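/- For every β > 0 there exists a constant C > 0 depending only on β such that for every integer n ≥ 1, every θ ∈ (0,π] and every λ ∈ [−2π√(β/8), 2π√(β/8)], | E[ e^{iλ(N_n(0,θ) − nθ/(2π))} ] − e^{−(λ²/(βπ²)) ln(2+nθ)} | ≤ C λ², where E denotes expectation with respect to μ_{β,n}. -/

import Mathlib

open MeasureTheory ProbabilityTheory Filter

noncomputable section

/-- The normalization constant `C_{β,n} = (2π)^n Γ(1+βn/2)/Γ(1+β/2)^n`. -/
def cbeConst (β : ℝ) (n : ℕ) : ℝ :=
  (2 * Real.pi) ^ n * Real.Gamma (1 + β * n / 2) / Real.Gamma (1 + β / 2) ^ n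

/-- The circular β-ensemble: the measure on `[0,2π)^n` with density
`(1/C_{β,n}) ∏_{j<k} |e^{iθ_j} − e^{iθ_k}|^β` with respect to Lebesgue measure. -/
def cbe (β : ℝ) (n : ℕ) : Measure (Fin n → ℝ) :=
  ((volume : Measure (Fin n → ℝ)).restrict
      (Set.univ.pi fun _ => Set.Ico 0 (2 * Real.pi))).withDensity
    (fun y => ENNReal.ofReal ((1 / cbeConst β n) *
      ∏ p ∈ Finset.univ.filter (fun p : Fin n × Fin n => p.1 < p.2),
        ‖Complex.exp (Complex.I * (y p.1 : ℂ)) - Complex.exp (Complex.I * (y p.2 : ℂ))‖ ^ β))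

/-- `countIn a b y` is the number of indices `j` with `y j ∈ [a, b)`. -/
def countIn {n : ℕ} (a b : ℝ) (y : Fin n → ℝ) : ℕ :=
  (Finset.univ.filter fun j => a ≤ y j ∧ y j < b).card

namespace CircularBeta

section

open Finset Polynomial

/-- The absolute value of the Vandermonde product. -/
def absVand {n : ℕ} (v : Fin n → ℝ) : ℝ :=
  ∏ p ∈ univ.filter (fun p : Fin n × Fin n => p.1 < p.2), |v p.2 - v p.1|

theorem absVand_nonneg {n : ℕ} (v : Fin n → ℝ) : 0 ≤ absVand v :=
  prod_nonneg fun _ _ => abs_nonneg _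

theorem absVand_eq_prod_prod {n : ℕ} (v : Fin n → ℝ) :
    absVand v = ∏ i, ∏ j ∈ Ioi i, |v j - v i| := by
  unfold absVand
  rw [prod_filter, ← univ_product_univ, prod_product]
  refine prod_congr rfl fun i _ => ?_
  rw [← prod_filter]
  refine prod_congr ?_ fun _ _ => rfl
  ext j; simp

theorem absVand_eq_abs_det {n : ℕ} (v : Fin n → ℝ) :
    absVand v = |(Matrix.vandermonde v).det| := by
  rw [Matrix.det_vandermonde, absVand_eq_prod_prod]
  simp only [abs_prod]

theorem absVand_pos {n : ℕ} {v : Fin n → ℝ} (hv : Function.Injective v) : 0 < absVand v := by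
  rw [absVand_eq_abs_det]
  exact abs_pos.2 (Matrix.det_vandermonde_ne_zero_iff.2 hv)

theorem absVand_cons {n : ℕ} (t : ℝ) (v : Fin n → ℝ) :
    absVand (Fin.cons t v : Fin (n + 1) → ℝ) = (∏ i, |t - v i|) * absVand v := by
  rw [absVand_eq_prod_prod, absVand_eq_prod_prod, Fin.prod_univ_succ]
  congr 1
  · simp [abs_sub_comm]
  · refine prod_congr rfl fun i _ => ?_
    simp

theorem prod_prod_erase_abs {n : ℕ} (v : Fin n → ℝ) :
    ∏ i, ∏ j ∈ univ.erase i, |v i - v j| = absVand v ^ 2 := by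
  have h1 : ∀ i : Fin n, ∏ j ∈ univ.erase i, |v i - v j| =
      (∏ j ∈ Iio i, |v i - v j|) * ∏ j ∈ Ioi i, |v i - v j| := by
    intro i
    rw [← prod_union]
    · refine prod_congr ?_ fun _ _ => rfl
      ext j; simp [lt_or_lt_iff_ne]
    · rw [disjoint_left]; intro j; simp; exact fun h => h.le
  simp_rw [h1, prod_mul_distrib]
  have h2 : ∏ i, ∏ j ∈ Ioi i, |v i - v j| = absVand v := by
    rw [absVand_eq_prod_prod]; simp_rw [abs_sub_comm]
  have h3 : ∏ i, ∏ j ∈ Iio i, |v i - v j| = absVand v := by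
    rw [absVand_eq_prod_prod, prod_comm' (t' := univ) (s' := fun j => Ioi j)]
    simp
  rw [h2, h3, sq]

/-- Column `0` holds `∏ (y i - b l)`, column `j + 1` the same product without the factor `j`. -/
def borderedCauchy {k : ℕ} (y : Fin (k + 1) → ℝ) (b : Fin k → ℝ) :
    Matrix (Fin (k + 1)) (Fin (k + 1)) ℝ :=
  Matrix.of fun i => Fin.cons (∏ l, (y i - b l)) fun j => ∏ l ∈ univ.erase j, (y i - b l)

theorem abs_det_borderedCauchy {k : ℕ} (y : Fin (k + 1) → ℝ) {b : Fin k → ℝ}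
    (hb : Function.Injective b) : |(borderedCauchy y b).det| = absVand y * absVand b := by
  let q : Fin (k + 1) → ℝ[X] :=
    Fin.cons (∏ l, (X - C (b l))) fun j => ∏ l ∈ univ.erase j, (X - C (b l))
  have hq : ∀ j, (q j).natDegree < k + 1 := by
    refine Fin.cases ?_ fun j => ?_
    · simp [q]
    · simp [q]
  let W : Matrix (Fin (k + 1)) (Fin (k + 1)) ℝ := Matrix.of fun i j => (q j).coeff i
  have hW : ∀ z : Fin (k + 1) → ℝ, borderedCauchy z b = Matrix.vandermonde z * W := by
    intro z
    ext i j
    have h1 : borderedCauchy z b i j = (q j).eval (z i) := by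
      refine Fin.cases ?_ (fun j => ?_) j <;> simp [borderedCauchy, q, eval_prod]
    rw [h1, eval_eq_sum_range' (hq j), Matrix.mul_apply, ← Fin.sum_univ_eq_sum_range
      (fun e => (q j).coeff e * z i ^ e)]
    refine sum_congr rfl fun e _ => ?_
    simp [W, Matrix.vandermonde_apply, mul_comm]
  obtain ⟨t, ht⟩ : ∃ t : ℝ, t ∉ Set.range b := by
    by_contra! h
    exact (Set.finite_range b).not_infinite (by
      rw [Set.eq_univ_of_forall h]; exact Set.infinite_univ)
  have ht' : 0 < ∏ l, |t - b l| :=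
    prod_pos fun l _ => abs_pos.2 (sub_ne_zero.2 fun h => ht ⟨l, h.symm⟩)
  have hdet : |(borderedCauchy (Fin.cons t b) b).det| = (∏ l, |t - b l|) * absVand b ^ 2 := by
    rw [Matrix.det_of_isUpperTriangular, Fin.prod_univ_succ, abs_mul]
    · congr 1
      · simp [borderedCauchy, abs_prod]
      · rw [← prod_prod_erase_abs]
        simp [borderedCauchy, abs_prod]
    · intro i j hij
      induction i using Fin.cases with
      | zero => exact absurd hij (Fin.not_lt_zero _)
      | succ i =>
        induction j using Fin.cases with
        | zero =>
          simp only [borderedCauchy, Matrix.of_apply, Fin.cons_succ, Fin.cons_zero]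
          exact prod_eq_zero (mem_univ i) (sub_self _)
        | succ j =>
          simp only [borderedCauchy, Matrix.of_apply, Fin.cons_succ]
          refine prod_eq_zero (i := i) ?_ (sub_self _)
          rw [mem_erase]
          refine ⟨?_, mem_univ _⟩
          rintro rfl
          exact lt_irrefl _ hij
  have hWdet : |W.det| = absVand b := by
    rw [hW, Matrix.det_mul, abs_mul, ← absVand_eq_abs_det, absVand_cons] at hdet
    have := absVand_pos hb
    have h : (∏ i, |t - b i|) * absVand b * |W.det| = (∏ i, |t - b i|) * absVand b * absVand b := by
      rw [hdet]; ring
    exact mul_left_cancel₀ (by positivity) h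
  rw [hW, Matrix.det_mul, abs_mul, ← absVand_eq_abs_det, hWdet]

/-- The points of `b` separate consecutive points of `y`. -/
def Interlace {k : ℕ} (y : Fin (k + 1) → ℝ) (b : Fin k → ℝ) : Prop :=
  ∀ j, y j.castSucc < b j ∧ b j < y j.succ

theorem Interlace.strictMono_left {k : ℕ} {y : Fin (k + 1) → ℝ} {b : Fin k → ℝ}
    (h : Interlace y b) : StrictMono y :=
  Fin.strictMono_iff_lt_succ.2 fun j => (h j).1.trans (h j).2

theorem Interlace.lt_of_lt {k : ℕ} {y : Fin (k + 1) → ℝ} {b : Fin k → ℝ}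
    (h : Interlace y b) {i : Fin (k + 1)} {j : Fin k} (hij : j.castSucc < i) : b j < y i :=
  (h j).2.trans_le (h.strictMono_left.monotone (by rw [Fin.le_def, Fin.val_succ]; exact hij))

theorem Interlace.lt_of_le {k : ℕ} {y : Fin (k + 1) → ℝ} {b : Fin k → ℝ}
    (h : Interlace y b) {i : Fin (k + 1)} {j : Fin k} (hij : i ≤ j.castSucc) : y i < b j :=
  (h.strictMono_left.monotone hij).trans_lt (h j).1

theorem Interlace.strictMono_right {k : ℕ} {y : Fin (k + 1) → ℝ} {b : Fin k → ℝ}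
    (h : Interlace y b) : StrictMono b := by
  intro i j hij
  refine (h i).2.trans (h.lt_of_le ?_)
  rw [Fin.le_def, Fin.val_succ, Fin.val_castSucc]
  exact hij

theorem Interlace.ne {k : ℕ} {y : Fin (k + 1) → ℝ} {b : Fin k → ℝ}
    (h : Interlace y b) (i : Fin (k + 1)) (j : Fin k) : y i ≠ b j := by
  rcases lt_or_ge j.castSucc i with hij | hij
  · exact (h.lt_of_lt hij).ne'
  · exact (h.lt_of_le hij).ne

theorem prod_erase_eq_prod_succAbove {k : ℕ} (i : Fin (k + 1)) (f : Fin (k + 1) → ℝ) :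
    ∏ l ∈ univ.erase i, f l = ∏ j, f (i.succAbove j) := by
  have : (univ.erase i : Finset (Fin (k + 1))) = univ.map (Fin.succAboveEmb i) := by
    rw [Fin.univ_succAbove k i]; simp
  rw [this, prod_map]; rfl

theorem Interlace.div_pos {k : ℕ} {y : Fin (k + 1) → ℝ} {b : Fin k → ℝ}
    (h : Interlace y b) (i : Fin (k + 1)) (j : Fin k) :
    0 < (y i - b j) / (y i - y (i.succAbove j)) := by
  have hy := h.strictMono_left
  rcases lt_or_ge j.castSucc i with hij | hij
  · rw [Fin.succAbove_of_castSucc_lt _ _ hij]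
    exact _root_.div_pos (sub_pos.2 (h.lt_of_lt hij)) (sub_pos.2 (hy hij))
  · rw [Fin.succAbove_of_le_castSucc _ _ hij]
    refine div_pos_of_neg_of_neg (sub_neg.2 (h.lt_of_le hij)) (sub_neg.2 (hy ?_))
    exact lt_of_le_of_lt hij (Fin.castSucc_lt_succ)

theorem Interlace.residue_pos {k : ℕ} {y : Fin (k + 1) → ℝ} {b : Fin k → ℝ}
    (h : Interlace y b) (i : Fin (k + 1)) :
    0 < (∏ j, (y i - b j)) / ∏ j ∈ univ.erase i, (y i - y j) := by
  rw [prod_erase_eq_prod_succAbove i fun l => y i - y l, ← prod_div_distrib]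
  exact prod_pos fun j _ => h.div_pos i j

theorem Interlace.residue_neg {k : ℕ} {y : Fin (k + 1) → ℝ} {b : Fin k → ℝ}
    (h : Interlace y b) (j : Fin k) :
    (∏ i, (b j - y i)) / ∏ l ∈ univ.erase j, (b j - b l) < 0 := by
  have hb := h.strictMono_right
  rw [Fin.prod_univ_succAbove _ j.succ, ← mul_prod_erase univ _ (mem_univ j), ← mul_assoc,
    mul_div_assoc, ← prod_div_distrib]
  refine mul_neg_of_neg_of_pos ?_ (prod_pos fun l hl => ?_)
  · rw [Fin.succAbove_of_castSucc_lt _ _ Fin.castSucc_lt_succ]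
    exact mul_neg_of_neg_of_pos (sub_neg.2 (h j).2) (sub_pos.2 (h j).1)
  · rcases lt_or_gt_of_ne (ne_of_mem_erase hl) with hlj | hlj
    · rw [Fin.succAbove_of_castSucc_lt]
      · refine _root_.div_pos (sub_pos.2 ?_) (sub_pos.2 (hb hlj))
        exact h.lt_of_le (Fin.castSucc_le_castSucc_iff.2 hlj.le)
      · exact lt_trans (Fin.castSucc_lt_castSucc_iff.2 hlj) Fin.castSucc_lt_succ
    · rw [Fin.succAbove_of_le_castSucc]
      · refine div_pos_of_neg_of_neg (sub_neg.2 ?_) (sub_neg.2 (hb hlj))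
        exact h.lt_of_lt (lt_trans (Fin.castSucc_lt_castSucc_iff.2 hlj) Fin.castSucc_lt_succ)
      · rw [Fin.le_def, Fin.val_succ, Fin.val_castSucc]; exact hlj

theorem exists_interlace_roots {k : ℕ} {y : Fin (k + 1) → ℝ} (hy : StrictMono y) {f : ℝ → ℝ}
    (hf : Continuous f) (hs : ∀ i, 0 < f (y i) / ∏ j ∈ univ.erase i, (y i - y j)) :
    ∃ x : Fin k → ℝ, Interlace y x ∧ ∀ j, f (x j) = 0 := by
  let m : Fin k → ℝ := fun j => (y j.castSucc + y j.succ) / 2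
  have hm : Interlace y m := fun j => by
    have := hy (Fin.castSucc_lt_succ (i := j))
    constructor <;> simp only [m] <;> linarith
  have key : ∀ j : Fin k, f (y j.castSucc) * f (y j.succ) < 0 := by
    intro j
    have h1 : ∀ i, 0 < f (y i) * ∏ l, (y i - m l) := by
      intro i
      have h2 := mul_pos (hs i) (hm.residue_pos i)
      rw [div_mul_div_comm] at h2
      exact (pos_iff_pos_of_mul_pos (by
        have h3 := mul_pos h2 (mul_self_pos.2 (fun h => by
          rw [h] at h2; simp at h2 : ∏ j ∈ univ.erase i, (y i - y j) ≠ 0))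
        have h4 : (f (y i) * ∏ l, (y i - m l)) / ((∏ j ∈ univ.erase i, (y i - y j)) *
          ∏ j ∈ univ.erase i, (y i - y j)) * ((∏ j ∈ univ.erase i, (y i - y j)) *
          ∏ j ∈ univ.erase i, (y i - y j)) = f (y i) * ∏ l, (y i - m l) :=
          div_mul_cancel₀ _ (fun h => by rw [h] at h2; simp at h2)
        rw [h4] at h3
        nlinarith : 0 < (f (y i) * ∏ l, (y i - m l)) * 1)).2 one_pos
    have h2 : (∏ l, (y j.castSucc - m l)) * ∏ l, (y j.succ - m l) < 0 := by
      rw [← prod_mul_distrib, ← mul_prod_erase univ _ (mem_univ j)]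
      refine mul_neg_of_neg_of_pos ?_ (prod_pos fun l hl => ?_)
      · exact mul_neg_of_neg_of_pos (sub_neg.2 (hm j).1) (sub_pos.2 (hm j).2)
      · rcases lt_or_gt_of_ne (ne_of_mem_erase hl) with hlj | hlj
        · refine mul_pos (sub_pos.2 (hm.lt_of_lt ?_)) (sub_pos.2 (hm.lt_of_lt ?_))
          · exact Fin.castSucc_lt_castSucc_iff.2 hlj
          · exact lt_trans (Fin.castSucc_lt_castSucc_iff.2 hlj) Fin.castSucc_lt_succ
        · refine mul_pos_of_neg_of_neg (sub_neg.2 (hm.lt_of_le ?_)) (sub_neg.2 (hm.lt_of_le ?_))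
          · exact Fin.castSucc_le_castSucc_iff.2 hlj.le
          · rw [Fin.le_def, Fin.val_succ, Fin.val_castSucc]; exact hlj
    have h3 := mul_pos (h1 j.castSucc) (h1 j.succ)
    by_contra! h4
    nlinarith [mul_nonneg_of_nonpos_of_nonpos (neg_nonpos.2 h4) h2.le]
  have hx : ∀ j : Fin k, ∃ x, y j.castSucc < x ∧ x < y j.succ ∧ f x = 0 := by
    intro j
    have hlt := hy (Fin.castSucc_lt_succ (i := j))
    rcases mul_neg_iff.1 (key j) with ⟨h1, h2⟩ | ⟨h1, h2⟩
    · obtain ⟨x, hx, h0⟩ := intermediate_value_Ioo' hlt.le hf.continuousOn ⟨h2, h1⟩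
      exact ⟨x, hx.1, hx.2, h0⟩
    · obtain ⟨x, hx, h0⟩ := intermediate_value_Ioo hlt.le hf.continuousOn ⟨h1, h2⟩
      exact ⟨x, hx.1, hx.2, h0⟩
  choose x h1 h2 h3 using hx
  exact ⟨x, fun j => ⟨h1 j, h2 j⟩, h3⟩

theorem eval_prod_erase {ι : Type*} [Fintype ι] [DecidableEq ι] (b : ι → ℝ) (i j : ι) :
    (∏ l ∈ univ.erase j, (X - C (b l)) : ℝ[X]).eval (b i) =
      if i = j then ∏ l ∈ univ.erase i, (b i - b l) else 0 := by
  rw [eval_prod]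
  split_ifs with h
  · subst h; simp
  · exact prod_eq_zero (mem_erase.2 ⟨h, mem_univ i⟩) (by simp)

theorem eval_sum_prod_erase {ι : Type*} [Fintype ι] [DecidableEq ι] (b v : ι → ℝ) (i : ι) :
    (∑ j, C (v j) * ∏ l ∈ univ.erase j, (X - C (b l)) : ℝ[X]).eval (b i) =
      v i * ∏ l ∈ univ.erase i, (b i - b l) := by
  rw [eval_finsetSum]
  simp only [eval_mul, eval_C, eval_prod_erase, mul_ite, mul_zero, sum_ite_eq, mem_univ, if_true]

theorem degree_C_mul_le' (r : ℝ) (p : ℝ[X]) : (C r * p).degree ≤ p.degree := by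
  rw [← smul_eq_C_mul]; exact degree_smul_le r p

theorem degree_sum_prod_erase_lt {k : ℕ} (b v : Fin k → ℝ) :
    (∑ j, C (v j) * ∏ l ∈ univ.erase j, (X - C (b l)) : ℝ[X]).degree < k := by
  refine mem_degreeLT.1 (Submodule.sum_mem _ fun j _ => mem_degreeLT.2 ?_)
  refine (degree_C_mul_le' _ _).trans_lt ?_
  rw [degree_prod]
  simp only [degree_X_sub_C, sum_const, card_erase_of_mem (mem_univ j), card_univ,
    Fintype.card_fin, nsmul_eq_mul, mul_one]
  have : 0 < k := j.pos
  exact_mod_cast Nat.sub_lt this one_pos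

theorem prod_erase_sub_ne_zero {ι : Type*} [Fintype ι] [DecidableEq ι] {b : ι → ℝ}
    (hb : Function.Injective b) (i : ι) : ∏ l ∈ univ.erase i, (b i - b l) ≠ 0 :=
  prod_ne_zero_iff.2 fun _ hl => sub_ne_zero.2 (hb.ne (ne_of_mem_erase hl).symm)

/-- Lagrange interpolation in weight form. -/
theorem eq_sum_prod_erase {k : ℕ} {b : Fin k → ℝ} (hb : Function.Injective b) {p : ℝ[X]}
    (hp : p.degree < k) :
    p = ∑ j, C (p.eval (b j) / ∏ l ∈ univ.erase j, (b j - b l)) *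
      ∏ l ∈ univ.erase j, (X - C (b l)) := by
  refine eq_of_degrees_lt_of_eval_index_eq (s := univ) (v := b) hb.injOn (by simpa using hp)
    (by simpa using degree_sum_prod_erase_lt b _) fun i _ => ?_
  rw [eval_sum_prod_erase, div_mul_cancel₀ _ (prod_erase_sub_ne_zero hb i)]

theorem degree_C_mul_prod_lt {k : ℕ} (r : ℝ) (b : Fin k → ℝ) :
    (C r * ∏ j, (X - C (b j)) : ℝ[X]).degree < (k + 1 : ℕ) := by
  refine (degree_C_mul_le' _ _).trans_lt ?_
  rw [degree_prod]
  simp only [degree_X_sub_C, sum_const, card_univ, Fintype.card_fin, nsmul_eq_mul, mul_one]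
  exact_mod_cast Nat.lt_succ_self k

theorem degree_prod_sub_lt {k : ℕ} {b y : Fin (k + 1) → ℝ} (h : ∑ i, b i = ∑ i, y i) :
    (∏ i, (X - C (y i)) - ∏ i, (X - C (b i)) : ℝ[X]).degree < k := by
  rw [degree_lt_iff_coeff_zero]
  intro m hm
  rw [coeff_sub, sub_eq_zero]
  have hd : ∀ z : Fin (k + 1) → ℝ, (∏ i, (X - C (z i)) : ℝ[X]).natDegree = k + 1 := fun z => by
    rw [natDegree_prod_of_monic _ _ fun i _ => monic_X_sub_C _]; simp
  have hM : ∀ z : Fin (k + 1) → ℝ, (∏ i, (X - C (z i)) : ℝ[X]).Monic := fun z =>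
    monic_prod_of_monic _ _ fun i _ => monic_X_sub_C _
  rcases hm.eq_or_lt with rfl | hm
  · have hn : ∀ z : Fin (k + 1) → ℝ, (∏ i, (X - C (z i)) : ℝ[X]).coeff k = -∑ i, z i := fun z => by
      rw [← prod_X_sub_C_nextCoeff, nextCoeff_of_natDegree_pos (by rw [hd]; omega), hd]; rfl
    rw [hn, hn, h]
  · rcases (Nat.succ_le_iff.2 hm).eq_or_lt with rfl | hm
    · have h1 : ∀ z : Fin (k + 1) → ℝ, (∏ i, (X - C (z i)) : ℝ[X]).coeff (k + 1) = 1 := fun z => by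
        have := (hM z).coeff_natDegree
        rwa [hd] at this
      rw [Nat.succ_eq_add_one, h1, h1]
    · rw [coeff_eq_zero_of_natDegree_lt (by rw [hd]; exact hm),
        coeff_eq_zero_of_natDegree_lt (by rw [hd]; exact hm)]

/-- Expansion of `∏ (X - y i)` around the zeros `b`. -/
theorem prod_eq_add_sum {k : ℕ} {b : Fin k → ℝ} (hb : Function.Injective b)
    (y : Fin (k + 1) → ℝ) :
    (∏ i, (X - C (y i)) : ℝ[X]) = (X + C (∑ j, b j - ∑ i, y i)) * ∏ j, (X - C (b j)) +
      ∑ j, C ((∏ i, (b j - y i)) / ∏ l ∈ univ.erase j, (b j - b l)) *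
        ∏ l ∈ univ.erase j, (X - C (b l)) := by
  set c := ∑ j, b j - ∑ i, y i with hc
  let b' : Fin (k + 1) → ℝ := Fin.cons (-c) b
  have hb' : (∏ i, (X - C (b' i)) : ℝ[X]) = (X + C c) * ∏ j, (X - C (b j)) := by
    rw [Fin.prod_univ_succ]; simp [b']
  have hdeg := degree_prod_sub_lt (b := b') (y := y) (by rw [Fin.sum_univ_succ]; simp [b', hc])
  have := eq_sum_prod_erase hb hdeg
  rw [hb'] at this
  rw [← sub_eq_iff_eq_add', this]
  refine sum_congr rfl fun j _ => ?_
  congr 3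
  simp only [eval_sub, eval_mul, eval_prod, eval_X, eval_C]
  rw [prod_eq_zero (i := j) (mem_univ j) (sub_self _)]
  simp

theorem hasFDerivAt_of_matrix {n : ℕ} {f : (Fin n → ℝ) → Fin n → ℝ} {z : Fin n → ℝ}
    (M : Matrix (Fin n) (Fin n) ℝ)
    (h : ∀ i, HasFDerivAt (fun z => f z i)
      (∑ j, M i j • (ContinuousLinearMap.proj j : (Fin n → ℝ) →L[ℝ] ℝ)) z) :
    HasFDerivAt f (LinearMap.toContinuousLinearMap (Matrix.toLin' M)) z := by
  refine hasFDerivAt_pi'.2 fun i => (h i).congr_fderiv ?_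
  ext v
  simp [Matrix.mulVec, dotProduct]

theorem det_toContinuousLinearMap_toLin' {n : ℕ} (M : Matrix (Fin n) (Fin n) ℝ) :
    (LinearMap.toContinuousLinearMap (Matrix.toLin' M)).det = M.det := by
  rw [ContinuousLinearMap.det, LinearMap.coe_toContinuousLinearMap, LinearMap.det_toLin']

/-- The weight at `y i` in the partial fraction expansion of `∏ (x - b j) / ∏ (x - y i)`. -/
def spectralWeight {k : ℕ} (y : Fin (k + 1) → ℝ) (b : Fin k → ℝ) (i : Fin (k + 1)) : ℝ :=
  (∏ j, (y i - b j)) / ∏ l ∈ univ.erase i, (y i - y l)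

theorem sum_coeff_prod_erase {k : ℕ} (y v : Fin (k + 1) → ℝ) :
    (∑ i, C (v i) * ∏ l ∈ univ.erase i, (X - C (y l)) : ℝ[X]).coeff k = ∑ i, v i := by
  rw [finsetSum_coeff]
  refine sum_congr rfl fun i _ => ?_
  rw [coeff_C_mul]
  have hM : (∏ l ∈ univ.erase i, (X - C (y l)) : ℝ[X]).Monic :=
    monic_prod_of_monic _ _ fun i _ => monic_X_sub_C _
  have hd : (∏ l ∈ univ.erase i, (X - C (y l)) : ℝ[X]).natDegree = k := by
    rw [natDegree_prod_of_monic _ _ fun i _ => monic_X_sub_C _]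
    simp [card_erase_of_mem]
  have := hM.coeff_natDegree
  rw [hd] at this
  rw [this, mul_one]

theorem monic_prod_X_sub_C_coeff {k : ℕ} (b : Fin k → ℝ) :
    (∏ j, (X - C (b j)) : ℝ[X]).coeff k = 1 := by
  have hM : (∏ j, (X - C (b j)) : ℝ[X]).Monic :=
    monic_prod_of_monic _ _ fun i _ => monic_X_sub_C _
  have hd : (∏ j, (X - C (b j)) : ℝ[X]).natDegree = k := by
    rw [natDegree_prod_of_monic _ _ fun i _ => monic_X_sub_C _]; simp
  have := hM.coeff_natDegree
  rwa [hd] at this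

theorem prod_eq_sum_spectralWeight {k : ℕ} {y : Fin (k + 1) → ℝ} (hy : Function.Injective y)
    (b : Fin k → ℝ) :
    (∏ j, (X - C (b j)) : ℝ[X]) =
      ∑ i, C (spectralWeight y b i) * ∏ l ∈ univ.erase i, (X - C (y l)) := by
  have h := eq_sum_prod_erase hy (p := ∏ j, (X - C (b j)))
    (by simpa using degree_C_mul_prod_lt 1 b)
  simpa [eval_prod, spectralWeight] using h

theorem sum_spectralWeight {k : ℕ} {y : Fin (k + 1) → ℝ} (hy : Function.Injective y)
    (b : Fin k → ℝ) : ∑ i, spectralWeight y b i = 1 := by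
  rw [← sum_coeff_prod_erase y, ← prod_eq_sum_spectralWeight hy, monic_prod_X_sub_C_coeff]

theorem sum_spectralWeight_mul {k : ℕ} {y : Fin (k + 1) → ℝ} (hy : Function.Injective y)
    (b : Fin k → ℝ) : ∑ i, spectralWeight y b i * y i = ∑ i, y i - ∑ j, b j := by
  obtain ⟨c, hc⟩ : ∃ c, c = ∑ i, y i - ∑ j, b j := ⟨_, rfl⟩
  rw [← hc]
  have hdeg : ((X - C c) * ∏ j, (X - C (b j)) - ∏ i, (X - C (y i)) : ℝ[X]).degree < k := by
    have := degree_prod_sub_lt (y := Fin.cons c b) (b := y)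
      (by rw [Fin.sum_univ_succ (Fin.cons c b : Fin (k + 1) → ℝ)]; simp [hc])
    rw [Fin.prod_univ_succ] at this
    simpa using this
  have h1 : ((X - C c) * ∏ j, (X - C (b j)) - ∏ i, (X - C (y i)) : ℝ[X]) =
      ∑ i, C (spectralWeight y b i * (y i - c)) * ∏ l ∈ univ.erase i, (X - C (y l)) := by
    have h2 : (∏ i, (X - C (y i)) : ℝ[X]) =
        ∑ i, C (spectralWeight y b i) * ∏ l, (X - C (y l)) := by
      rw [← sum_mul, ← map_sum, sum_spectralWeight hy, map_one, one_mul]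
    rw [prod_eq_sum_spectralWeight hy, h2, mul_sum, ← sum_sub_distrib]
    refine sum_congr rfl fun i _ => ?_
    rw [← mul_prod_erase univ _ (mem_univ i), map_mul (C (R := ℝ)), map_sub (C (R := ℝ))]
    ring
  have h3 := sum_coeff_prod_erase y fun i => spectralWeight y b i * (y i - c)
  rw [← h1, coeff_eq_zero_of_degree_lt hdeg] at h3
  simp only [mul_sub, sum_sub_distrib, ← sum_mul, sum_spectralWeight hy, one_mul] at h3
  linarith

theorem eval_eq_of_ne {k : ℕ} (y v : Fin k → ℝ) {x : ℝ}
    (hx : ∀ i, x ≠ y i) :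
    (∑ i, C (v i) * ∏ l ∈ univ.erase i, (X - C (y l)) : ℝ[X]).eval x =
      (∑ i, v i / (x - y i)) * ∏ i, (x - y i) := by
  rw [eval_finsetSum, sum_mul]
  refine sum_congr rfl fun i _ => ?_
  rw [← mul_prod_erase univ _ (mem_univ i), eval_mul, eval_C, eval_prod]
  simp only [eval_sub, eval_X, eval_C]
  rw [← mul_assoc, div_mul_cancel₀ _ (sub_ne_zero.2 (hx i))]

theorem sum_spectralWeight_div {k : ℕ} {y : Fin (k + 1) → ℝ} (hy : Function.Injective y)
    (b : Fin k → ℝ) {x : ℝ} (hx : ∀ i, x ≠ y i) :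
    ∑ i, spectralWeight y b i / (x - y i) = (∏ j, (x - b j)) / ∏ i, (x - y i) := by
  rw [eq_div_iff (prod_ne_zero_iff.2 fun i _ => sub_ne_zero.2 (hx i)), ← eval_eq_of_ne y _ hx,
    ← prod_eq_sum_spectralWeight hy, eval_prod]
  simp

theorem Interlace.spectralWeight_pos {k : ℕ} {y : Fin (k + 1) → ℝ} {b : Fin k → ℝ}
    (h : Interlace y b) (i : Fin (k + 1)) : 0 < spectralWeight y b i := h.residue_pos i

theorem Interlace.unique_right {k : ℕ} {y : Fin (k + 1) → ℝ} {b b' : Fin k → ℝ}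
    (h : Interlace y b) (h' : Interlace y b')
    (hp : ∀ x : ℝ, ∏ j, (x - b j) = ∏ j, (x - b' j)) : b = b' := by
  ext j
  have h1 := hp (b j)
  rw [prod_eq_zero (mem_univ j) (sub_self _)] at h1
  obtain ⟨l, -, hl⟩ := prod_eq_zero_iff.1 h1.symm
  have hl' : b j = b' l := sub_eq_zero.1 hl
  rcases lt_trichotomy j l with hlt | rfl | hlt
  · have := (h'.strictMono_left.monotone (Fin.le_def.2 (by
      rw [Fin.val_succ, Fin.val_castSucc]; exact hlt) : j.succ ≤ l.castSucc))
    linarith [(h j).2, (h' l).1]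
  · exact hl'
  · have := (h'.strictMono_left.monotone (Fin.le_def.2 (by
      rw [Fin.val_succ, Fin.val_castSucc]; exact hlt) : l.succ ≤ j.castSucc))
    linarith [(h j).1, (h' l).2]

theorem Interlace.unique_left {k : ℕ} {y y' : Fin (k + 1) → ℝ} {b : Fin k → ℝ}
    (h : Interlace y b) (h' : Interlace y' b)
    (hp : ∀ x : ℝ, ∏ j, (x - y j) = ∏ j, (x - y' j)) : y = y' := by
  ext i
  have h1 := hp (y i)
  rw [prod_eq_zero (mem_univ i) (sub_self _)] at h1
  obtain ⟨l, -, hl⟩ := prod_eq_zero_iff.1 h1.symm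
  have hl' : y i = y' l := sub_eq_zero.1 hl
  rcases lt_trichotomy i l with hlt | rfl | hlt
  · obtain ⟨j, rfl⟩ := Fin.exists_castSucc_eq.2 (ne_of_lt (hlt.trans_le (Fin.le_last l)))
    linarith [h.lt_of_le (le_refl j.castSucc), h'.lt_of_lt hlt]
  · exact hl'
  · obtain ⟨j, rfl⟩ := Fin.exists_castSucc_eq.2 (ne_of_lt (hlt.trans_le (Fin.le_last i)))
    linarith [h'.lt_of_le (le_refl j.castSucc), h.lt_of_lt hlt]

theorem measurableSet_interlace_right {k : ℕ} (y : Fin (k + 1) → ℝ) :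
    MeasurableSet {b : Fin k → ℝ | Interlace y b} := by
  have : {b : Fin k → ℝ | Interlace y b} = Set.univ.pi fun j => Set.Ioo (y j.castSucc) (y j.succ)
      := by
    ext b; simp [Interlace]
  rw [this]
  exact MeasurableSet.univ_pi fun j => measurableSet_Ioo

theorem measurableSet_interlace_left {k : ℕ} (b : Fin k → ℝ) :
    MeasurableSet {y : Fin (k + 1) → ℝ | Interlace y b} := by
  simp only [Interlace, Set.ofPred_forall]
  refine MeasurableSet.iInter fun j => ?_
  exact (measurableSet_lt (measurable_pi_apply _) measurable_const).inter
    (measurableSet_lt measurable_const (measurable_pi_apply _))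

theorem piFinSuccAbove_symm_eq_cons {k : ℕ} (p : ℝ × (Fin k → ℝ)) :
    (MeasurableEquiv.piFinSuccAbove (fun _ : Fin (k + 1) => ℝ) 0).symm p =
      Fin.cons p.1 p.2 := by
  refine funext (Fin.cases ?_ fun j => ?_) <;> simp [MeasurableEquiv.piFinSuccAbove]

theorem measurePreserving_cons (k : ℕ) : MeasurePreserving
    (fun p : ℝ × (Fin k → ℝ) => (Fin.cons p.1 p.2 : Fin (k + 1) → ℝ)) := by
  have h := (volume_preserving_piFinSuccAbove (fun _ : Fin (k + 1) => ℝ) 0).symm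
  rwa [funext piFinSuccAbove_symm_eq_cons] at h

theorem measurableEmbedding_cons (k : ℕ) : MeasurableEmbedding
    (fun p : ℝ × (Fin k → ℝ) => (Fin.cons p.1 p.2 : Fin (k + 1) → ℝ)) := by
  have h := (MeasurableEquiv.piFinSuccAbove (fun _ : Fin (k + 1) => ℝ) 0).symm.measurableEmbedding
  rwa [funext piFinSuccAbove_symm_eq_cons] at h

@[fun_prop]
theorem measurable_absVand {k : ℕ} : Measurable (absVand : (Fin k → ℝ) → ℝ) := by
  unfold absVand; fun_prop

/-- Jacobian matrix of `(r, b) ↦ r • spectralWeight y b`. -/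
theorem hasFDerivAt_smul_spectralWeight {k : ℕ} (y : Fin (k + 1) → ℝ) (z : Fin (k + 1) → ℝ) :
    HasFDerivAt (fun z : Fin (k + 1) → ℝ => z 0 • spectralWeight y (Fin.tail z))
      (LinearMap.toContinuousLinearMap (Matrix.toLin'
        (Matrix.diagonal (fun i => (∏ l ∈ univ.erase i, (y i - y l))⁻¹) *
          (borderedCauchy y (Fin.tail z) * Matrix.diagonal (Fin.cons 1 fun _ => -z 0))))) z := by
  refine hasFDerivAt_of_matrix _ fun i => ?_
  have h1 : ∀ j : Fin k, HasFDerivAt (fun z : Fin (k + 1) → ℝ => y i - z j.succ)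
      (-(ContinuousLinearMap.proj j.succ : (Fin (k + 1) → ℝ) →L[ℝ] ℝ)) z := fun j =>
    (hasFDerivAt_apply (𝕜 := ℝ) j.succ z).const_sub (y i)
  have h0 : HasFDerivAt (fun z : Fin (k + 1) → ℝ => z 0)
      (ContinuousLinearMap.proj 0 : (Fin (k + 1) → ℝ) →L[ℝ] ℝ) z := hasFDerivAt_apply 0 z
  have h2 := HasFDerivAt.finsetProd (u := univ) fun j _ => h1 j
  have h3 := (h0.mul h2).mul_const (∏ l ∈ univ.erase i, (y i - y l))⁻¹
  refine (h3.congr_of_eventuallyEq (Eventually.of_forall fun z => ?_)).congr_fderiv ?_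
  · simp [spectralWeight, Fin.tail, div_eq_mul_inv, mul_assoc]
  · rw [Fin.sum_univ_succ]
    simp only [Matrix.diagonal_mul, Matrix.mul_diagonal, borderedCauchy, Matrix.of_apply,
      Fin.cons_zero, Fin.cons_succ, smul_add, smul_sum, Fin.tail]
    refine (add_comm _ _).trans ?_
    congr 1
    · rw [mul_one, smul_smul]
    · refine sum_congr rfl fun j _ => ?_
      ext v
      simp
      ring

theorem abs_prod_prod_erase_inv {n : ℕ} (v : Fin n → ℝ) :
    |∏ i, (∏ l ∈ univ.erase i, (v i - v l))⁻¹| = (absVand v ^ 2)⁻¹ := by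
  rw [prod_inv_distrib, abs_inv, abs_prod, ← prod_prod_erase_abs]
  simp only [abs_prod]

theorem abs_det_smul_spectralWeight {k : ℕ} {y : Fin (k + 1) → ℝ} {z : Fin (k + 1) → ℝ}
    (hz : 0 < z 0) (h : Interlace y (Fin.tail z)) :
    |(LinearMap.toContinuousLinearMap (Matrix.toLin'
        (Matrix.diagonal (fun i => (∏ l ∈ univ.erase i, (y i - y l))⁻¹) *
          (borderedCauchy y (Fin.tail z) * Matrix.diagonal (Fin.cons 1 fun _ => -z 0))))).det| =
      z 0 ^ k * (absVand (Fin.tail z) / absVand y) := by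
  rw [det_toContinuousLinearMap_toLin', Matrix.det_mul, Matrix.det_mul, Matrix.det_diagonal,
    Matrix.det_diagonal, abs_mul, abs_mul, abs_prod_prod_erase_inv,
    abs_det_borderedCauchy _ h.strictMono_right.injective, Fin.prod_univ_succ]
  have := absVand_pos h.strictMono_left.injective
  simp [abs_of_pos hz]
  field_simp

theorem image_smul_spectralWeight {k : ℕ} {y : Fin (k + 1) → ℝ} (hy : StrictMono y) :
    (fun z : Fin (k + 1) → ℝ => z 0 • spectralWeight y (Fin.tail z)) ''
      {z | 0 < z 0 ∧ Interlace y (Fin.tail z)} = {g | ∀ i, 0 < g i} := by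
  ext g
  constructor
  · rintro ⟨z, ⟨hz, h⟩, rfl⟩ i
    exact mul_pos hz (h.spectralWeight_pos i)
  · intro hg
    obtain ⟨b, hb, hb0⟩ := exists_interlace_roots hy
      (f := fun x => (∑ i, C (g i) * ∏ l ∈ univ.erase i, (X - C (y l)) : ℝ[X]).eval x)
      (Polynomial.continuous _) fun i => by
        rw [eval_sum_prod_erase, mul_div_cancel_right₀ _ (prod_erase_sub_ne_zero hy.injective i)]
        exact hg i
    have hS : 0 < ∑ i, g i := sum_pos (fun i _ => hg i) univ_nonempty
    refine ⟨Fin.cons (∑ i, g i) b, ⟨by simpa using hS, by simpa using hb⟩, ?_⟩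
    have hlow : (∑ i, C (g i) * ∏ l ∈ univ.erase i, (X - C (y l)) -
        C (∑ i, g i) * ∏ j, (X - C (b j)) : ℝ[X]) = 0 := by
      refine eq_zero_of_degree_lt_of_eval_finset_eq_zero (univ.image b) ?_ ?_
      · rw [card_image_of_injective _ hb.strictMono_right.injective, card_univ, Fintype.card_fin,
          degree_lt_iff_coeff_zero]
        intro m hm
        rw [coeff_sub]
        rcases hm.eq_or_lt with rfl | hm
        · rw [sum_coeff_prod_erase, coeff_C_mul, monic_prod_X_sub_C_coeff, mul_one, sub_self]
        · rw [(degree_lt_iff_coeff_zero _ _).1 (degree_sum_prod_erase_lt y g) m hm,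
            (degree_lt_iff_coeff_zero _ _).1 (degree_C_mul_prod_lt _ b) m hm, sub_zero]
      · intro x hx
        obtain ⟨j, -, rfl⟩ := mem_image.1 hx
        rw [eval_sub, hb0 j, eval_mul, eval_prod, prod_eq_zero (mem_univ j) (by simp)]
        simp
    ext i
    have h1 := congrArg (fun p : ℝ[X] => p.eval (y i)) (sub_eq_zero.1 hlow)
    simp only [eval_sum_prod_erase, eval_mul, eval_C, eval_prod, eval_sub, eval_X] at h1
    simp only [Fin.cons_zero, Fin.tail_cons, Pi.smul_apply, smul_eq_mul, spectralWeight]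
    rw [← mul_div_assoc, ← h1, mul_div_cancel_right₀ _ (prod_erase_sub_ne_zero hy.injective i)]

theorem injOn_smul_spectralWeight {k : ℕ} {y : Fin (k + 1) → ℝ} (hy : StrictMono y) :
    Set.InjOn (fun z : Fin (k + 1) → ℝ => z 0 • spectralWeight y (Fin.tail z))
      {z | 0 < z 0 ∧ Interlace y (Fin.tail z)} := by
  intro z hz z' hz' h
  have hsum := congrArg (fun g : Fin (k + 1) → ℝ => ∑ i, g i) h
  simp only [Pi.smul_apply, smul_eq_mul, ← mul_sum, sum_spectralWeight hy.injective, mul_one]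
    at hsum
  have hw : spectralWeight y (Fin.tail z) = spectralWeight y (Fin.tail z') := by
    have h' : z 0 • spectralWeight y (Fin.tail z) = z' 0 • spectralWeight y (Fin.tail z') := h
    rw [hsum] at h'
    exact smul_right_injective _ hz'.1.ne' h'
  have ht : Fin.tail z = Fin.tail z' := by
    refine hz.2.unique_right hz'.2 fun x => ?_
    have h1 := prod_eq_sum_spectralWeight hy.injective (Fin.tail z)
    rw [hw, ← prod_eq_sum_spectralWeight hy.injective] at h1
    simpa [eval_prod] using congrArg (fun p : ℝ[X] => p.eval x) h1
  rw [← Fin.cons_self_tail z, ← Fin.cons_self_tail z', ht, hsum]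

@[fun_prop]
theorem measurable_spectralWeight {α : Type*} [MeasurableSpace α] {k : ℕ}
    {y : α → Fin (k + 1) → ℝ} {b : α → Fin k → ℝ} (hy : Measurable y) (hb : Measurable b) :
    Measurable fun a => spectralWeight (y a) (b a) := by
  unfold spectralWeight; fun_prop

theorem lintegral_pos_eq_lintegral_interlace {k : ℕ} {y : Fin (k + 1) → ℝ} (hy : StrictMono y)
    {F : (Fin (k + 1) → ℝ) → ENNReal} (hF : Measurable F) :
    ∫⁻ g in {g | ∀ i, 0 < g i}, F g =
      ∫⁻ b in {b | Interlace y b}, ∫⁻ r in Set.Ioi (0 : ℝ),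
        ENNReal.ofReal (r ^ k * (absVand b / absVand y)) * F (r • spectralWeight y b) := by
  have hmeas : MeasurableSet {z : Fin (k + 1) → ℝ | 0 < z 0 ∧ Interlace y (Fin.tail z)} := by
    refine (measurableSet_lt measurable_const (measurable_pi_apply _)).inter ?_
    exact measurableSet_interlace_right y |>.preimage
      (measurable_pi_lambda _ fun j => measurable_pi_apply _)
  rw [← image_smul_spectralWeight hy, lintegral_image_eq_lintegral_abs_det_fderiv_mul volume hmeas
    (fun z _ => (hasFDerivAt_smul_spectralWeight y z).hasFDerivWithinAt)
    (injOn_smul_spectralWeight hy)]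
  rw [setLIntegral_congr_fun hmeas
    (g := fun z => ENNReal.ofReal (z 0 ^ k * (absVand (Fin.tail z) / absVand y)) *
      F (z 0 • spectralWeight y (Fin.tail z)))
    fun z hz => by rw [abs_det_smul_spectralWeight hz.1 hz.2]]
  have hpre : (fun p : ℝ × (Fin k → ℝ) => (Fin.cons p.1 p.2 : Fin (k + 1) → ℝ)) ⁻¹'
      {z | 0 < z 0 ∧ Interlace y (Fin.tail z)} = Set.Ioi 0 ×ˢ {b | Interlace y b} := by
    ext ⟨r, b⟩
    simp
  rw [← (measurePreserving_cons k).setLIntegral_comp_preimage_emb (measurableEmbedding_cons k),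
    hpre, Measure.volume_eq_prod, setLIntegral_prod_symm]
  · simp
  · refine Measurable.aemeasurable ?_
    simp only [Fin.cons_zero, Fin.tail_cons]
    fun_prop

/-- Minus the residue of `∏ (x - y i) / ∏ (x - b j)` at `b j`, divided by `1 + b j ^ 2`. -/
def poleWeight {k : ℕ} (b : Fin k → ℝ) (y : Fin (k + 1) → ℝ) (j : Fin k) : ℝ :=
  -((∏ i, (b j - y i)) / ∏ l ∈ univ.erase j, (b j - b l)) / (1 + b j ^ 2)

theorem Interlace.poleWeight_pos {k : ℕ} {y : Fin (k + 1) → ℝ} {b : Fin k → ℝ}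
    (h : Interlace y b) (j : Fin k) : 0 < poleWeight b y j :=
  _root_.div_pos (neg_pos.2 (h.residue_neg j)) (by positivity)

theorem residue_eq_poleWeight {k : ℕ} (b : Fin k → ℝ) (y : Fin (k + 1) → ℝ) (j : Fin k) :
    (∏ i, (b j - y i)) / ∏ l ∈ univ.erase j, (b j - b l) =
      -(poleWeight b y j * (1 + b j ^ 2)) := by
  rw [poleWeight, div_mul_cancel₀ _ (by positivity), neg_neg]

theorem hasFDerivAt_poleWeight {k : ℕ} (b : Fin k → ℝ) {y : Fin (k + 1) → ℝ}
    (h : ∀ i j, y i ≠ b j) :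
    HasFDerivAt (fun y : Fin (k + 1) → ℝ =>
        (Fin.cons (∑ j, b j - ∑ i, y i) (poleWeight b y) : Fin (k + 1) → ℝ))
      (LinearMap.toContinuousLinearMap (Matrix.toLin'
        (Matrix.diagonal (Fin.cons (-1) (poleWeight b y)) *
          ((borderedCauchy y b).transpose *
            Matrix.diagonal fun i => (∏ l, (y i - b l))⁻¹)))) y := by
  have hP : ∀ i, ∏ l, (y i - b l) ≠ 0 := fun i =>
    prod_ne_zero_iff.2 fun j _ => sub_ne_zero.2 (h i j)
  have h0 : ∀ i, HasFDerivAt (fun z : Fin (k + 1) → ℝ => z i)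
      (ContinuousLinearMap.proj i : (Fin (k + 1) → ℝ) →L[ℝ] ℝ) y := fun i => hasFDerivAt_apply i y
  refine hasFDerivAt_of_matrix _ (Fin.cases ?_ fun j => ?_)
  · have h2 := (HasFDerivAt.fun_sum (u := univ) fun i _ => h0 i).const_sub (∑ j, b j)
    simp only [Fin.cons_zero]
    refine h2.congr_fderiv ?_
    rw [← sum_neg_distrib]
    refine sum_congr rfl fun i _ => ?_
    ext v
    simp [Matrix.diagonal_mul, Matrix.mul_diagonal, borderedCauchy, hP]
  · have h2 := HasFDerivAt.finsetProd (u := univ) fun i _ => (h0 i).const_sub (b j)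
    have h3 := (((h2.mul_const (∏ l ∈ univ.erase j, (b j - b l))⁻¹).fun_neg).mul_const
      (1 + b j ^ 2)⁻¹)
    refine (h3.congr_of_eventuallyEq (Eventually.of_forall fun z => ?_)).congr_fderiv ?_
    · simp [poleWeight, div_eq_mul_inv]
    · rw [smul_sum, ← sum_neg_distrib, smul_sum]
      refine sum_congr rfl fun i _ => ?_
      have h4 : ∏ l, (y i - b l) = (y i - b j) * ∏ l ∈ univ.erase j, (y i - b l) :=
        (mul_prod_erase univ _ (mem_univ j)).symm
      have h5 : ∏ i, (b j - y i) = (b j - y i) * ∏ l ∈ univ.erase i, (b j - y l) :=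
        (mul_prod_erase univ _ (mem_univ i)).symm
      have h6 : ∏ l ∈ univ.erase j, (y i - b l) ≠ 0 := fun h7 => hP i (by rw [h4, h7, mul_zero])
      have h7 := sub_ne_zero.2 (h i j)
      ext v
      simp only [Matrix.diagonal_mul, Matrix.mul_diagonal, borderedCauchy, Matrix.of_apply,
        Matrix.transpose_apply, Fin.cons_succ, poleWeight, h4, h5]
      simp
      field_simp
      ring

theorem absVand_sq_prod {k : ℕ} (b : Fin k → ℝ) (y : Fin (k + 1) → ℝ) :
    |∏ j, poleWeight b y j| =
      (∏ j, ∏ i, |b j - y i|) / (absVand b ^ 2 * ∏ j, (1 + b j ^ 2)) := by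
  simp only [poleWeight, abs_prod, abs_div, abs_neg, prod_div_distrib, ← prod_prod_erase_abs]
  rw [div_div]
  congr 2
  exact prod_congr rfl fun j _ => abs_of_pos (by positivity)

theorem Interlace.prod_prod_abs_pos {k : ℕ} {y : Fin (k + 1) → ℝ} {b : Fin k → ℝ}
    (h : Interlace y b) : 0 < ∏ j, ∏ i, |b j - y i| :=
  prod_pos fun j _ => prod_pos fun i _ => abs_pos.2 (sub_ne_zero.2 (h.ne i j).symm)

theorem abs_det_poleWeight {k : ℕ} {b : Fin k → ℝ} {y : Fin (k + 1) → ℝ} (h : Interlace y b) :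
    |(LinearMap.toContinuousLinearMap (Matrix.toLin'
        (Matrix.diagonal (Fin.cons (-1) (poleWeight b y)) *
          ((borderedCauchy y b).transpose *
            Matrix.diagonal fun i => (∏ l, (y i - b l))⁻¹)))).det| =
      absVand y / (absVand b * ∏ j, (1 + b j ^ 2)) := by
  have h1 : |∏ i, (∏ l, (y i - b l))⁻¹| = (∏ j, ∏ i, |b j - y i|)⁻¹ := by
    rw [prod_inv_distrib, abs_inv]
    simp only [abs_prod]
    rw [Finset.prod_comm]
    simp only [abs_sub_comm]
  rw [det_toContinuousLinearMap_toLin', Matrix.det_mul, Matrix.det_mul, Matrix.det_diagonal,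
    Matrix.det_diagonal, Matrix.det_transpose, abs_mul, abs_mul, h1,
    abs_det_borderedCauchy _ h.strictMono_right.injective, Fin.prod_univ_succ]
  simp only [Fin.cons_zero, Fin.cons_succ, abs_mul, absVand_sq_prod, abs_neg, abs_one, one_mul]
  have h2 := absVand_pos h.strictMono_right.injective
  have h3 := h.prod_prod_abs_pos
  have h4 : 0 < ∏ j, (1 + b j ^ 2) := prod_pos fun j _ => by positivity
  field_simp

theorem prod_erase_eq_prod_ite {k : ℕ} (i : Fin k) (f : Fin k → ℝ) :
    ∏ l ∈ univ.erase i, f l = ∏ l, if l = i then 1 else f l := by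
  rw [← mul_prod_erase univ (fun l => if l = i then 1 else f l) (mem_univ i), if_pos rfl, one_mul]
  exact prod_congr rfl fun l hl => by rw [if_neg (ne_of_mem_erase hl)]

theorem strictMono_cons_snoc {k : ℕ} {b : Fin k → ℝ} (hb : StrictMono b) {R : ℝ} (hR : 0 < R)
    (h : ∀ j, |b j| < R) :
    StrictMono (Fin.cons (-R) (Fin.snoc b R : Fin (k + 1) → ℝ) : Fin (k + 2) → ℝ) := by
  have hs : StrictMono (Fin.snoc b R : Fin (k + 1) → ℝ) := by
    intro i j hij
    induction i using Fin.lastCases with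
    | last => exact absurd hij (not_lt.2 (Fin.le_last j))
    | cast i =>
      induction j using Fin.lastCases with
      | last => simpa using (abs_lt.1 (h i)).2
      | cast j => simpa using hb (Fin.castSucc_lt_castSucc_iff.1 hij)
  intro i j hij
  induction j using Fin.cases with
  | zero => exact absurd hij (Fin.not_lt_zero i)
  | succ j =>
    induction i using Fin.cases with
    | zero =>
      induction j using Fin.lastCases with
      | last => simp; linarith
      | cast j => simpa using (abs_lt.1 (h j)).1
    | succ i => simpa using hs (Fin.succ_lt_succ_iff.1 hij)

theorem degree_monic_sub_lt {k : ℕ} (c : ℝ) (b v : Fin k → ℝ) (x : Fin (k + 1) → ℝ) :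
    ((X + C c) * ∏ j, (X - C (b j)) + ∑ j, C (v j) * ∏ l ∈ univ.erase j, (X - C (b l)) -
      ∏ i, (X - C (x i)) : ℝ[X]).degree < (k + 1 : ℕ) := by
  have hq : ((X + C c) * ∏ j, (X - C (b j)) : ℝ[X]) =
      ∏ i, (X - C ((Fin.cons (-c) b : Fin (k + 1) → ℝ) i)) := by
    rw [Fin.prod_univ_succ]; simp
  rw [degree_lt_iff_coeff_zero]
  intro m hm
  rw [coeff_sub, coeff_add, (degree_lt_iff_coeff_zero _ _).1 (degree_sum_prod_erase_lt b v) m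
    (by omega), add_zero, hq]
  rcases hm.eq_or_lt with rfl | hm
  · rw [monic_prod_X_sub_C_coeff, monic_prod_X_sub_C_coeff, sub_self]
  · have h1 := (degree_lt_iff_coeff_zero _ _).1 (degree_C_mul_prod_lt 1 x) m hm
    have h2 := (degree_lt_iff_coeff_zero _ _).1
      (degree_C_mul_prod_lt 1 (Fin.cons (-c) b : Fin (k + 1) → ℝ)) m hm
    rw [map_one, one_mul] at h1 h2
    rw [h1, h2, sub_self]

theorem exists_interlace_of_residues {k : ℕ} {b : Fin k → ℝ} (hb : StrictMono b) (c : ℝ)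
    {v : Fin k → ℝ} (hv : ∀ j, 0 < v j) :
    ∃ y : Fin (k + 1) → ℝ, Interlace y b ∧ (∏ i, (X - C (y i)) : ℝ[X]) =
      (X + C c) * ∏ j, (X - C (b j)) + ∑ j, C (-v j) * ∏ l ∈ univ.erase j, (X - C (b l)) := by
  set p : ℝ[X] := (X + C c) * ∏ j, (X - C (b j)) +
    ∑ j, C (-v j) * ∏ l ∈ univ.erase j, (X - C (b l)) with hp
  set R : ℝ := |c| + ∑ j, v j + ∑ j, |b j| + 1 with hR
  have hv0 : 0 ≤ ∑ j, v j := sum_nonneg fun j _ => (hv j).le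
  have hb0 : ∀ j, |b j| + 1 ≤ R := fun j => by
    have := single_le_sum (fun i _ => abs_nonneg (b i)) (mem_univ j)
    linarith [abs_nonneg c]
  have hR0 : 0 < R := by
    have := sum_nonneg fun i (_ : i ∈ univ) => abs_nonneg (b i)
    linarith [abs_nonneg c]
  have hlarge : ∀ x : ℝ, R = |x| → p.eval x = (∏ j, (x - b j)) * (x + c - ∑ j, v j / (x - b j)) ∧
      |∑ j, v j / (x - b j)| ≤ ∑ j, v j ∧ ∏ j, (x - b j) ≠ 0 := by
    intro x hx
    have hxb : ∀ j, 1 ≤ |x - b j| := fun j => by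
      have := abs_sub_abs_le_abs_sub x (b j)
      linarith [hb0 j]
    have hne : ∀ j, x ≠ b j := fun j h => by
      have := hxb j
      rw [h, sub_self, abs_zero] at this
      linarith
    refine ⟨?_, ?_, prod_ne_zero_iff.2 fun j _ => sub_ne_zero.2 (hne j)⟩
    · rw [hp, eval_add, eval_eq_of_ne _ _ hne, eval_mul, eval_prod]
      simp [neg_div]
      ring
    · refine (abs_sum_le_sum_abs _ _).trans (sum_le_sum fun j _ => ?_)
      rw [abs_div, abs_of_pos (hv j)]
      exact div_le_self (hv j).le (hxb j)
  obtain ⟨x, hx, hx0⟩ := exists_interlace_roots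
    (strictMono_cons_snoc hb hR0 fun j => by linarith [hb0 j]) (f := fun x => p.eval x)
    (Polynomial.continuous _) (by
      intro i
      rw [prod_erase_eq_prod_ite]
      induction i using Fin.cases with
      | zero =>
        obtain ⟨h1, h2, h3⟩ := hlarge (-R) (by rw [abs_neg, abs_of_pos hR0])
        simp only [Fin.prod_univ_succ (n := k + 1), Fin.prod_univ_castSucc (n := k), Fin.cons_zero,
          Fin.cons_succ, Fin.snoc_castSucc, Fin.snoc_last, Fin.succ_ne_zero, if_true, if_false,
          h1, one_mul]
        rw [mul_div_mul_left _ _ h3]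
        refine div_pos_of_neg_of_neg ?_ (by linarith)
        have := (abs_le.1 h2).1
        have := sum_nonneg fun i (_ : i ∈ univ) => abs_nonneg (b i)
        linarith [le_abs_self c]
      | succ i =>
        induction i using Fin.lastCases with
        | last =>
          obtain ⟨h1, h2, h3⟩ := hlarge R (by rw [abs_of_pos hR0])
          have hl : ∀ j : Fin k, (j.castSucc = Fin.last k) = False := fun j =>
            eq_false (Fin.castSucc_lt_last j).ne
          simp only [Fin.prod_univ_succ (n := k + 1), Fin.prod_univ_castSucc (n := k),
            Fin.cons_zero, Fin.cons_succ, Fin.snoc_castSucc, Fin.snoc_last,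
            (Fin.succ_ne_zero _).symm, if_true, if_false, h1, mul_one, Fin.succ_inj, hl]
          rw [mul_comm (R - -R), mul_div_mul_left _ _ h3]
          refine div_pos ?_ (by linarith)
          have := (abs_le.1 h2).2
          have := sum_nonneg fun i (_ : i ∈ univ) => abs_nonneg (b i)
          linarith [neg_abs_le c]
        | cast j =>
          have hl : (Fin.last k = j.castSucc) = False := eq_false (Fin.castSucc_lt_last j).ne'
          have h1 : p.eval (b j) = -(v j * ∏ l ∈ univ.erase j, (b j - b l)) := by
            rw [hp, eval_add, eval_sum_prod_erase, eval_mul, eval_prod,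
              prod_eq_zero (mem_univ j) (by simp)]
            ring
          simp only [Fin.prod_univ_succ (n := k + 1), Fin.prod_univ_castSucc (n := k),
            Fin.cons_zero, Fin.cons_succ, Fin.snoc_castSucc, Fin.snoc_last,
            (Fin.succ_ne_zero _).symm, if_false, h1, Fin.succ_inj, hl,
            Fin.castSucc_inj]
          rw [← prod_erase_eq_prod_ite j fun l => b j - b l]
          have h2 := prod_erase_sub_ne_zero hb.injective j
          have h3 := abs_lt.1 (show |b j| < R by linarith [hb0 j])
          rw [show -(v j * ∏ l ∈ univ.erase j, (b j - b l)) / ((b j - -R) *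
            ((∏ l ∈ univ.erase j, (b j - b l)) * (b j - R))) = v j / ((b j + R) * (R - b j)) by
              have h4 : b j + R ≠ 0 := by linarith
              have h5 : R - b j ≠ 0 := by linarith
              have h6 : b j - R ≠ 0 := by linarith
              rw [div_eq_div_iff (by
                refine mul_ne_zero ?_ (mul_ne_zero h2 h6)
                rwa [sub_neg_eq_add]) (mul_ne_zero h4 h5)]
              ring]
          exact div_pos (hv j) (mul_pos (by linarith) (by linarith)))
  refine ⟨x, fun j => ?_, ?_⟩
  · constructor
    · have := (hx j.castSucc).2
      simpa using this
    · have := (hx j.succ).1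
      rw [← Fin.succ_castSucc] at this
      simpa using this
  · symm
    rw [← sub_eq_zero]
    refine eq_zero_of_degree_lt_of_eval_finset_eq_zero (univ.image x) ?_ ?_
    · rw [card_image_of_injective _ hx.strictMono_right.injective, card_univ, Fintype.card_fin]
      exact degree_monic_sub_lt c b _ x
    · intro z hz
      obtain ⟨i, -, rfl⟩ := mem_image.1 hz
      rw [eval_sub, hx0 i, eval_prod, prod_eq_zero (mem_univ i) (by simp), sub_zero]

theorem prod_eq_poleWeight {k : ℕ} {b : Fin k → ℝ} (hb : Function.Injective b)
    (y : Fin (k + 1) → ℝ) :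
    (∏ i, (X - C (y i)) : ℝ[X]) = (X + C (∑ j, b j - ∑ i, y i)) * ∏ j, (X - C (b j)) +
      ∑ j, C (-(poleWeight b y j * (1 + b j ^ 2))) * ∏ l ∈ univ.erase j, (X - C (b l)) := by
  simp only [← residue_eq_poleWeight, ← prod_eq_add_sum hb]

theorem image_poleWeight {k : ℕ} {b : Fin k → ℝ} (hb : StrictMono b) :
    (fun y : Fin (k + 1) → ℝ =>
        (Fin.cons (∑ j, b j - ∑ i, y i) (poleWeight b y) : Fin (k + 1) → ℝ)) ''
      {y | Interlace y b} = {z | ∀ j, 0 < (Fin.tail z : Fin k → ℝ) j} := by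
  ext z
  constructor
  · rintro ⟨y, hy, rfl⟩ j
    simpa using Interlace.poleWeight_pos hy j
  · intro hz
    obtain ⟨y, hy, hp⟩ := exists_interlace_of_residues hb (z 0)
      (v := fun j => Fin.tail z j * (1 + b j ^ 2)) fun j => mul_pos (hz j) (by positivity)
    refine ⟨y, hy, ?_⟩
    have hg : poleWeight b y = Fin.tail z := by
      ext j
      have h1 := congrArg (fun p : ℝ[X] => p.eval (b j)) hp
      simp only [eval_add, eval_sum_prod_erase, eval_mul, eval_prod, eval_sub, eval_X, eval_C] at h1
      rw [prod_eq_zero (f := fun x => b j - b x) (mem_univ j) (sub_self (b j)), mul_zero, zero_add,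
        neg_mul] at h1
      rw [poleWeight, h1, neg_div (∏ l ∈ univ.erase j, (b j - b l)), neg_neg,
          mul_div_cancel_right₀ _ (prod_erase_sub_ne_zero hb.injective j),
        mul_div_cancel_right₀ _ (by positivity)]
    rw [prod_eq_poleWeight hb.injective, hg] at hp
    have h2 := mul_right_cancel₀ (prod_ne_zero_iff.2 fun j _ => X_sub_C_ne_zero (b j))
      (add_right_cancel hp)
    have h3 := C_injective (add_left_cancel h2)
    change (Fin.cons _ _ : Fin (k + 1) → ℝ) = z
    rw [hg, h3, Fin.cons_self_tail]

theorem injOn_poleWeight {k : ℕ} {b : Fin k → ℝ} (hb : StrictMono b) :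
    Set.InjOn (fun y : Fin (k + 1) → ℝ =>
        (Fin.cons (∑ j, b j - ∑ i, y i) (poleWeight b y) : Fin (k + 1) → ℝ))
      {y | Interlace y b} := by
  intro y hy y' hy' h
  obtain ⟨h1, h2⟩ := (Fin.cons_inj (α := fun _ => ℝ)).1 h
  refine Interlace.unique_left hy hy' fun x => ?_
  have h3 := prod_eq_poleWeight hb.injective y
  rw [h1, h2, ← prod_eq_poleWeight hb.injective y'] at h3
  simpa [eval_prod] using congrArg (fun p : ℝ[X] => p.eval x) h3

theorem lintegral_pos_prod_eq_lintegral_interlace {k : ℕ} {b : Fin k → ℝ} (hb : StrictMono b)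
    {F : ℝ → (Fin k → ℝ) → ENNReal} (hF : Measurable (Function.uncurry F)) :
    ∫⁻ g in {g | ∀ i, 0 < g i}, ∫⁻ q, F q g =
      ∫⁻ y in {y | Interlace y b}, ENNReal.ofReal (absVand y / (absVand b * ∏ j, (1 + b j ^ 2))) *
        F (∑ j, b j - ∑ i, y i + ∑ j, poleWeight b y j * b j) (poleWeight b y) := by
  have hpos : MeasurableSet {g : Fin k → ℝ | ∀ i, 0 < g i} := by
    simp only [Set.ofPred_forall]
    exact MeasurableSet.iInter fun j => measurableSet_lt measurable_const (measurable_pi_apply _)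
  have hF' : Measurable fun p : ℝ × (Fin k → ℝ) => F (p.1 + ∑ j, p.2 j * b j) p.2 :=
    hF.comp (by fun_prop : Measurable fun p : ℝ × (Fin k → ℝ) => (p.1 + ∑ j, p.2 j * b j, p.2))
  have h1 := lintegral_image_eq_lintegral_abs_det_fderiv_mul volume
    (measurableSet_interlace_left b)
    (fun y (hy : Interlace y b) => (hasFDerivAt_poleWeight b hy.ne).hasFDerivWithinAt)
    (injOn_poleWeight hb) fun z => F (z 0 + ∑ j, (Fin.tail z : Fin k → ℝ) j * b j) (Fin.tail z)
  rw [image_poleWeight hb, setLIntegral_congr_fun (measurableSet_interlace_left b)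
    (fun y (hy : Interlace y b) => by rw [abs_det_poleWeight hy])] at h1
  simp only [Fin.cons_zero, Fin.tail_cons] at h1
  rw [← h1]
  have hpre : (fun p : ℝ × (Fin k → ℝ) => (Fin.cons p.1 p.2 : Fin (k + 1) → ℝ)) ⁻¹'
      {z | ∀ j, 0 < (Fin.tail z : Fin k → ℝ) j} = Set.univ ×ˢ {g | ∀ i, 0 < g i} := by
    ext ⟨r, b⟩
    simp
  rw [← (measurePreserving_cons k).setLIntegral_comp_preimage_emb (measurableEmbedding_cons k),
    hpre, Measure.volume_eq_prod, setLIntegral_prod_symm _ (by simpa using hF'.aemeasurable)]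
  refine setLIntegral_congr_fun hpos fun g _ => ?_
  simp only [Fin.cons_zero, Fin.tail_cons, Measure.restrict_univ]
  exact (lintegral_add_right_eq_self (fun q => F q g) _).symm

/-- Herglotz representation of `∏ (z - y i) / ∏ (z - b j)`. -/
theorem prod_div_eq_herglotz {K : Type*} [Field K] [Algebra ℝ K] {k : ℕ} {b : Fin k → ℝ}
    (hb : Function.Injective b) (y : Fin (k + 1) → ℝ) {z : K}
    (hz : ∀ j, z ≠ algebraMap ℝ K (b j)) :
    (∏ i, (z - algebraMap ℝ K (y i))) / ∏ j, (z - algebraMap ℝ K (b j)) =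
      z + algebraMap ℝ K (∑ j, b j - ∑ i, y i + ∑ j, poleWeight b y j * b j) +
        ∑ j, algebraMap ℝ K (poleWeight b y j) *
          (1 + algebraMap ℝ K (b j) * z) / (algebraMap ℝ K (b j) - z) := by
  have hne : ∀ j, z - algebraMap ℝ K (b j) ≠ 0 := fun j => sub_ne_zero.2 (hz j)
  have h0 : ∏ j, (z - algebraMap ℝ K (b j)) ≠ 0 := prod_ne_zero_iff.2 fun j _ => hne j
  have h1 := congrArg (fun p : ℝ[X] => aeval z p) (prod_eq_poleWeight hb y)
  simp only [map_add, map_mul, map_prod, map_sub, aeval_X, aeval_C, map_sum] at h1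
  have h2 : (∑ j, algebraMap ℝ K (poleWeight b y j) * (1 + algebraMap ℝ K (b j) * z) /
        (algebraMap ℝ K (b j) - z)) * ∏ j, (z - algebraMap ℝ K (b j)) =
      -((∑ j, algebraMap ℝ K (poleWeight b y j * b j)) * ∏ j, (z - algebraMap ℝ K (b j))) +
        ∑ j, algebraMap ℝ K (-(poleWeight b y j * (1 + b j ^ 2))) *
          ∏ l ∈ univ.erase j, (z - algebraMap ℝ K (b l)) := by
    rw [sum_mul, sum_mul, ← sum_neg_distrib, ← sum_add_distrib]
    refine sum_congr rfl fun j _ => ?_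
    rw [← mul_prod_erase univ _ (mem_univ j)]
    have h2 : algebraMap ℝ K (b j) - z ≠ 0 := sub_ne_zero.2 (hz j).symm
    simp only [map_neg, map_mul, map_add, map_one, map_pow]
    field_simp
    ring
  rw [div_eq_iff h0, h1, map_add, map_sub, map_sum, map_sum, map_sum]
  linear_combination -h2

theorem norm_prod_div_sq {k : ℕ} {b : Fin k → ℝ} (hb : Function.Injective b)
    (y : Fin (k + 1) → ℝ) :
    (∏ i, (1 + y i ^ 2)) / ∏ j, (1 + b j ^ 2) =
      (1 + ∑ j, poleWeight b y j) ^ 2 +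
        (∑ j, b j - ∑ i, y i + ∑ j, poleWeight b y j * b j) ^ 2 := by
  have hne : ∀ x : ℝ, Complex.I - (x : ℂ) ≠ 0 := fun x h => by
    simpa using congrArg Complex.im h
  have h := prod_div_eq_herglotz hb y (z := Complex.I) fun j => sub_ne_zero.1 (hne (b j))
  have h1 : ∀ j, algebraMap ℝ ℂ (poleWeight b y j) *
      (1 + algebraMap ℝ ℂ (b j) * Complex.I) / (algebraMap ℝ ℂ (b j) - Complex.I) =
      (poleWeight b y j : ℂ) * Complex.I := by
    intro j
    have h2 : (b j : ℂ) - Complex.I ≠ 0 := by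
      rw [← neg_sub]; exact neg_ne_zero.2 (hne _)
    simp only [Complex.coe_algebraMap]
    rw [div_eq_iff h2]
    linear_combination (poleWeight b y j : ℂ) * Complex.I_sq
  have hn : ∀ x : ℝ, Complex.normSq (Complex.I - (x : ℂ)) = 1 + x ^ 2 := fun x => by
    rw [Complex.normSq_apply]; simp; ring
  simp only [h1] at h
  have h3 := congrArg Complex.normSq h
  simp only [Complex.coe_algebraMap, map_div₀, map_prod, hn, ← sum_mul] at h3
  rw [h3, Complex.normSq_apply, ← Complex.ofReal_sum]
  simp
  ring

end

section

open Finset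

/-- Density of the circular ensemble in the coordinate `x = -cot (θ / 2)`, up to a constant. -/
def cauchyWeight (β : ℝ) {n : ℕ} (b : Fin n → ℝ) : ℝ :=
  absVand b ^ β * (∏ j, (1 + b j ^ 2)) ^ (-(β * ((n : ℝ) - 1) / 2 + 1))

/-- Joint density of an interlacing pair whose first member has density `cauchyWeight`. -/
def interlaceWeight (β : ℝ) {k : ℕ} (y : Fin (k + 1) → ℝ) (b : Fin k → ℝ) : ℝ :=
  absVand b * absVand y * (∏ j, ∏ i, |b j - y i|) ^ (β / 2 - 1) *
    (∏ i, (1 + y i ^ 2)) ^ (-(k * (β / 2) + 1))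

@[fun_prop]
theorem measurable_cauchyWeight {α : Type*} [MeasurableSpace α] {β : ℝ} {n : ℕ}
    {b : α → Fin n → ℝ} (hb : Measurable b) : Measurable fun a => cauchyWeight β (b a) := by
  unfold cauchyWeight; fun_prop

@[fun_prop]
theorem measurable_interlaceWeight {α : Type*} [MeasurableSpace α] {β : ℝ} {k : ℕ}
    {y : α → Fin (k + 1) → ℝ} {b : α → Fin k → ℝ} (hy : Measurable y) (hb : Measurable b) :
    Measurable fun a => interlaceWeight β (y a) (b a) := by
  unfold interlaceWeight; fun_prop

theorem cauchyWeight_nonneg {β : ℝ} {n : ℕ} (b : Fin n → ℝ) : 0 ≤ cauchyWeight β b :=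
  mul_nonneg (Real.rpow_nonneg (absVand_nonneg b) _)
    (Real.rpow_nonneg (prod_nonneg fun j _ => by positivity) _)

theorem rpow_identity_up {V P Q Y W : ℝ} (β k : ℝ) (hV : 0 < V) (hP : 0 < P) (hQ : 0 < Q)
    (hY : 0 < Y) (hW : 0 < W) :
    V ^ β * P ^ (-(β * (k - 1) / 2 + 1)) * (W / (V * P) *
      ((Q / (V ^ 2 * P)) ^ (β / 2 - 1) * (Y / P) ^ (-(k * (β / 2) + 1)))) =
      V * W * Q ^ (β / 2 - 1) * Y ^ (-(k * (β / 2) + 1)) := by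
  rw [← Real.exp_log hV, ← Real.exp_log hP, ← Real.exp_log hQ, ← Real.exp_log hY,
    ← Real.exp_log hW]
  simp only [← Real.exp_nat_mul, ← Real.exp_add, ← Real.exp_sub, ← Real.exp_mul]
  congr 1
  push_cast
  ring

theorem rpow_identity_down {V P Q W r : ℝ} (β : ℝ) (k : ℕ) (hV : 0 < V) (hP : 0 < P) (hQ : 0 < Q)
    (hW : 0 < W) (hr : 0 < r) :
    V ^ β * P ^ (-(β * (((k + 1 : ℕ) : ℝ) - 1) / 2 + 1)) * (r ^ k * (W / V) *
      (r ^ (k + 1) * (Q / V ^ 2)) ^ (β / 2 - 1)) =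
      W * V * Q ^ (β / 2 - 1) * P ^ (-(k * (β / 2) + 1)) *
        r ^ (((k + 1 : ℕ) : ℝ) * (β / 2) - 1) := by
  rw [← Real.exp_log hV, ← Real.exp_log hP, ← Real.exp_log hQ, ← Real.exp_log hr,
    ← Real.exp_log hW]
  simp only [← Real.exp_nat_mul, ← Real.exp_add, ← Real.exp_sub, ← Real.exp_mul]
  congr 1
  push_cast
  ring

theorem prod_one_add_sq_pos {k : ℕ} (b : Fin k → ℝ) : 0 < ∏ j, (1 + b j ^ 2) :=
  prod_pos fun j _ => by positivity

theorem lintegral_weights_shift {k : ℕ} {b : Fin k → ℝ} (hb : StrictMono b) (β : ℝ)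
    {F : ℝ → (Fin k → ℝ) → ENNReal} (hF : Measurable (Function.uncurry F)) :
    ENNReal.ofReal (cauchyWeight β b) * ∫⁻ g in {g | ∀ i, 0 < g i},
        ENNReal.ofReal ((∏ i, g i) ^ (β / 2 - 1)) *
        ∫⁻ q, ENNReal.ofReal (((1 + ∑ i, g i) ^ 2 + q ^ 2) ^ (-(k * (β / 2) + 1))) * F q g =
      ∫⁻ y in {y | Interlace y b}, ENNReal.ofReal (interlaceWeight β y b) *
        F (∑ j, b j - ∑ i, y i + ∑ j, poleWeight b y j * b j) (poleWeight b y) := by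
  have h1 : ∀ g : Fin k → ℝ, ENNReal.ofReal ((∏ i, g i) ^ (β / 2 - 1)) *
        ∫⁻ q, ENNReal.ofReal (((1 + ∑ i, g i) ^ 2 + q ^ 2) ^ (-(k * (β / 2) + 1))) * F q g =
      ∫⁻ q, ENNReal.ofReal ((∏ i, g i) ^ (β / 2 - 1)) * (ENNReal.ofReal
        (((1 + ∑ i, g i) ^ 2 + q ^ 2) ^ (-(k * (β / 2) + 1))) * F q g) := fun g => by
    rw [lintegral_const_mul' _ _ ENNReal.ofReal_ne_top]
  simp only [h1]
  rw [lintegral_pos_prod_eq_lintegral_interlace hb (F := fun q g =>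
    ENNReal.ofReal ((∏ i, g i) ^ (β / 2 - 1)) * (ENNReal.ofReal
        (((1 + ∑ i, g i) ^ 2 + q ^ 2) ^ (-(k * (β / 2) + 1))) * F q g)),
    ← lintegral_const_mul' _ _ ENNReal.ofReal_ne_top]
  · refine setLIntegral_congr_fun (measurableSet_interlace_left b) fun y (hy : Interlace y b) => ?_
    rw [← norm_prod_div_sq hb.injective]
    have hpw := absVand_sq_prod b y
    rw [abs_of_pos (prod_pos fun j _ => hy.poleWeight_pos j)] at hpw
    have hV := absVand_pos hb.injective
    have hW := absVand_pos hy.strictMono_left.injective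
    have hP := prod_one_add_sq_pos b
    have hY := prod_one_add_sq_pos y
    have h2 := rpow_identity_up β k hV hP hy.prod_prod_abs_pos hY hW
    rw [interlaceWeight, ← h2, hpw, ← cauchyWeight, ENNReal.ofReal_mul (cauchyWeight_nonneg b),
      ENNReal.ofReal_mul (by positivity), ENNReal.ofReal_mul (Real.rpow_nonneg
        (div_nonneg hy.prod_prod_abs_pos.le (by positivity)) _)]
    ring
  · have hF' : Measurable fun p : ℝ × (Fin k → ℝ) => F p.1 p.2 := hF
    unfold Function.uncurry
    fun_prop

theorem prod_spectralWeight {k : ℕ} {y : Fin (k + 1) → ℝ} {b : Fin k → ℝ} (h : Interlace y b) :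
    ∏ i, spectralWeight y b i = (∏ j, ∏ i, |b j - y i|) / absVand y ^ 2 := by
  rw [← abs_of_pos (prod_pos fun i _ => h.spectralWeight_pos i)]
  simp only [spectralWeight, abs_prod, abs_div, prod_div_distrib, ← prod_prod_erase_abs]
  rw [Finset.prod_comm]
  simp only [abs_sub_comm]

theorem lintegral_weights_polar {k : ℕ} {b : Fin (k + 1) → ℝ} (hb : StrictMono b) (β : ℝ)
    {F : (Fin (k + 1) → ℝ) → ENNReal} (hF : Measurable F) :
    ENNReal.ofReal (cauchyWeight β b) * ∫⁻ g in {g | ∀ i, 0 < g i},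
        ENNReal.ofReal ((∏ i, g i) ^ (β / 2 - 1)) * F g =
      ∫⁻ x in {x | Interlace b x}, ENNReal.ofReal (interlaceWeight β b x) *
        ∫⁻ r in Set.Ioi (0 : ℝ), ENNReal.ofReal (r ^ (((k + 1 : ℕ) : ℝ) * (β / 2) - 1)) *
          F (r • spectralWeight b x) := by
  rw [lintegral_pos_eq_lintegral_interlace hb (by fun_prop),
    ← lintegral_const_mul' _ _ ENNReal.ofReal_ne_top]
  refine setLIntegral_congr_fun (measurableSet_interlace_right b) fun x (hx : Interlace b x) => ?_
  rw [← lintegral_const_mul' _ _ ENNReal.ofReal_ne_top,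
    ← lintegral_const_mul' _ _ ENNReal.ofReal_ne_top]
  refine setLIntegral_congr_fun measurableSet_Ioi fun r (hr : 0 < r) => ?_
  have hV := absVand_pos hb.injective
  have hW := absVand_pos hx.strictMono_right.injective
  have hP := prod_one_add_sq_pos b
  have hQ := hx.prod_prod_abs_pos
  have h2 := rpow_identity_down β k hV hP hQ hW hr
  have h3 : ∏ i, (r • spectralWeight b x) i =
      r ^ (k + 1) * ((∏ j, ∏ i, |x j - b i|) / absVand b ^ 2) := by
    simp [prod_mul_distrib, prod_spectralWeight hx]
  rw [h3, ← mul_assoc, ← mul_assoc, ← mul_assoc, ← ENNReal.ofReal_mul (cauchyWeight_nonneg b),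
    ← ENNReal.ofReal_mul (mul_nonneg (cauchyWeight_nonneg b) (by positivity)),
    cauchyWeight, mul_assoc (_ * _), h2, ENNReal.ofReal_mul (by positivity), interlaceWeight]

/-- The number of coordinates of `y` below `ξ`, as a real number. -/
def countLt (ξ : ℝ) {n : ℕ} (y : Fin n → ℝ) : ℝ := ∑ i, if y i < ξ then 1 else 0

@[fun_prop]
theorem measurable_countLt {α : Type*} [MeasurableSpace α] {ξ : ℝ} {n : ℕ}
    {y : α → Fin n → ℝ} (hy : Measurable y) : Measurable fun a => countLt ξ (y a) := by
  unfold countLt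
  exact Finset.measurable_sum _ fun i _ =>
    Measurable.ite (measurableSet_lt (by fun_prop) measurable_const) measurable_const
      measurable_const

theorem Interlace.countLt_eq {ξ : ℝ} : ∀ {k : ℕ} {y : Fin (k + 1) → ℝ} {b : Fin k → ℝ},
    Interlace y b → (∀ i, ξ ≠ y i) → (∀ j, ξ ≠ b j) →
    countLt ξ y = countLt ξ b + if 0 < (∏ i, (ξ - y i)) / ∏ j, (ξ - b j) then 1 else 0
  | 0, y, b, _, _, _ => by simp [countLt, -Finset.sum_boole]
  | k + 1, y, b, h, hy, hb => by
    have h' : Interlace (fun i => y i.castSucc) (fun j => b j.castSucc) := fun j =>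
      ⟨(h j.castSucc).1, by simpa using (h j.castSucc).2⟩
    have ih := h'.countLt_eq (fun i => hy _) (fun j => hb _)
    have hl := h (Fin.last k)
    simp only [countLt] at ih ⊢
    rw [Fin.sum_univ_castSucc (n := k + 1), Fin.sum_univ_castSucc (n := k) (f := fun j => ite (b j
        < ξ) _ _), ih,
      Fin.prod_univ_castSucc (n := k + 1), Fin.prod_univ_castSucc (n := k) (f := fun j => ξ - b j),
      mul_div_mul_comm]
    simp only [Fin.succ_last] at hl
    rcases lt_or_gt_of_ne (hy (Fin.last _)) with hy1 | hy1 <;>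
    rcases lt_or_gt_of_ne (hb (Fin.last _)) with hb1 | hb1
    · have : 0 < (ξ - y (Fin.last _)) / (ξ - b (Fin.last _)) :=
        div_pos_of_neg_of_neg (by linarith) (by linarith)
      simp only [mul_pos_iff_of_pos_right this, if_neg hy1.not_gt, if_neg hb1.not_gt]
      ring
    · have h1 : 0 < (∏ i : Fin (k + 1), (ξ - y i.castSucc)) / ∏ j : Fin k, (ξ - b j.castSucc) := by
        refine _root_.div_pos (prod_pos fun i _ => ?_) (prod_pos fun j _ => ?_)
        · have := h.strictMono_left.monotone (Fin.castSucc_le_castSucc_iff.2 (Fin.le_last i))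
          linarith [hl.1]
        · have := h.strictMono_right (Fin.castSucc_lt_last j)
          linarith
      have h2 : (ξ - y (Fin.last _)) / (ξ - b (Fin.last _)) < 0 :=
        div_neg_of_neg_of_pos (by linarith) (by linarith)
      rw [if_pos h1, if_neg hy1.not_gt, if_pos hb1, if_neg (mul_neg_of_pos_of_neg h1 h2).not_gt]
    · exfalso; linarith
    · have : 0 < (ξ - y (Fin.last _)) / (ξ - b (Fin.last _)) :=
        _root_.div_pos (by linarith) (by linarith)
      simp only [mul_pos_iff_of_pos_right this, if_pos hy1, if_pos hb1]
      ring

/-- The coordinate `-cot (θ / 2)` of the point `e^{iθ}`. -/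
def negCot (θ : ℝ) : ℝ := -(Real.cos (θ / 2) / Real.sin (θ / 2))

theorem two_arctan_cayley {θ : ℝ} (hθ : θ ∈ Set.Ioc 0 Real.pi) {Y : ℝ} (h : negCot θ + Y ≠ 0) :
    2 * Real.arctan ((negCot θ * Y - 1) / (negCot θ + Y)) +
      2 * Real.pi * (if 0 < negCot θ + Y then 1 else 0) = 2 * Real.arctan Y + θ := by
  obtain ⟨h0, h1⟩ := hθ
  have hs : 0 < Real.sin (θ / 2) := Real.sin_pos_of_pos_of_lt_pi (by linarith) (by linarith)
  set φ := Real.arctan Y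
  have hφ : Y = Real.sin φ / Real.cos φ := by rw [← Real.tan_eq_sin_div_cos, Real.tan_arctan]
  have hc : 0 < Real.cos φ := Real.cos_arctan_pos Y
  have hφ1 := Real.neg_pi_div_two_lt_arctan Y
  have hφ2 := Real.arctan_lt_pi_div_two Y
  change -(Real.pi / 2) < φ at hφ1
  change φ < Real.pi / 2 at hφ2
  have e1 : negCot θ + Y = -Real.cos (φ + θ / 2) / (Real.cos φ * Real.sin (θ / 2)) := by
    rw [hφ, negCot, Real.cos_add]; field_simp; ring
  have e2 : negCot θ * Y - 1 = -Real.sin (φ + θ / 2) / (Real.cos φ * Real.sin (θ / 2)) := by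
    rw [hφ, negCot, Real.sin_add]; field_simp; ring
  have hcos : Real.cos (φ + θ / 2) ≠ 0 := fun h' => h (by rw [e1, h']; simp)
  have e3 : (negCot θ * Y - 1) / (negCot θ + Y) = Real.tan (φ + θ / 2) := by
    rw [e1, e2, Real.tan_eq_sin_div_cos]; field_simp
  rw [e3]
  have hpos : 0 < negCot θ + Y ↔ Real.cos (φ + θ / 2) < 0 := by
    rw [e1, div_pos_iff_of_pos_right (by positivity)]; exact neg_pos
  rcases lt_or_gt_of_ne hcos with h' | h'
  · rw [if_pos (hpos.2 h')]
    have : Real.pi / 2 < φ + θ / 2 := by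
      by_contra! hle
      exact absurd (Real.cos_nonneg_of_neg_pi_div_two_le_of_le (by linarith) hle) h'.not_ge
    rw [show Real.tan (φ + θ / 2) = Real.tan (φ + θ / 2 - Real.pi) by rw [Real.tan_sub_pi],
      Real.arctan_tan (by linarith) (by linarith)]
    ring
  · rw [if_neg (by rw [hpos]; exact h'.not_gt)]
    have : φ + θ / 2 < Real.pi / 2 := by
      by_contra! hle
      exact absurd (Real.cos_nonpos_of_pi_div_two_le_of_le hle (by linarith)) h'.not_ge
    rw [Real.arctan_tan (by linarith) (by linarith)]
    ring

/-- Translation part of the rational function attached to an interlacing pair. -/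
def sumGap {k : ℕ} (y : Fin (k + 1) → ℝ) (x : Fin k → ℝ) : ℝ := ∑ j, x j - ∑ i, y i

/-- Value at `ξ` of the Cayley transform of the rational function attached to an interlacing
pair. -/
def ratioAt (ξ : ℝ) {k : ℕ} (y : Fin (k + 1) → ℝ) (x : Fin k → ℝ) : ℝ :=
  ξ - (1 + ξ ^ 2) * ((∏ j, (ξ - x j)) / ∏ i, (ξ - y i))

/-- The increment of the phase function over the arc ending at `ξ`. -/
def phaseGap (ξ : ℝ) {k : ℕ} (y : Fin (k + 1) → ℝ) (x : Fin k → ℝ) : ℝ :=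
  2 * Real.arctan (ratioAt ξ y x) - 2 * Real.arctan (sumGap y x) + 2 * Real.pi * countLt ξ y

theorem sum_spectralWeight_mul_div {k : ℕ} {b : Fin (k + 1) → ℝ} (hb : StrictMono b)
    (x : Fin k → ℝ) {ξ : ℝ} (hξ : ∀ j, ξ ≠ b j) :
    ∑ j, spectralWeight b x j * ((1 + b j * ξ) / (b j - ξ)) = ratioAt ξ b x := by
  have h : ∀ j, spectralWeight b x j * ((1 + b j * ξ) / (b j - ξ)) =
      ξ * spectralWeight b x j - (1 + ξ ^ 2) * (spectralWeight b x j / (ξ - b j)) := fun j => by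
    have h1 := sub_ne_zero.2 (hξ j)
    have h2 := sub_ne_zero.2 (hξ j).symm
    field_simp
    ring
  simp only [h]
  rw [sum_sub_distrib, ← mul_sum, ← mul_sum, sum_spectralWeight hb.injective,
    sum_spectralWeight_div hb.injective x hξ, ratioAt, mul_one]

theorem Interlace.phaseGap_eq {k : ℕ} {y : Fin (k + 1) → ℝ} {b : Fin k → ℝ} (h : Interlace y b)
    {θ : ℝ} (hθ : θ ∈ Set.Ioc 0 Real.pi) (hy : ∀ i, negCot θ ≠ y i) (hb : ∀ j, negCot θ ≠ b j) :
    phaseGap (negCot θ) y b = θ + 2 * Real.arctan (sumGap y b + ∑ j, poleWeight b y j * b j +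
        ∑ j, poleWeight b y j * ((1 + b j * negCot θ) / (b j - negCot θ))) -
      2 * Real.arctan (sumGap y b) + 2 * Real.pi * countLt (negCot θ) b := by
  set ξ := negCot θ
  set Y := sumGap y b + ∑ j, poleWeight b y j * b j +
    ∑ j, poleWeight b y j * ((1 + b j * ξ) / (b j - ξ))
  have hr : (∏ i, (ξ - y i)) / ∏ j, (ξ - b j) = ξ + Y := by
    have := prod_div_eq_herglotz (K := ℝ) h.strictMono_right.injective y hb
    simp only [Algebra.algebraMap_self, RingHom.id_apply] at this
    rw [this]
    simp only [Y, sumGap, mul_div_assoc]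
    ring
  have hne : ξ + Y ≠ 0 := by
    rw [← hr]
    exact div_ne_zero (prod_ne_zero_iff.2 fun i _ => sub_ne_zero.2 (hy i))
      (prod_ne_zero_iff.2 fun i _ => sub_ne_zero.2 (hb i))
  have hratio : ratioAt ξ y b = (ξ * Y - 1) / (ξ + Y) := by
    rw [ratioAt, ← inv_div, hr]
    field_simp
    ring
  have := two_arctan_cayley hθ hne
  rw [phaseGap, h.countLt_eq hy hb, hratio, hr]
  linear_combination this

theorem measurableSet_interlace (k : ℕ) :
    MeasurableSet {p : (Fin (k + 1) → ℝ) × (Fin k → ℝ) | Interlace p.1 p.2} := by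
  simp only [Interlace, Set.ofPred_forall]
  refine MeasurableSet.iInter fun j => ?_
  have h1 : Measurable fun p : (Fin (k + 1) → ℝ) × (Fin k → ℝ) => p.1 j.castSucc := by fun_prop
  have h2 : Measurable fun p : (Fin (k + 1) → ℝ) × (Fin k → ℝ) => p.2 j := by fun_prop
  have h3 : Measurable fun p : (Fin (k + 1) → ℝ) × (Fin k → ℝ) => p.1 j.succ := by fun_prop
  exact (measurableSet_lt h1 h2).inter (measurableSet_lt h2 h3)

theorem measurableSet_strictMono (n : ℕ) : MeasurableSet {y : Fin n → ℝ | StrictMono y} := by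
  simp only [StrictMono, Set.ofPred_forall]
  exact MeasurableSet.iInter fun i => MeasurableSet.iInter fun j => MeasurableSet.iInter fun _ =>
    measurableSet_lt (by fun_prop) (by fun_prop)

@[fun_prop]
theorem measurable_sumGap {α : Type*} [MeasurableSpace α] {k : ℕ}
    {y : α → Fin (k + 1) → ℝ} {x : α → Fin k → ℝ} (hy : Measurable y) (hx : Measurable x) :
    Measurable fun a => sumGap (y a) (x a) := by
  unfold sumGap; fun_prop

@[fun_prop]
theorem measurable_ratioAt {α : Type*} [MeasurableSpace α] {ξ : ℝ} {k : ℕ}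
    {y : α → Fin (k + 1) → ℝ} {x : α → Fin k → ℝ} (hy : Measurable y) (hx : Measurable x) :
    Measurable fun a => ratioAt ξ (y a) (x a) := by
  unfold ratioAt; fun_prop

@[fun_prop]
theorem measurable_arctan' {α : Type*} [MeasurableSpace α] {f : α → ℝ} (hf : Measurable f) :
    Measurable fun a => Real.arctan (f a) := Real.measurable_arctan.comp hf

@[fun_prop]
theorem measurable_phaseGap {α : Type*} [MeasurableSpace α] {ξ : ℝ} {k : ℕ}
    {y : α → Fin (k + 1) → ℝ} {x : α → Fin k → ℝ} (hy : Measurable y) (hx : Measurable x) :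
    Measurable fun a => phaseGap ξ (y a) (x a) := by
  unfold phaseGap; fun_prop

/-- Integral of a function of the two phases against the weight of interlacing pairs. -/
def pairIntegral (β ξ : ℝ) (k : ℕ) (F : ℝ → ℝ → ENNReal) : ENNReal :=
  ∫⁻ y in {y : Fin (k + 1) → ℝ | StrictMono y}, ∫⁻ x in {x | Interlace y x},
    ENNReal.ofReal (interlaceWeight β y x) * F (sumGap y x) (phaseGap ξ y x)

theorem lintegral_interlace_swap {k : ℕ} {f : (Fin (k + 1) → ℝ) → (Fin k → ℝ) → ENNReal}
    (hf : Measurable (Function.uncurry f)) :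
    ∫⁻ y in {y : Fin (k + 1) → ℝ | StrictMono y}, ∫⁻ x in {x | Interlace y x}, f y x =
      ∫⁻ x in {x : Fin k → ℝ | StrictMono x}, ∫⁻ y in {y | Interlace y x}, f y x := by
  have h1 : ∀ y : Fin (k + 1) → ℝ, {y : Fin (k + 1) → ℝ | StrictMono y}.indicator
      (fun y => ∫⁻ x in {x | Interlace y x}, f y x) y =
      ∫⁻ x, {p : (Fin (k + 1) → ℝ) × (Fin k → ℝ) | Interlace p.1 p.2}.indicator
        (Function.uncurry f) (y, x) := fun y => by
    by_cases hy : StrictMono y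
    · rw [Set.indicator_of_mem hy, ← lintegral_indicator (measurableSet_interlace_right y)]
      rfl
    · rw [Set.indicator_of_notMem hy, ← lintegral_zero (μ := (volume : Measure (Fin k → ℝ)))]
      refine lintegral_congr fun x => (Set.indicator_of_notMem (fun h => hy ?_) _).symm
      exact Interlace.strictMono_left h
  have h2 : ∀ x : Fin k → ℝ, {x : Fin k → ℝ | StrictMono x}.indicator
      (fun x => ∫⁻ y in {y | Interlace y x}, f y x) x =
      ∫⁻ y, {p : (Fin (k + 1) → ℝ) × (Fin k → ℝ) | Interlace p.1 p.2}.indicator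
        (Function.uncurry f) (y, x) := fun x => by
    by_cases hx : StrictMono x
    · rw [Set.indicator_of_mem hx, ← lintegral_indicator (measurableSet_interlace_left x)]
      rfl
    · rw [Set.indicator_of_notMem hx,
        ← lintegral_zero (μ := (volume : Measure (Fin (k + 1) → ℝ)))]
      refine lintegral_congr fun y => (Set.indicator_of_notMem (fun h => hx ?_) _).symm
      exact Interlace.strictMono_right h
  rw [← lintegral_indicator (measurableSet_strictMono _),
    ← lintegral_indicator (measurableSet_strictMono _)]
  simp only [h1, h2]
  exact lintegral_lintegral_swap (hf.indicator (measurableSet_interlace k)).aemeasurable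

theorem ae_forall_ne (n : ℕ) (ξ : ℝ) : ∀ᵐ y : Fin n → ℝ, ∀ i, ξ ≠ y i := by
  rw [ae_all_iff]
  intro i
  have := Measure.pi_hyperplane (fun _ : Fin n => (volume : Measure ℝ)) i ξ
  rw [← volume_pi] at this
  rw [ae_iff]
  simpa [eq_comm] using this

theorem pairIntegral_succ {β θ : ℝ} (hθ : θ ∈ Set.Ioc 0 Real.pi) (k : ℕ)
    {F : ℝ → ℝ → ENNReal} (hF : Measurable (Function.uncurry F)) :
    pairIntegral β (negCot θ) (k + 1) F =
      ∫⁻ b in {b : Fin (k + 1) → ℝ | StrictMono b}, ∫⁻ x in {x | Interlace b x},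
        ENNReal.ofReal (interlaceWeight β b x) * ∫⁻ r in Set.Ioi (0 : ℝ),
          ENNReal.ofReal (r ^ (((k + 1 : ℕ) : ℝ) * (β / 2) - 1)) * ∫⁻ q,
            ENNReal.ofReal (((1 + r) ^ 2 + q ^ 2) ^ (-(((k + 1 : ℕ) : ℝ) * (β / 2) + 1))) *
              F (q + r * sumGap b x) (θ + 2 * Real.arctan (q + r * ratioAt (negCot θ) b x) -
                2 * Real.arctan (q + r * sumGap b x) + 2 * Real.pi * countLt (negCot θ) b) := by
  unfold pairIntegral
  have hF' : ∀ {α : Type} [MeasurableSpace α] {u v : α → ℝ}, Measurable u → Measurable v →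
      Measurable fun a => F (u a) (v a) := fun hu hv => hF.comp (hu.prodMk hv)
  rw [lintegral_interlace_swap (by
    refine Measurable.mul (by fun_prop) (hF' (by fun_prop) (by fun_prop)))]
  refine lintegral_congr_ae ?_
  rw [EventuallyEq, ae_restrict_iff' (measurableSet_strictMono _)]
  filter_upwards [ae_forall_ne (k + 1) (negCot θ)] with b hb hmono
  set ξ := negCot θ
  let G : ℝ → (Fin (k + 1) → ℝ) → ENNReal := fun q g => F (q - ∑ j, g j * b j)
    (θ + 2 * Real.arctan (q + ∑ j, g j * ((1 + b j * ξ) / (b j - ξ))) -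
      2 * Real.arctan (q - ∑ j, g j * b j) + 2 * Real.pi * countLt ξ b)
  have hG : Measurable (Function.uncurry G) := hF' (by fun_prop) (by fun_prop)
  calc _ = ∫⁻ y in {y | Interlace y b}, ENNReal.ofReal (interlaceWeight β y b) *
        G (∑ j, b j - ∑ i, y i + ∑ j, poleWeight b y j * b j) (poleWeight b y) := by
        refine lintegral_congr_ae ?_
        rw [EventuallyEq, ae_restrict_iff' (measurableSet_interlace_left _)]
        filter_upwards [ae_forall_ne (k + 1 + 1) ξ] with y hy hint
        rw [Interlace.phaseGap_eq hint hθ hy hb]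
        simp only [G, sumGap, add_sub_cancel_right]
        rfl
    _ = _ := by
        rw [← lintegral_weights_shift hmono β hG, lintegral_weights_polar hmono β ?_]
        · refine setLIntegral_congr_fun (measurableSet_interlace_right b)
            fun x (hx : Interlace b x) => ?_
          have e1 : ∀ r : ℝ, ∑ j, (r • spectralWeight b x) j = r := fun r => by
            simp [← mul_sum, sum_spectralWeight hmono.injective]
          have e2 : ∀ r : ℝ, ∑ j, (r • spectralWeight b x) j * b j = - (r * sumGap b x) :=
            fun r => by
              simp [mul_assoc, ← mul_sum, sum_spectralWeight_mul hmono.injective, sumGap]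
              ring
          have e3 : ∀ r : ℝ, ∑ j, (r • spectralWeight b x) j * ((1 + b j * ξ) / (b j - ξ)) =
              r * ratioAt ξ b x := fun r => by
            simp only [Pi.smul_apply, smul_eq_mul, mul_assoc, ← mul_sum,
              sum_spectralWeight_mul_div hmono x hb]
          simp only [e1, e2, e3, G, sub_neg_eq_add]
        · exact Measurable.lintegral_prod_right' (f := fun p : (Fin (k + 1) → ℝ) × ℝ =>
            ENNReal.ofReal (((1 + ∑ i, p.1 i) ^ 2 + p.2 ^ 2) ^
              (-(((k + 1 : ℕ) : ℝ) * (β / 2) + 1))) * G p.2 p.1)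
            (Measurable.mul (by fun_prop) (hG.comp measurable_swap))

theorem lintegral_periodic_shift {f : ℝ → ENNReal} (hf : ∀ s, f (s + 2 * Real.pi) = f s) (a : ℝ) :
    ∫⁻ s in Set.Ioc (-Real.pi) Real.pi, f (s + a) =
      ∫⁻ s in Set.Ioc (-Real.pi) Real.pi, f s := by
  have h1 : ∫⁻ s in Set.Ioc (-Real.pi) Real.pi, f (s + a) =
      ∫⁻ s in Set.Ioc (-Real.pi + a) (-Real.pi + a + 2 * Real.pi), f s := by
    have := (measurePreserving_add_right volume a).setLIntegral_comp_preimage_emb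
      (measurableEmbedding_addRight a) f (Set.Ioc (-Real.pi + a) (-Real.pi + a + 2 * Real.pi))
    rw [← this, Set.preimage_add_const_Ioc]
    congr 3 <;> ring
  have hT : (0:ℝ) < 2 * Real.pi := Real.two_pi_pos
  have h2 := IsAddFundamentalDomain.setLIntegral_eq (isAddFundamentalDomain_Ioc hT (-Real.pi + a))
    (isAddFundamentalDomain_Ioc hT (-Real.pi)) f fun g x => by
      obtain ⟨n, hn⟩ := AddSubgroup.mem_zmultiples_iff.1 g.2
      have : Function.Periodic f (2 * Real.pi) := hf
      change f ((g : ℝ) + x) = f x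
      rw [← hn, add_comm]
      exact this.zsmul n x
  rw [h1, h2]
  congr 3
  ring

/-- Twice the argument of `1 + α e^{-is}`. -/
def diskArg (α : ℂ) (s : ℝ) : ℝ := 2 * (1 + α * Complex.exp (-(s * Complex.I))).arg

theorem diskArg_add_two_pi (α : ℂ) (s : ℝ) : diskArg α (s + 2 * Real.pi) = diskArg α s := by
  simp only [diskArg]
  push_cast
  rw [show -((s + 2 * (Real.pi : ℂ)) * Complex.I) = -(s * Complex.I) - 2 * Real.pi * Complex.I by
    ring, Complex.exp_periodic.sub_eq]

theorem diskArg_add_int (α : ℂ) (s : ℝ) (n : ℤ) :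
    diskArg α (s + 2 * Real.pi * n) = diskArg α s := by
  have : Function.Periodic (diskArg α) (2 * Real.pi) := diskArg_add_two_pi α
  simpa [mul_comm] using this.int_mul n s

theorem exp_two_arg (z : ℂ) (hz : z ≠ 0) :
    Complex.exp (((2 * z.arg : ℝ) : ℂ) * Complex.I) = z / (starRingEnd ℂ) z := by
  have h1 : (‖z‖ : ℂ) ≠ 0 := by exact_mod_cast norm_ne_zero_iff.2 hz
  have h2 : (starRingEnd ℂ) z ≠ 0 := by simpa using hz
  have h3 := Complex.norm_mul_exp_arg_mul_I z
  rw [eq_div_iff h2]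
  have h4 : z * (starRingEnd ℂ) z = (‖z‖ : ℂ) ^ 2 := by
    rw [Complex.mul_conj, Complex.normSq_eq_norm_sq]; push_cast; rfl
  have h5 : Complex.exp (((2 * z.arg : ℝ) : ℂ) * Complex.I) =
      Complex.exp (z.arg * Complex.I) ^ 2 := by
    rw [← Complex.exp_nat_mul]; push_cast; ring_nf
  have h6 : Complex.exp (z.arg * Complex.I) = z / ‖z‖ := by rw [eq_div_iff h1, mul_comm, h3]
  rw [h5, h6]
  field_simp
  rw [h4]

theorem arg_one_add_mul_I (y : ℝ) : (1 + y * Complex.I : ℂ).arg = Real.arctan y := by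
  rw [Complex.arg_of_re_nonneg (by simp), Real.arctan_eq_arcsin, Complex.norm_def]
  simp [Complex.normSq_apply, ← pow_two]

theorem arg_lt_of_re_pos {z : ℂ} (hz : 0 < z.re) : -(Real.pi / 2) < z.arg ∧ z.arg < Real.pi / 2 :=
  abs_lt.1 (Complex.abs_arg_lt_pi_div_two_iff.2 (Or.inl hz))

theorem one_add_re_pos {z : ℂ} (hz : ‖z‖ < 1) : 0 < (1 + z).re := by
  have := (abs_le.1 (Complex.abs_re_le_norm z)).1
  simp only [Complex.add_re, Complex.one_re]
  linarith

theorem norm_cayley_lt {p : ℂ} (hp : 0 < p.re) : ‖(1 - p) / (1 + p)‖ < 1 := by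
  have h0 : 1 + p ≠ 0 := fun h => by
    have := congrArg Complex.re h
    simp at this; linarith
  rw [norm_div, div_lt_one (norm_pos_iff.2 h0)]
  refine lt_of_pow_lt_pow_left₀ 2 (norm_nonneg _) ?_
  rw [← Complex.normSq_eq_norm_sq, ← Complex.normSq_eq_norm_sq, Complex.normSq_apply,
    Complex.normSq_apply]
  simp
  nlinarith

theorem two_arctan_mobius {p : ℂ} (hp : 0 < p.re) (y : ℝ) :
    2 * Real.arctan (-p.im + p.re * y) = 2 * Real.arctan y - 2 * (1 + p).arg +
      diskArg ((1 - p) / (1 + p)) (2 * Real.arctan y - 2 * (1 + p).arg) := by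
  set α := (1 - p) / (1 + p)
  set s := 2 * Real.arctan y - 2 * (1 + p).arg with hs
  have hA : 1 + p ≠ 0 := fun h => by
    have := congrArg Complex.re h
    simp at this; linarith
  have hA' : 1 + (starRingEnd ℂ) p ≠ 0 := by
    have : (starRingEnd ℂ) (1 + p) ≠ 0 := (map_ne_zero _).2 hA
    rwa [map_add, map_one] at this
  have hy : (1 + y * Complex.I : ℂ) ≠ 0 := fun h => by
    have := congrArg Complex.re h
    simp at this
  have hy' : (1 - y * Complex.I : ℂ) ≠ 0 := fun h => by
    have := congrArg Complex.re h
    simp at this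
  have he : Complex.exp (-(s * Complex.I)) = ((1 - y * Complex.I) / (1 + y * Complex.I)) *
      ((1 + p) / (1 + (starRingEnd ℂ) p)) := by
    have e1 : Complex.exp (-(s * Complex.I)) =
        (Complex.exp (((2 * (1 + y * Complex.I : ℂ).arg : ℝ) : ℂ) * Complex.I))⁻¹ *
        Complex.exp (((2 * (1 + p).arg : ℝ) : ℂ) * Complex.I) := by
      rw [← Complex.exp_neg, ← Complex.exp_add, arg_one_add_mul_I, hs]
      congr 1
      push_cast
      ring
    rw [e1, exp_two_arg _ hA, exp_two_arg _ hy]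
    simp [← sub_eq_add_neg]
  set W := 1 + α * Complex.exp (-(s * Complex.I)) with hW
  have hWre : 0 < W.re := by
    refine one_add_re_pos ?_
    rw [norm_mul, show -((s : ℂ) * Complex.I) = ((-s : ℝ) : ℂ) * Complex.I by push_cast; ring,
      Complex.norm_exp_ofReal_mul_I, mul_one]
    exact norm_cayley_lt hp
  have hW0 : W ≠ 0 := fun h => by rw [h] at hWre; simp at hWre
  set q := -p.im + p.re * y with hq
  have hprod : (1 + q * Complex.I) * 2 = (starRingEnd ℂ) (1 + p) * ((1 + y * Complex.I) * W) := by
    have e0 : (starRingEnd ℂ) (1 + p) * ((1 + y * Complex.I) * W) =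
        (1 + (starRingEnd ℂ) p) * (1 + y * Complex.I) + (1 - p) * (1 - y * Complex.I) := by
      rw [hW, he, map_add, map_one]
      simp only [α]
      field_simp
    rw [e0, hq]
    apply Complex.ext <;> simp <;> ring
  have hpos := arg_lt_of_re_pos hWre
  have hA2 := arg_lt_of_re_pos (z := (1 + p)) (by simp; linarith)
  have harg : (starRingEnd ℂ (1 + p)).arg = -(1 + p).arg := by
    rw [Complex.arg_conj, if_neg (by linarith [Real.pi_pos])]
  have hq1 := Real.neg_pi_div_two_lt_arctan q
  have hq2 := Real.arctan_lt_pi_div_two q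
  have hy1 := Real.neg_pi_div_two_lt_arctan y
  have hy2 := Real.arctan_lt_pi_div_two y
  have hangle : ((Real.arctan q : ℝ) : Real.Angle) =
      ((-(1 + p).arg + Real.arctan y + W.arg : ℝ) : Real.Angle) := by
    have : ((1 + q * Complex.I : ℂ) * 2).arg = Real.arctan q := by
      rw [← arg_one_add_mul_I]
      exact Complex.arg_mul_real (r := 2) (by norm_num) _
    rw [← this, hprod, Complex.arg_mul_coe_angle ((map_ne_zero _).2 hA) (mul_ne_zero hy hW0),
      Complex.arg_mul_coe_angle hy hW0, harg, arg_one_add_mul_I]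
    simp only [Real.Angle.coe_add, add_assoc]
  obtain ⟨k, hk⟩ := Real.Angle.angle_eq_iff_two_pi_dvd_sub.1 hangle
  have hpi := Real.pi_pos
  have hk0 : k = 0 := by
    have h1 : (k : ℝ) < 1 := by nlinarith
    have h2 : (-1 : ℝ) < k := by nlinarith
    have h1' : k < 1 := by exact_mod_cast h1
    have h2' : -1 < k := by exact_mod_cast h2
    omega
  rw [hk0] at hk
  simp only [diskArg]
  rw [← hW]
  push_cast at hk
  linarith

theorem det_restrictScalars_toSpanSingleton (z : ℂ) :
    (((ContinuousLinearMap.toSpanSingleton ℂ z).restrictScalars ℝ) : ℂ →L[ℝ] ℂ).det =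
      Complex.normSq z := by
  simp [ContinuousLinearMap.det, LinearMap.det_restrictScalars, Algebra.norm_complex_eq]

theorem hasDerivAt_cayley {z : ℂ} (hz : 1 + z ≠ 0) :
    HasDerivAt (fun z : ℂ => (1 - z) / (1 + z)) (-2 / (1 + z) ^ 2) z := by
  have := ((hasDerivAt_id z).const_sub 1).div ((hasDerivAt_id z).const_add 1) hz
  refine this.congr_deriv ?_
  simp only [id]
  congr 1
  ring

theorem cayley_cayley {z : ℂ} (hz : 1 + z ≠ 0) :
    (1 - (1 - z) / (1 + z)) / (1 + (1 - z) / (1 + z)) = z := by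
  have h : 1 + (1 - z) / (1 + z) = 2 / (1 + z) := by field_simp; ring
  rw [h]
  field_simp
  ring

theorem one_add_ne_zero_of_norm_lt {z : ℂ} (hz : ‖z‖ < 1) : 1 + z ≠ 0 := fun h =>
  (one_add_re_pos hz).ne' (by rw [h, Complex.zero_re])

theorem one_add_ne_zero_of_re_pos {z : ℂ} (hz : 0 < z.re) : 1 + z ≠ 0 := by
  intro h
  have := congrArg Complex.re h
  simp at this
  linarith

theorem cayley_re (z : ℂ) :
    ((1 - z) / (1 + z)).re = (1 - ‖z‖ ^ 2) / ‖1 + z‖ ^ 2 := by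
  rw [Complex.div_re, ← Complex.normSq_eq_norm_sq, ← Complex.normSq_eq_norm_sq, ← add_div]
  congr 1
  simp [Complex.normSq_apply]
  ring

theorem image_cayley :
    (fun z : ℂ => (1 - z) / (1 + z)) '' Metric.ball 0 1 = {p : ℂ | 0 < p.re} := by
  ext p
  simp only [Set.mem_image, Metric.mem_ball, dist_zero_right]
  constructor
  · rintro ⟨z, hz, rfl⟩
    have h := one_add_ne_zero_of_norm_lt hz
    rw [Set.mem_ofPred_eq, cayley_re]
    have := norm_pos_iff.2 h
    have : ‖z‖ ^ 2 < 1 := by have := norm_nonneg z; nlinarith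
    have : 0 < 1 - ‖z‖ ^ 2 := by linarith
    positivity
  · intro hp
    exact ⟨(1 - p) / (1 + p), norm_cayley_lt hp, cayley_cayley (one_add_ne_zero_of_re_pos hp)⟩

theorem disk_rpow_identity {P A : ℝ} (c : ℝ) (hP : 0 < P) (hA : 0 < A) :
    4 / A ^ 2 * ((P / A) ^ (c - 1) * (4 / A) ^ (-(c + 1))) = 4 ^ (-c) * P ^ (c - 1) := by
  rw [← Real.exp_log hP, ← Real.exp_log hA, ← Real.exp_log (show (0:ℝ) < 4 by norm_num)]
  simp only [← Real.exp_nat_mul, ← Real.exp_add, ← Real.exp_sub, ← Real.exp_mul]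
  congr 1
  push_cast
  ring

theorem lintegral_halfPlane_eq_disk (c : ℝ) (H : ℂ → ENNReal) :
    ∫⁻ p in {p : ℂ | 0 < p.re}, ENNReal.ofReal (p.re ^ (c - 1)) *
      (ENNReal.ofReal (((1 + p.re) ^ 2 + p.im ^ 2) ^ (-(c + 1))) * H ((1 - p) / (1 + p))) =
    ∫⁻ z in Metric.ball (0 : ℂ) 1,
      ENNReal.ofReal (4 ^ (-c) * (1 - ‖z‖ ^ 2) ^ (c - 1)) * H z := by
  rw [← image_cayley, lintegral_image_eq_lintegral_abs_det_fderiv_mul volume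
    Metric.isOpen_ball.measurableSet (f := fun z : ℂ => (1 - z) / (1 + z))
    (f' := fun z => (ContinuousLinearMap.toSpanSingleton ℂ (-2 / (1 + z) ^ 2)).restrictScalars ℝ)
    (fun z hz => ((hasDerivAt_cayley (one_add_ne_zero_of_norm_lt
      (by simpa using hz))).hasFDerivAt.restrictScalars ℝ).hasFDerivWithinAt)
    (fun z hz w hw h => by
      simp only at h
      rw [← cayley_cayley (one_add_ne_zero_of_norm_lt (z := z) (by simpa using hz)), h,
        cayley_cayley (one_add_ne_zero_of_norm_lt (z := w) (by simpa using hw))])]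
  refine setLIntegral_congr_fun Metric.isOpen_ball.measurableSet fun z hz => ?_
  have hz1 : ‖z‖ < 1 := by simpa using hz
  have h := one_add_ne_zero_of_norm_lt hz1
  simp only [cayley_cayley h, det_restrictScalars_toSpanSingleton]
  rw [← mul_assoc, ← mul_assoc, ← ENNReal.ofReal_mul (by positivity), ← ENNReal.ofReal_mul]
  · congr 2
    have hA : 0 < ‖1 + z‖ ^ 2 := by have := norm_pos_iff.2 h; positivity
    have hP : 0 < 1 - ‖z‖ ^ 2 := by have := norm_nonneg z; nlinarith
    rw [cayley_re, ← disk_rpow_identity c hP hA, abs_of_nonneg (Complex.normSq_nonneg _),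
      mul_assoc]
    have e2 : (1 + (1 - ‖z‖ ^ 2) / ‖1 + z‖ ^ 2) ^ 2 + ((1 - z) / (1 + z)).im ^ 2 =
        4 / ‖1 + z‖ ^ 2 := by
      have : (1 + (1 - z) / (1 + z)) = 2 / (1 + z) := by field_simp; ring
      have h3 := congrArg Complex.normSq this
      rw [Complex.normSq_apply, map_div₀, Complex.normSq_eq_norm_sq (1 + z)] at h3
      simp only [Complex.add_re, Complex.one_re, cayley_re, Complex.add_im, Complex.one_im] at h3
      rw [show (4 : ℝ) = Complex.normSq 2 by simp; norm_num, ← h3]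
      ring
    rw [e2]
    congr 1
    rw [map_div₀, map_pow, Complex.normSq_eq_norm_sq (1 + z)]
    simp [Complex.normSq_apply]
    norm_num
  · refine mul_nonneg (abs_nonneg _) (Real.rpow_nonneg ?_ _)
    rw [cayley_re]
    have : ‖z‖ ^ 2 ≤ 1 := by have := norm_nonneg z; nlinarith
    have : 0 ≤ 1 - ‖z‖ ^ 2 := by linarith
    positivity

theorem lintegral_disk_polar (c : ℝ) {H : ℂ → ENNReal} (hH : Measurable H) :
    ∫⁻ z in Metric.ball (0 : ℂ) 1, ENNReal.ofReal (4 ^ (-c) * (1 - ‖z‖ ^ 2) ^ (c - 1)) * H z =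
    ENNReal.ofReal (4 ^ (-c)) * ∫⁻ ρ in Set.Ioo (0 : ℝ) 1,
      ENNReal.ofReal (ρ * (1 - ρ ^ 2) ^ (c - 1)) *
        ∫⁻ u in Set.Ioc (-Real.pi) Real.pi, H (ρ * Complex.exp (u * Complex.I)) := by
  rw [← lintegral_indicator Metric.isOpen_ball.measurableSet,
    ← Complex.lintegral_comp_polarCoord_symm, polarCoord_target,
    Measure.volume_eq_prod, ← Measure.prod_restrict]
  have hm : Measurable fun z : ℂ =>
      ENNReal.ofReal (4 ^ (-c) * (1 - ‖z‖ ^ 2) ^ (c - 1)) * H z := by fun_prop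
  have hm' : Measurable fun p : ℝ × ℝ => Complex.polarCoord.symm p := by
    have : (fun p : ℝ × ℝ => Complex.polarCoord.symm p) = fun p : ℝ × ℝ =>
      (p.1 * (Real.cos p.2 + Real.sin p.2 * Complex.I) : ℂ) := by
      ext p; rw [Complex.polarCoord_symm_apply]
    rw [this]; fun_prop
  have hm'' := (hm.indicator (Metric.isOpen_ball (x := (0 : ℂ)) (ε := 1)).measurableSet).comp hm'
  have hm3 : Measurable fun p : ℝ × ℝ => ENNReal.ofReal p.1 • (Metric.ball (0 : ℂ) 1).indicator
      (fun z : ℂ => ENNReal.ofReal (4 ^ (-c) * (1 - ‖z‖ ^ 2) ^ (c - 1)) * H z)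
        (Complex.polarCoord.symm p) := measurable_fst.ennreal_ofReal.smul hm''
  rw [lintegral_prod _ hm3.aemeasurable]
  rw [← Set.Ioi_inter_Iio (a := (0 : ℝ)), Set.inter_comm, ← Measure.restrict_restrict
      measurableSet_Iio,
    ← lintegral_indicator measurableSet_Iio, ← lintegral_const_mul' _ _ ENNReal.ofReal_ne_top]
  refine setLIntegral_congr_fun measurableSet_Ioi fun ρ (hρ : 0 < ρ) => ?_
  have hn : ∀ u : ℝ, ‖Complex.polarCoord.symm (ρ, u)‖ = ρ := fun u => by
    rw [Complex.norm_polarCoord_symm, abs_of_pos hρ]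
  have hs : ∀ u : ℝ, Complex.polarCoord.symm (ρ, u) = ρ * Complex.exp (u * Complex.I) :=
    fun u => by
      rw [Complex.polarCoord_symm_apply, Complex.exp_mul_I]
      push_cast; rfl
  simp only [smul_eq_mul]
  by_cases h1 : ρ < 1
  · rw [Set.indicator_of_mem (show ρ ∈ Set.Iio 1 from h1), ← lintegral_const_mul' _ _
      ENNReal.ofReal_ne_top, ← lintegral_const_mul' _ _ ENNReal.ofReal_ne_top,
      setLIntegral_congr Ioo_ae_eq_Ioc]
    refine lintegral_congr fun u => ?_
    have hmem : Complex.polarCoord.symm (ρ, u) ∈ Metric.ball (0 : ℂ) 1 := by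
      rw [mem_ball_zero_iff, hn]; exact h1
    rw [Set.indicator_of_mem hmem, hn, hs, ENNReal.ofReal_mul (by positivity),
      ENNReal.ofReal_mul hρ.le]
    ring
  · rw [Set.indicator_of_notMem (show ρ ∉ Set.Iio 1 from h1), mul_zero]
    refine (lintegral_congr fun u => ?_).trans lintegral_zero
    have hmem : Complex.polarCoord.symm (ρ, u) ∉ Metric.ball (0 : ℂ) 1 := by
      rw [mem_ball_zero_iff, hn]; exact h1
    rw [Set.indicator_of_notMem hmem, mul_zero]

theorem lintegral_halfPlane_eq_prod {f : ℂ → ENNReal} (hf : Measurable f) :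
    ∫⁻ p in {p : ℂ | 0 < p.re}, f p = ∫⁻ r in Set.Ioi (0 : ℝ), ∫⁻ q : ℝ, f ⟨r, q⟩ := by
  rw [← Complex.volume_preserving_equiv_real_prod.symm.setLIntegral_comp_preimage_emb
    Complex.measurableEquivRealProd.symm.measurableEmbedding]
  have : (Complex.measurableEquivRealProd.symm ⁻¹' {p : ℂ | 0 < p.re}) =
      Set.Ioi (0 : ℝ) ×ˢ Set.univ := by
    ext p; simp [Complex.measurableEquivRealProd]
  rw [this, Measure.volume_eq_prod, ← Measure.prod_restrict, Measure.restrict_univ,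
    lintegral_prod _ (by
      exact (hf.comp Complex.measurableEquivRealProd.symm.measurable).aemeasurable)]
  rfl

@[fun_prop]
theorem measurable_diskArg {α : Type*} [MeasurableSpace α] {z : α → ℂ} {s : α → ℝ}
    (hz : Measurable z) (hs : Measurable s) : Measurable fun a => diskArg (z a) (s a) := by
  unfold diskArg
  exact (Complex.measurable_arg.comp (by fun_prop)).const_mul 2

theorem diskArg_mul_exp (z : ℂ) (u s : ℝ) :
    diskArg (z * Complex.exp (u * Complex.I)) s = diskArg z (s - u) := by
  simp only [diskArg]
  rw [mul_assoc, ← Complex.exp_add]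
  push_cast
  ring_nf

/-- The law of the modulus of the Verblunsky-type coefficient of parameter `c`. -/
def radialMeasure (c : ℝ) : Measure ℝ :=
  (volume.restrict (Set.Ioo 0 1)).withDensity fun ρ =>
    ENNReal.ofReal (2 * c * (ρ * (1 - ρ ^ 2) ^ (c - 1)))

/-- The uniform probability measure on `(-π, π]`. -/
def uniformPhase : Measure ℝ :=
  ENNReal.ofReal (2 * Real.pi)⁻¹ • volume.restrict (Set.Ioc (-Real.pi) Real.pi)

instance (c : ℝ) : SFinite (radialMeasure c) := by unfold radialMeasure; infer_instance

/-- The joint law of modulus and phase of the coefficient of parameter `c`. -/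
def stepMeasure (c : ℝ) : Measure (ℝ × ℝ) := (radialMeasure c).prod uniformPhase

instance : IsProbabilityMeasure uniformPhase := ⟨by
  have := Real.pi_pos
  rw [uniformPhase, Measure.smul_apply, Measure.restrict_apply_univ, Real.volume_Ioc, smul_eq_mul,
    sub_neg_eq_add, ← two_mul, ← ENNReal.ofReal_mul (by positivity),
    inv_mul_cancel₀ (by positivity), ENNReal.ofReal_one]⟩

/-- Random part of the one-step increment of the relative phase. -/
def phaseJump (x : ℝ) (w : ℝ × ℝ) : ℝ := diskArg w.1 (w.2 + x) - diskArg w.1 w.2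

@[fun_prop]
theorem measurable_phaseJump {α : Type*} [MeasurableSpace α] {x : α → ℝ} {w : α → ℝ × ℝ}
    (hx : Measurable x) (hw : Measurable w) : Measurable fun a => phaseJump (x a) (w a) := by
  unfold phaseJump; fun_prop

/-- Law of the relative phase after `k` steps. -/
def phaseLaw (β θ : ℝ) : ℕ → Measure ℝ
  | 0 => Measure.dirac θ
  | k + 1 => ((phaseLaw β θ k).prod (stepMeasure (((k + 1 : ℕ) : ℝ) * (β / 2)))).map
      fun p => θ + p.1 + phaseJump p.1 p.2

/-- Total mass constant for interlacing pairs. -/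
def pairConst (β : ℝ) : ℕ → ℝ
  | 0 => 1 / 2
  | k + 1 => pairConst β k *
      (4 ^ (-(((k + 1 : ℕ) : ℝ) * (β / 2))) * Real.pi / (((k + 1 : ℕ) : ℝ) * (β / 2)))

instance (c : ℝ) : SFinite (stepMeasure c) := by unfold stepMeasure; infer_instance

instance (β θ : ℝ) : ∀ k, SFinite (phaseLaw β θ k)
  | 0 => by unfold phaseLaw; infer_instance
  | k + 1 => by
    have := instSFiniteRealPhaseLaw β θ k
    unfold phaseLaw; infer_instance

theorem lintegral_stepMeasure {c : ℝ} (f : ℝ × ℝ → ENNReal) (hf : Measurable f) :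
    ∫⁻ w, f w ∂stepMeasure c = ∫⁻ ρ in Set.Ioo (0 : ℝ) 1,
      ENNReal.ofReal (2 * c * (ρ * (1 - ρ ^ 2) ^ (c - 1))) * (ENNReal.ofReal (2 * Real.pi)⁻¹ *
        ∫⁻ u in Set.Ioc (-Real.pi) Real.pi, f (ρ, u)) := by
  rw [stepMeasure, lintegral_prod _ hf.aemeasurable, radialMeasure,
    lintegral_withDensity_eq_lintegral_mul _ (by fun_prop) (hf.lintegral_prod_right' )]
  simp only [uniformPhase, lintegral_smul_measure, smul_eq_mul, Pi.mul_apply]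

theorem disk_phase_average {c : ℝ} (hc : 0 < c) {F : ℝ → ℝ → ENNReal}
    (hF : Measurable (Function.uncurry F)) (hper : ∀ s x, F (s + 2 * Real.pi) x = F s x)
    (θ Δ : ℝ) :
    ∫⁻ p in {p : ℂ | 0 < p.re}, ENNReal.ofReal (p.re ^ (c - 1)) *
      (ENNReal.ofReal (((1 + p.re) ^ 2 + p.im ^ 2) ^ (-(c + 1))) *
        ∫⁻ s in Set.Ioc (-Real.pi) Real.pi, F (s + diskArg ((1 - p) / (1 + p)) s)
          (θ + Δ + diskArg ((1 - p) / (1 + p)) (s + Δ) - diskArg ((1 - p) / (1 + p)) s)) =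
    ENNReal.ofReal (4 ^ (-c) * Real.pi / c) * ∫⁻ w, (∫⁻ s in Set.Ioc (-Real.pi) Real.pi,
      F s (θ + Δ + phaseJump Δ w)) ∂stepMeasure c := by
  have hF' : ∀ {α : Type} [MeasurableSpace α] {u v : α → ℝ}, Measurable u → Measurable v →
      Measurable fun a => F (u a) (v a) := fun hu hv => hF.comp (hu.prodMk hv)
  let H : ℂ → ENNReal := fun z => ∫⁻ s in Set.Ioc (-Real.pi) Real.pi, F (s + diskArg z s)
    (θ + Δ + diskArg z (s + Δ) - diskArg z s)
  have hH : Measurable H := Measurable.lintegral_prod_right'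
    (f := fun p : ℂ × ℝ => F (p.2 + diskArg p.1 p.2)
      (θ + Δ + diskArg p.1 (p.2 + Δ) - diskArg p.1 p.2)) (hF' (by fun_prop) (by fun_prop))
  rw [lintegral_halfPlane_eq_disk c H, lintegral_disk_polar c hH,
    lintegral_stepMeasure _ (Measurable.lintegral_prod_right' (ν := volume.restrict _)
      (f := fun p : (ℝ × ℝ) × ℝ => F p.2 (θ + Δ + phaseJump Δ p.1))
      (hF' (by fun_prop) (by fun_prop))),
    ← lintegral_const_mul' _ _ ENNReal.ofReal_ne_top,
    ← lintegral_const_mul' _ _ ENNReal.ofReal_ne_top]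
  refine setLIntegral_congr_fun measurableSet_Ioo fun ρ hρ => ?_
  have e1 : ∀ u : ℝ, H (ρ * Complex.exp (u * Complex.I)) =
      ∫⁻ s in Set.Ioc (-Real.pi) Real.pi, F (u + (s + diskArg ρ s)) (θ + Δ + phaseJump Δ (ρ, s)) :=
    fun u => by
      rw [← lintegral_periodic_shift (a := -u)]
      · simp only [H, diskArg_mul_exp, phaseJump]
        refine lintegral_congr fun s => ?_
        ring_nf
      · intro s
        have e : s + 2 * Real.pi + diskArg (↑ρ) (s + 2 * Real.pi) =
          s + diskArg (↑ρ) s + 2 * Real.pi := by rw [diskArg_add_two_pi]; ring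
        have e' : phaseJump Δ (ρ, s + 2 * Real.pi) = phaseJump Δ (ρ, s) := by
          simp only [phaseJump]
          rw [diskArg_add_two_pi, add_right_comm, diskArg_add_two_pi]
        rw [e, ← add_assoc, hper, e']
  have e2 : ∫⁻ u in Set.Ioc (-Real.pi) Real.pi, H (ρ * Complex.exp (u * Complex.I)) =
      ∫⁻ u in Set.Ioc (-Real.pi) Real.pi, ∫⁻ s in Set.Ioc (-Real.pi) Real.pi,
        F s (θ + Δ + phaseJump Δ (ρ, u)) := by
    simp only [e1]
    rw [lintegral_lintegral_swap (f := fun u s : ℝ =>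
      F (u + (s + diskArg ρ s)) (θ + Δ + phaseJump Δ (ρ, s))) (hF' (α := ℝ × ℝ) (by fun_prop) (by
          fun_prop)).aemeasurable]
    refine lintegral_congr fun s => ?_
    exact lintegral_periodic_shift (f := fun u => F u (θ + Δ + phaseJump Δ (ρ, s)))
      (fun u => hper _ _) _
  rw [e2, ← mul_assoc, ← mul_assoc, ← mul_assoc, ← ENNReal.ofReal_mul (by positivity),
    ← ENNReal.ofReal_mul (by positivity), ← ENNReal.ofReal_mul]
  · congr 2
    have := Real.pi_pos
    field_simp
  · have : 0 ≤ 1 - ρ ^ 2 := by nlinarith [hρ.1, hρ.2]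
    have := hρ.1
    have := Real.pi_pos
    positivity

theorem countLt_eq_intCast (ξ : ℝ) {n : ℕ} (y : Fin n → ℝ) :
    countLt ξ y = ((#{i | y i < ξ} : ℤ) : ℝ) := by
  simp [countLt]

theorem pairIntegral_succ_phase {β θ : ℝ} (hθ : θ ∈ Set.Ioc 0 Real.pi) (k : ℕ)
    {F : ℝ → ℝ → ENNReal} (hF : Measurable (Function.uncurry F)) :
    pairIntegral β (negCot θ) (k + 1) (fun y x => F (2 * Real.arctan y) x) =
      pairIntegral β (negCot θ) k (fun y x => ∫⁻ p in {p : ℂ | 0 < p.re},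
        ENNReal.ofReal (p.re ^ (((k + 1 : ℕ) : ℝ) * (β / 2) - 1)) *
        (ENNReal.ofReal (((1 + p.re) ^ 2 + p.im ^ 2) ^ (-(((k + 1 : ℕ) : ℝ) * (β / 2) + 1))) *
          F (2 * Real.arctan y - 2 * (1 + p).arg + diskArg ((1 - p) / (1 + p))
              (2 * Real.arctan y - 2 * (1 + p).arg))
            (θ + x + diskArg ((1 - p) / (1 + p)) (2 * Real.arctan y - 2 * (1 + p).arg + x) -
              diskArg ((1 - p) / (1 + p)) (2 * Real.arctan y - 2 * (1 + p).arg)))) := by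
  have hF' : ∀ {α : Type} [MeasurableSpace α] {u v : α → ℝ}, Measurable u → Measurable v →
      Measurable fun a => F (u a) (v a) := fun hu hv => hF.comp (hu.prodMk hv)
  have harg : Measurable fun p : ℂ => (1 + p).arg := Complex.measurable_arg.comp (by fun_prop)
  rw [pairIntegral_succ (F := fun y x => F (2 * Real.arctan y) x) hθ k (hF' (by fun_prop) (by
      fun_prop)), pairIntegral]
  refine lintegral_congr fun b => lintegral_congr fun x => ?_
  congr 1
  rw [lintegral_halfPlane_eq_prod (by
    refine Measurable.mul (by fun_prop) (Measurable.mul (by fun_prop)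
      (hF' (by fun_prop) (by fun_prop))))]
  refine setLIntegral_congr_fun measurableSet_Ioi fun r (hr : 0 < r) => ?_
  simp only
  rw [lintegral_const_mul' _ _ ENNReal.ofReal_ne_top]
  congr 1
  rw [← lintegral_neg_eq_self]
  refine lintegral_congr fun q => ?_
  have h0 := two_arctan_mobius (p := ⟨r, q⟩) hr (sumGap b x)
  have h1 := two_arctan_mobius (p := ⟨r, q⟩) hr (ratioAt (negCot θ) b x)
  simp only at h0 h1
  have hph : 2 * Real.arctan (ratioAt (negCot θ) b x) = 2 * Real.arctan (sumGap b x) +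
      phaseGap (negCot θ) b x - 2 * Real.pi * countLt (negCot θ) b := by
    rw [phaseGap]; ring
  set p : ℂ := ⟨r, q⟩
  have h2 : diskArg ((1 - p) / (1 + p)) (2 * Real.arctan (ratioAt (negCot θ) b x) -
      2 * (1 + p).arg) = diskArg ((1 - p) / (1 + p)) (2 * Real.arctan (sumGap b x) -
      2 * (1 + p).arg + phaseGap (negCot θ) b x) := by
    rw [hph, countLt_eq_intCast, ← diskArg_add_int _ _ (#{i | b i < negCot θ} : ℤ)]
    congr 1
    ring
  rw [h0, h1, h2, neg_sq, hph]
  congr 2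
  ring

theorem integral_zero_phase (G : ℝ → ENNReal) :
    ∫⁻ y : ℝ, ENNReal.ofReal ((1 + y ^ 2)⁻¹) * G (2 * Real.arctan y) =
      ENNReal.ofReal (1 / 2) * ∫⁻ s in Set.Ioc (-Real.pi) Real.pi, G s := by
  have himg : (fun y : ℝ => 2 * Real.arctan y) '' Set.univ = Set.Ioo (-Real.pi) Real.pi := by
    ext s
    simp only [Set.image_univ, Set.mem_range, Set.mem_Ioo]
    constructor
    · rintro ⟨y, rfl⟩
      constructor <;> linarith [Real.arctan_lt_pi_div_two y, Real.neg_pi_div_two_lt_arctan y]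
    · rintro ⟨h1, h2⟩
      exact ⟨Real.tan (s / 2), by rw [Real.arctan_tan (by linarith) (by linarith)]; ring⟩
  rw [← setLIntegral_congr Ioo_ae_eq_Ioc, ← himg,
    lintegral_image_eq_lintegral_abs_deriv_mul MeasurableSet.univ
    (f' := fun y => 2 * (1 / (1 + y ^ 2)))
    (fun y _ => ((Real.hasDerivAt_arctan y).const_mul 2).hasDerivWithinAt)
    (fun y _ z _ h => Real.arctan_injective (mul_left_cancel₀ two_ne_zero h)),
    ← lintegral_const_mul' _ _ ENNReal.ofReal_ne_top, Measure.restrict_univ]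
  refine lintegral_congr fun y => ?_
  rw [← mul_assoc, ← ENNReal.ofReal_mul (by norm_num)]
  congr 2
  rw [abs_of_pos (by positivity)]
  field_simp

theorem pairConst_nonneg {β : ℝ} (hβ : 0 < β) : ∀ k, 0 ≤ pairConst β k
  | 0 => by norm_num [pairConst]
  | k + 1 => by
    have := pairConst_nonneg hβ k
    have := Real.pi_pos
    rw [pairConst]; positivity

theorem pairIntegral_zero {β θ : ℝ} (hθ : θ ∈ Set.Ioc 0 Real.pi) (F : ℝ → ℝ → ENNReal) :
    pairIntegral β (negCot θ) 0 (fun y x => F (2 * Real.arctan y) x) =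
      ENNReal.ofReal (1 / 2) * ∫⁻ s in Set.Ioc (-Real.pi) Real.pi, F s θ := by
  have h1 : {y : Fin (0 + 1) → ℝ | StrictMono y} = Set.univ :=
    Set.eq_univ_of_forall fun y => by
    have : Subsingleton (Fin (0 + 1)) := inferInstanceAs (Subsingleton (Fin 1))
    exact Subsingleton.strictMono y
  have h2 : ∀ y : Fin (0 + 1) → ℝ, {x : Fin 0 → ℝ | Interlace y x} = Set.univ := fun y =>
    Set.eq_univ_of_forall fun x j => j.elim0
  have h3 : ∀ᵐ y : Fin (0 + 1) → ℝ, ∀ x : Fin 0 → ℝ, phaseGap (negCot θ) y x = θ := by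
    filter_upwards [ae_forall_ne (0 + 1) (negCot θ)] with y hy x
    have h : negCot θ + -y 0 ≠ 0 := by
      have := sub_ne_zero.2 (hy 0)
      rwa [← sub_eq_add_neg]
    have e1 : ratioAt (negCot θ) y x = (negCot θ * -y 0 - 1) / (negCot θ + -y 0) := by
      simp only [ratioAt, Fin.prod_univ_zero, Fin.prod_univ_succ, mul_one]
      rw [← sub_eq_add_neg] at h ⊢
      field_simp
      ring
    have e2 : sumGap y x = -y 0 := by simp [sumGap]
    have e3 : countLt (negCot θ) y = if 0 < negCot θ + -y 0 then 1 else 0 := by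
      simp only [countLt, Fin.sum_univ_succ, Fin.sum_univ_zero, add_zero, ← sub_eq_add_neg,
        sub_pos]
    have := two_arctan_cayley hθ h
    rw [phaseGap, e1, e2, e3]
    linarith
  rw [pairIntegral, h1, Measure.restrict_univ, ← integral_zero_phase,
      ← lintegral_neg_eq_self (μ := (volume : Measure ℝ)),
    ← (volume_preserving_funUnique (Fin 1) ℝ).lintegral_comp_emb
      (MeasurableEquiv.measurableEmbedding _)]
  refine lintegral_congr_ae ?_
  filter_upwards [h3] with y hy
  rw [h2, Measure.restrict_univ, volume_pi, Measure.pi_of_empty, lintegral_dirac, hy]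
  have e2 : ∀ x : Fin 0 → ℝ, sumGap y x = -y 0 := by simp [sumGap]
  have e4 : ∀ x : Fin 0 → ℝ, interlaceWeight β y x = (1 + y 0 ^ 2)⁻¹ := fun x => by
    have : (∏ p : Fin (0 + 1) × Fin (0 + 1) with p.1 < p.2, |y p.2 - y p.1|) = 1 := by
      refine Finset.prod_eq_one fun p hp => absurd (Finset.mem_filter.1 hp).2 ?_
      lia
    simp [interlaceWeight, absVand, Real.rpow_neg_one, this]
  rw [e2, e4]
  simp

theorem pairIntegral_eq {β θ : ℝ} (hβ : 0 < β) (hθ : θ ∈ Set.Ioc 0 Real.pi) (k : ℕ)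
    {F : ℝ → ℝ → ENNReal} (hF : Measurable (Function.uncurry F))
    (hper : ∀ s x, F (s + 2 * Real.pi) x = F s x) :
    pairIntegral β (negCot θ) k (fun y x => F (2 * Real.arctan y) x) =
      ENNReal.ofReal (pairConst β k) *
        ∫⁻ x, (∫⁻ s in Set.Ioc (-Real.pi) Real.pi, F s x) ∂phaseLaw β θ k := by
  induction k generalizing F with
  | zero =>
    rw [pairIntegral_zero hθ, phaseLaw, lintegral_dirac', pairConst]
    exact Measurable.lintegral_prod_right' (f := fun p : ℝ × ℝ => F p.2 p.1)
      (hF.comp measurable_swap)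
  | succ k ih =>
    have hF' : ∀ {α : Type} [MeasurableSpace α] {u v : α → ℝ}, Measurable u → Measurable v →
        Measurable fun a => F (u a) (v a) := fun hu hv => hF.comp (hu.prodMk hv)
    have harg : Measurable fun p : ℂ => 2 * (1 + p).arg :=
      (Complex.measurable_arg.comp (by fun_prop)).const_mul 2
    obtain ⟨c, hc⟩ : ∃ c : ℝ, ((k + 1 : ℕ) : ℝ) * (β / 2) = c := ⟨_, rfl⟩
    have hc0 : 0 < c := by rw [← hc]; positivity
    obtain ⟨G, hGdef⟩ : ∃ G : ℂ → ℝ → ℝ → ENNReal, ∀ p s x, G p s x =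
      F (s - 2 * (1 + p).arg + diskArg ((1 - p) / (1 + p)) (s - 2 * (1 + p).arg))
        (θ + x + diskArg ((1 - p) / (1 + p)) (s - 2 * (1 + p).arg + x) -
          diskArg ((1 - p) / (1 + p)) (s - 2 * (1 + p).arg)) := ⟨_, fun _ _ _ => rfl⟩
    have hG : Measurable fun q : ℂ × ℝ × ℝ => G q.1 q.2.1 q.2.2 := by
      simp only [hGdef]
      have : Measurable fun q : ℂ × ℝ × ℝ => 2 * (1 + q.1).arg := harg.comp measurable_fst
      exact hF' (by fun_prop) (by fun_prop)
    have hGper : ∀ p s x, G p (s + 2 * Real.pi) x = G p s x := fun p s x => by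
      rw [hGdef, hGdef, add_sub_right_comm, diskArg_add_two_pi, add_right_comm _ (2 * Real.pi) x,
        diskArg_add_two_pi, add_right_comm, hper]
    have hWG : Measurable fun q : ℂ × ℝ × ℝ => ENNReal.ofReal (q.1.re ^ (c - 1)) *
        (ENNReal.ofReal (((1 + q.1.re) ^ 2 + q.1.im ^ 2) ^ (-(c + 1))) * G q.1 q.2.1 q.2.2) :=
      Measurable.mul (by fun_prop) (Measurable.mul (by fun_prop) hG)
    have key : ∀ x, ∫⁻ s in Set.Ioc (-Real.pi) Real.pi, ∫⁻ p in {p : ℂ | 0 < p.re},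
        ENNReal.ofReal (p.re ^ (c - 1)) *
          (ENNReal.ofReal (((1 + p.re) ^ 2 + p.im ^ 2) ^ (-(c + 1))) * G p s x) =
        ENNReal.ofReal (4 ^ (-c) * Real.pi / c) *
          ∫⁻ w, (∫⁻ s in Set.Ioc (-Real.pi) Real.pi, F s (θ + x + phaseJump x w))
            ∂stepMeasure c := fun x => by
      have hm : Measurable fun q : ℝ × ℂ => ENNReal.ofReal (q.2.re ^ (c - 1)) *
          (ENNReal.ofReal (((1 + q.2.re) ^ 2 + q.2.im ^ 2) ^ (-(c + 1))) * G q.2 q.1 x) :=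
        hWG.comp (g := fun q : ℂ × ℝ × ℝ => ENNReal.ofReal (q.1.re ^ (c - 1)) *
          (ENNReal.ofReal (((1 + q.1.re) ^ 2 + q.1.im ^ 2) ^ (-(c + 1))) * G q.1 q.2.1 q.2.2))
          (f := fun q : ℝ × ℂ => (q.2, q.1, x)) (by fun_prop)
      rw [← disk_phase_average hc0 hF hper, lintegral_lintegral_swap (f := fun (s : ℝ) (p : ℂ) =>
        ENNReal.ofReal (p.re ^ (c - 1)) *
          (ENNReal.ofReal (((1 + p.re) ^ 2 + p.im ^ 2) ^ (-(c + 1))) * G p s x)) hm.aemeasurable]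
      refine lintegral_congr fun p => ?_
      rw [lintegral_const_mul' _ _ ENNReal.ofReal_ne_top,
        lintegral_const_mul' _ _ ENNReal.ofReal_ne_top]
      congr 2
      rw [← lintegral_periodic_shift (fun s => hGper p s x) (2 * (1 + p).arg)]
      simp only [hGdef, add_sub_cancel_right]
    have hm : Measurable fun x => ∫⁻ s in Set.Ioc (-Real.pi) Real.pi, F s x :=
      Measurable.lintegral_prod_right' (f := fun p : ℝ × ℝ => F p.2 p.1) (hF.comp measurable_swap)
    obtain ⟨F1, hF1⟩ : ∃ F1 : ℝ → ℝ → ENNReal, ∀ s x, F1 s x =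
        ∫⁻ p in {p : ℂ | 0 < p.re}, ENNReal.ofReal (p.re ^ (c - 1)) *
        (ENNReal.ofReal (((1 + p.re) ^ 2 + p.im ^ 2) ^ (-(c + 1))) * G p s x) :=
      ⟨_, fun _ _ => rfl⟩
    have hF1m : Measurable (Function.uncurry F1) := by
      have : Function.uncurry F1 = fun a : ℝ × ℝ => ∫⁻ p in {p : ℂ | 0 < p.re},
        ENNReal.ofReal (p.re ^ (c - 1)) *
        (ENNReal.ofReal (((1 + p.re) ^ 2 + p.im ^ 2) ^ (-(c + 1))) * G p a.1 a.2) := by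
        ext a; rw [Function.uncurry, hF1]
      rw [this]
      exact hWG.lintegral_prod_left'
    have h1 := pairIntegral_succ_phase (β := β) hθ k hF
    simp only [hc, ← hGdef, ← hF1] at h1
    rw [h1, ih hF1m fun s x => by simp only [hF1, hGper]]
    simp only [hF1, key]
    rw [lintegral_const_mul' _ _ ENNReal.ofReal_ne_top, ← mul_assoc,
      ← ENNReal.ofReal_mul (pairConst_nonneg hβ k), pairConst, hc]
    congr 1
    rw [phaseLaw, lintegral_map hm (by fun_prop), hc, lintegral_prod _ (by
      exact (hm.comp (by fun_prop)).aemeasurable)]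

theorem lintegral_pi_prod {n : ℕ} (μ : Fin n → Measure ℝ) [∀ i, SigmaFinite (μ i)]
    {f : ℝ → ENNReal} (hf : Measurable f) :
    ∫⁻ x, ∏ i, f (x i) ∂Measure.pi μ = ∏ i, ∫⁻ t, f t ∂μ i := by
  induction n with
  | zero => simp
  | succ n ih =>
    rw [← ((measurePreserving_piFinSuccAbove μ 0).symm).lintegral_comp (by fun_prop)]
    simp only [Fin.prod_univ_succ, MeasurableEquiv.piFinSuccAbove_symm_apply,
      Fin.insertNthEquiv_zero, Fin.cons_zero, Fin.cons_succ,
      Fin.zero_succAbove, Fin.consEquiv, Equiv.coe_fn_mk]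
    rw [lintegral_prod_mul (g := fun y : Fin n → ℝ => ∏ i, f (y i)) hf.aemeasurable
      (Finset.measurable_fun_prod _ fun i _ => hf.comp (measurable_pi_apply i)).aemeasurable]
    congr 1
    exact ih _

theorem pi_withDensity {n : ℕ} (μ : Fin n → Measure ℝ) [∀ i, SigmaFinite (μ i)]
    {f : ℝ → ENNReal} (hf : Measurable f) [∀ i, SigmaFinite ((μ i).withDensity f)] :
    Measure.pi (fun i => (μ i).withDensity f) =
      (Measure.pi μ).withDensity fun x => ∏ i, f (x i) := by
  refine (Measure.pi_eq fun s hs => ?_)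
  rw [withDensity_apply _ (.univ_pi hs), Measure.restrict_pi_pi, lintegral_pi_prod _ hf]
  exact Finset.prod_congr rfl fun i _ => (withDensity_apply _ (hs i)).symm

theorem lintegral_Ioi_rpow_mul_exp {s : ℝ} (hs : 0 < s) :
    ∫⁻ r in Set.Ioi (0 : ℝ), ENNReal.ofReal (r ^ (s - 1)) * ENNReal.ofReal (Real.exp (-r)) =
      ENNReal.ofReal (Real.Gamma s) := by
  rw [Real.Gamma_eq_integral hs, ofReal_integral_eq_lintegral_ofReal
    (Real.GammaIntegral_convergent hs)]
  · refine setLIntegral_congr_fun measurableSet_Ioi fun r hr => ?_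
    rw [ENNReal.ofReal_mul (Real.exp_nonneg _), mul_comm]
  · filter_upwards [ae_restrict_mem measurableSet_Ioi] with r hr
    have : 0 < r := hr
    positivity

theorem lintegral_interlaceWeight {β : ℝ} (hβ : 0 < β) {k : ℕ} {b : Fin (k + 1) → ℝ}
    (hb : StrictMono b) :
    (∫⁻ x in {x | Interlace b x}, ENNReal.ofReal (interlaceWeight β b x)) *
        ENNReal.ofReal (Real.Gamma (((k + 1 : ℕ) : ℝ) * (β / 2))) =
      ENNReal.ofReal (cauchyWeight β b) * ENNReal.ofReal (Real.Gamma (β / 2)) ^ (k + 1) := by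
  have h := lintegral_weights_polar hb β
    (F := fun g => ENNReal.ofReal (Real.exp (-∑ i, g i))) (by fun_prop)
  have hexp : ∀ r : ℝ, ∀ x : Fin k → ℝ, Real.exp (-∑ i, (r • spectralWeight b x) i) =
      Real.exp (-r) := fun r x => by
    simp only [Pi.smul_apply, smul_eq_mul]
    rw [← Finset.mul_sum, sum_spectralWeight hb.injective, mul_one]
  simp only [hexp, lintegral_Ioi_rpow_mul_exp (show 0 < ((k + 1 : ℕ) : ℝ) * (β / 2) by positivity)]
    at h
  rw [lintegral_mul_const' _ _ ENNReal.ofReal_ne_top] at h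
  rw [← h]
  congr 1
  have hs : {g : Fin (k + 1) → ℝ | ∀ i, 0 < g i} = Set.univ.pi fun _ => Set.Ioi 0 := by
    ext; simp
  rw [← lintegral_Ioi_rpow_mul_exp (half_pos hβ), hs, volume_pi, Measure.restrict_pi_pi]
  have := lintegral_pi_prod (fun _ : Fin (k + 1) => volume.restrict (Set.Ioi (0 : ℝ)))
    (f := fun r => ENNReal.ofReal (r ^ (β / 2 - 1)) * ENNReal.ofReal (Real.exp (-r)))
    (by fun_prop)
  rw [Finset.prod_const, Finset.card_univ, Fintype.card_fin] at this
  rw [← this, ← Measure.restrict_pi_pi]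
  refine setLIntegral_congr_fun (.univ_pi fun _ => measurableSet_Ioi) fun g hg => ?_
  have hg' : ∀ i, 0 < g i := fun i => hg i trivial
  rw [Finset.prod_mul_distrib, ← ENNReal.ofReal_prod_of_nonneg fun i _ => (by
    have := hg' i; positivity), ← ENNReal.ofReal_prod_of_nonneg fun i _ => (by positivity),
    Real.finsetProd_rpow _ _ fun i _ => (hg' i).le, ← Real.exp_sum, Finset.sum_neg_distrib]

/-- The integer part of the rotated phase, as a periodic function of the first phase. -/
def windingNumber (s x : ℝ) : ℝ :=
  (⌊(s + x + Real.pi) / (2 * Real.pi)⌋ : ℝ) - (⌊(s + Real.pi) / (2 * Real.pi)⌋ : ℝ)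

@[fun_prop]
theorem measurable_windingNumber {α : Type*} [MeasurableSpace α] {s x : α → ℝ}
    (hs : Measurable s) (hx : Measurable x) : Measurable fun a => windingNumber (s a) (x a) := by
  unfold windingNumber
  have h : Measurable fun n : ℤ => (n : ℝ) := measurable_from_top
  exact (h.comp (Int.measurable_floor.comp (by fun_prop))).sub
    (h.comp (Int.measurable_floor.comp (by fun_prop)))

theorem windingNumber_add_two_pi (s x : ℝ) :
    windingNumber (s + 2 * Real.pi) x = windingNumber s x := by
  have h := Real.two_pi_pos.ne'
  have e1 : (s + 2 * Real.pi + x + Real.pi) / (2 * Real.pi) =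
    (s + x + Real.pi) / (2 * Real.pi) + 1 := by field_simp; ring
  have e2 : (s + 2 * Real.pi + Real.pi) / (2 * Real.pi) =
    (s + Real.pi) / (2 * Real.pi) + 1 := by field_simp; ring
  rw [windingNumber, e1, e2, Int.floor_add_one, Int.floor_add_one, windingNumber]
  push_cast
  ring

theorem floor_arctan_add (y : ℝ) (m : ℤ) :
    ⌊(2 * Real.arctan y + 2 * Real.pi * m + Real.pi) / (2 * Real.pi)⌋ = m := by
  have h := Real.pi_pos
  rw [Int.floor_eq_iff, le_div_iff₀ (by positivity), div_lt_iff₀ (by positivity)]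
  constructor <;> nlinarith [Real.arctan_lt_pi_div_two y, Real.neg_pi_div_two_lt_arctan y]

theorem countLt_eq_windingNumber (ξ : ℝ) {k : ℕ} (y : Fin (k + 1) → ℝ) (x : Fin k → ℝ) :
    countLt ξ y = windingNumber (2 * Real.arctan (sumGap y x)) (phaseGap ξ y x) := by
  have e : 2 * Real.arctan (sumGap y x) + phaseGap ξ y x + Real.pi =
      2 * Real.arctan (ratioAt ξ y x) + 2 * Real.pi * (#{i | y i < ξ} : ℤ) + Real.pi := by
    rw [phaseGap, countLt_eq_intCast]; ring
  have e2 := floor_arctan_add (sumGap y x) 0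
  rw [Int.cast_zero, mul_zero, add_zero] at e2
  rw [windingNumber, e, floor_arctan_add, e2, countLt_eq_intCast, Int.cast_zero, sub_zero]

/-- The counting function of the ordered ensemble is an integer part of the accumulated phase. -/
theorem lintegral_countLt {β θ : ℝ} (hβ : 0 < β) (hθ : θ ∈ Set.Ioc 0 Real.pi) (k : ℕ)
    {f : ℝ → ENNReal} (hf : Measurable f) :
    (∫⁻ y in {y : Fin (k + 1) → ℝ | StrictMono y}, ENNReal.ofReal (cauchyWeight β y) *
        f (countLt (negCot θ) y)) * ENNReal.ofReal (Real.Gamma (β / 2)) ^ (k + 1) =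
      ENNReal.ofReal (Real.Gamma (((k + 1 : ℕ) : ℝ) * (β / 2))) *
        (ENNReal.ofReal (pairConst β k) *
          ∫⁻ x, (∫⁻ s in Set.Ioc (-Real.pi) Real.pi, f (windingNumber s x)) ∂phaseLaw β θ k) := by
  have hm : Measurable (Function.uncurry fun s x => f (windingNumber s x)) :=
    hf.comp (by fun_prop)
  rw [← pairIntegral_eq hβ hθ k hm fun s x => by rw [windingNumber_add_two_pi],
    ← lintegral_mul_const' _ _ (by finiteness), pairIntegral,
    ← lintegral_const_mul' _ _ ENNReal.ofReal_ne_top]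
  refine setLIntegral_congr_fun (measurableSet_strictMono _) fun y hy => ?_
  simp only [← countLt_eq_windingNumber]
  rw [lintegral_mul_const'' _ (by fun_prop), mul_right_comm, ← lintegral_interlaceWeight hβ hy]
  ring

theorem absVand_comp_perm {n : ℕ} (v : Fin n → ℝ) (σ : Equiv.Perm (Fin n)) :
    absVand (v ∘ σ) = absVand v := by
  rw [absVand_eq_abs_det, absVand_eq_abs_det]
  have : Matrix.vandermonde (v ∘ σ) = (Matrix.vandermonde v).submatrix σ id := by
    ext i j; simp [Matrix.vandermonde_apply]
  rw [this, Matrix.det_permute, abs_mul]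
  rcases Int.units_eq_one_or (Equiv.Perm.sign σ) with h | h <;> simp [h]

theorem cauchyWeight_comp_perm {β : ℝ} {n : ℕ} (v : Fin n → ℝ) (σ : Equiv.Perm (Fin n)) :
    cauchyWeight β (v ∘ σ) = cauchyWeight β v := by
  have : ∏ j, (1 + (v ∘ σ) j ^ 2) = ∏ j, (1 + v j ^ 2) :=
    Equiv.prod_comp σ fun j => 1 + v j ^ 2
  rw [cauchyWeight, cauchyWeight, absVand_comp_perm, this]

theorem countLt_comp_perm {n : ℕ} (ξ : ℝ) (v : Fin n → ℝ) (σ : Equiv.Perm (Fin n)) :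
    countLt ξ (v ∘ σ) = countLt ξ v :=
  Equiv.sum_comp σ fun j => if v j < ξ then (1 : ℝ) else 0

theorem absVand_eq_zero {n : ℕ} {v : Fin n → ℝ} (hv : ¬ Function.Injective v) : absVand v = 0 := by
  rw [absVand_eq_abs_det, abs_eq_zero]
  by_contra h
  exact hv (Matrix.det_vandermonde_ne_zero_iff.1 h)

theorem sum_indicator_strictMono {n : ℕ} {H : (Fin n → ℝ) → ENNReal}
    (h0 : ∀ y, ¬ Function.Injective y → H y = 0) (y : Fin n → ℝ) :
    ∑ σ : Equiv.Perm (Fin n), {y : Fin n → ℝ | StrictMono (y ∘ σ)}.indicator H y = H y := by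
  by_cases hy : Function.Injective y
  · have hs : StrictMono (y ∘ Tuple.sort y) :=
      (Tuple.monotone_sort y).strictMono_of_injective (hy.comp (Equiv.injective _))
    rw [Finset.sum_eq_single (Tuple.sort y), Set.indicator_of_mem]
    · exact hs
    · intro τ _ hτ
      refine Set.indicator_of_notMem (fun h : StrictMono (y ∘ τ) => hτ ?_) _
      have := Tuple.unique_monotone h.monotone hs.monotone
      exact Equiv.ext fun i => hy (congrFun this i)
    · simp
  · rw [h0 y hy]
    exact Finset.sum_eq_zero fun σ _ => by simp [Set.indicator_apply, h0 y hy]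

theorem lintegral_eq_factorial_mul {n : ℕ} {H : (Fin n → ℝ) → ENNReal} (hH : Measurable H)
    (hsymm : ∀ y (σ : Equiv.Perm (Fin n)), H (y ∘ σ) = H y)
    (h0 : ∀ y, ¬ Function.Injective y → H y = 0) :
    ∫⁻ y, H y = n.factorial * ∫⁻ y in {y | StrictMono y}, H y := by
  have hσ : ∀ σ : Equiv.Perm (Fin n), MeasurePreserving (fun y : Fin n → ℝ => y ∘ σ) := fun σ =>
    volume_preserving_arrowCongr' σ.symm (MeasurableEquiv.refl ℝ) (MeasurePreserving.id _)
  have hm := measurableSet_strictMono n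
  have hmσ : ∀ σ : Equiv.Perm (Fin n), MeasurableSet {y : Fin n → ℝ | StrictMono (y ∘ σ)} :=
    fun σ => (hσ σ).measurable hm
  calc ∫⁻ y, H y = ∫⁻ y, ∑ σ : Equiv.Perm (Fin n),
        {y : Fin n → ℝ | StrictMono (y ∘ σ)}.indicator H y := by
        simp only [sum_indicator_strictMono h0]
    _ = ∑ σ : Equiv.Perm (Fin n), ∫⁻ y in {y | StrictMono y}, H y := by
        rw [lintegral_finsetSum _ fun σ _ => hH.indicator (hmσ σ)]
        refine Finset.sum_congr rfl fun σ _ => ?_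
        rw [← lintegral_indicator hm, ← (hσ σ).lintegral_comp (hH.indicator hm)]
        refine lintegral_congr fun y => ?_
        simp only [Set.indicator_apply, Set.mem_ofPred_eq, hsymm]
    _ = _ := by
        rw [Finset.sum_const, Finset.card_univ, Fintype.card_perm, Fintype.card_fin, nsmul_eq_mul]

theorem measurePreserving_pi_add_two_arctan :
    MeasurePreserving (fun x => Real.pi + 2 * Real.arctan x)
      (volume.withDensity fun x => ENNReal.ofReal (2 / (1 + x ^ 2)))
      (volume.restrict (Set.Ico 0 (2 * Real.pi))) := by
  refine ⟨by fun_prop, Measure.ext_of_lintegral _ fun f hf => ?_⟩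
  rw [lintegral_map hf (by fun_prop), lintegral_withDensity_eq_lintegral_mul _ (by fun_prop)
    (show Measurable fun x : ℝ => f (Real.pi + 2 * Real.arctan x) from hf.comp (by fun_prop))]
  have h1 := integral_zero_phase fun s => f (s + Real.pi)
  have h2 : ∫⁻ s in Set.Ioc (-Real.pi) Real.pi, f (s + Real.pi) =
      ∫⁻ s in Set.Ico 0 (2 * Real.pi), f s := by
    have := (measurePreserving_add_right volume Real.pi).setLIntegral_comp_preimage_emb
      (measurableEmbedding_addRight Real.pi) f (Set.Ioc 0 (2 * Real.pi))
    rw [Set.preimage_add_const_Ioc, zero_sub, two_mul, add_sub_cancel_right, ← two_mul] at this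
    rw [this]
    exact setLIntegral_congr Ico_ae_eq_Ioc.symm
  rw [h2] at h1
  have h3 : ∀ x : ℝ, ENNReal.ofReal (2 / (1 + x ^ 2)) =
      ENNReal.ofReal 2 * ENNReal.ofReal ((1 + x ^ 2)⁻¹) := fun x => by
    rw [← ENNReal.ofReal_mul (by norm_num), div_eq_mul_inv]
  simp only [Pi.mul_apply, h3, mul_assoc]
  rw [lintegral_const_mul' _ _ ENNReal.ofReal_ne_top]
  simp only [add_comm Real.pi]
  rw [h1, ← mul_assoc, ← ENNReal.ofReal_mul (by norm_num)]
  norm_num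

theorem norm_exp_sub_exp (x y : ℝ) :
    ‖Complex.exp (Complex.I * ((Real.pi + 2 * Real.arctan x : ℝ) : ℂ)) -
        Complex.exp (Complex.I * ((Real.pi + 2 * Real.arctan y : ℝ) : ℂ))‖ =
      |y - x| * (Real.sqrt (2 / (1 + x ^ 2)) * Real.sqrt (2 / (1 + y ^ 2))) := by
  have hne : ∀ x : ℝ, (1 + x * Complex.I : ℂ) ≠ 0 := fun x h => by
    have := congrArg Complex.re h
    simp at this
  have hne' : ∀ x : ℝ, (1 - x * Complex.I : ℂ) ≠ 0 := fun x h => by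
    have := congrArg Complex.re h
    simp at this
  have key : ∀ x : ℝ, Complex.exp (Complex.I * ((Real.pi + 2 * Real.arctan x : ℝ) : ℂ)) =
      -((1 + x * Complex.I) / (1 - x * Complex.I)) := fun x => by
    have := exp_two_arg (1 + x * Complex.I) (hne x)
    rw [arg_one_add_mul_I] at this
    simp only [map_add, map_one, map_mul, Complex.conj_ofReal, Complex.conj_I, mul_neg,
      ← sub_eq_add_neg] at this
    rw [← this, Complex.ofReal_add, mul_add, Complex.exp_add, mul_comm Complex.I (Real.pi : ℂ),
      Complex.exp_pi_mul_I, mul_comm Complex.I, neg_one_mul]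
  have hn : ∀ x : ℝ, ‖(1 - x * Complex.I : ℂ)‖ = Real.sqrt (1 + x ^ 2) := fun x => by
    rw [Complex.norm_def]
    congr 1
    simp [Complex.normSq_apply, pow_two]
  have : -((1 + x * Complex.I) / (1 - x * Complex.I)) - -((1 + y * Complex.I) / (1 - y * Complex.I))
      = 2 * Complex.I * ((y - x : ℝ) : ℂ) / ((1 - x * Complex.I) * (1 - y * Complex.I)) := by
    have h1 := hne' x
    have h2 := hne' y
    rw [neg_sub_neg, div_sub_div _ _ h2 h1]
    congr 1
    · push_cast
      ring
    · ring
  rw [key, key, this, norm_div, norm_mul, norm_mul, norm_mul, hn, hn, Complex.norm_real,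
    Complex.norm_I, Real.sqrt_div zero_le_two, Real.sqrt_div zero_le_two, div_mul_div_comm,
    Real.mul_self_sqrt zero_le_two]
  simp
  ring

theorem prod_lt_mul {n : ℕ} (a : Fin n → ℝ) :
    ∏ p : Fin n × Fin n with p.1 < p.2, (a p.1 * a p.2) = (∏ i, a i) ^ (n - 1) := by
  have h1 : ∀ f : Fin n → Fin n → ℝ, ∏ p : Fin n × Fin n with p.1 < p.2, f p.1 p.2 =
      ∏ i, ∏ j ∈ Ioi i, f i j := fun f => by
    rw [Finset.prod_filter, ← Finset.univ_product_univ, Finset.prod_product]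
    refine Finset.prod_congr rfl fun i _ => ?_
    rw [← Finset.prod_filter]
    exact Finset.prod_congr (by ext; simp) fun _ _ => rfl
  rw [Finset.prod_mul_distrib, h1 (fun i _ => a i), h1 (fun _ j => a j),
    Finset.prod_comm' (f := fun _ j => a j) (t' := univ) (s' := fun j => Iio j) (by simp),
        ← Finset.prod_mul_distrib,
    ← Finset.prod_pow]
  refine Finset.prod_congr rfl fun i _ => ?_
  rw [Finset.prod_const, Finset.prod_const, ← pow_add, Fin.card_Ioi, Fin.card_Iio]
  congr 1
  lia

theorem jacobian_mul_density {β : ℝ} (hβ : 0 < β) {n : ℕ} (hn : 1 ≤ n) (x : Fin n → ℝ) :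
    (∏ i, 2 / (1 + x i ^ 2)) * ∏ p : Fin n × Fin n with p.1 < p.2,
      ‖Complex.exp (Complex.I * ((Real.pi + 2 * Real.arctan (x p.1) : ℝ) : ℂ)) -
        Complex.exp (Complex.I * ((Real.pi + 2 * Real.arctan (x p.2) : ℝ) : ℂ))‖ ^ β =
      (2 ^ n) ^ (β * ((n : ℝ) - 1) / 2 + 1) * cauchyWeight β x := by
  have hP : 0 < ∏ i, 2 / (1 + x i ^ 2) := Finset.prod_pos fun i _ => by positivity
  have hsq : ∏ i, Real.sqrt (2 / (1 + x i ^ 2)) = (∏ i, 2 / (1 + x i ^ 2)) ^ (1 / 2 : ℝ) := by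
    rw [← Real.finsetProd_rpow _ _ fun i _ => by positivity]
    exact Finset.prod_congr rfl fun i _ => Real.sqrt_eq_rpow _
  have hq : ∏ i, 2 / (1 + x i ^ 2) = 2 ^ n / ∏ i, (1 + x i ^ 2) := by
    rw [Finset.prod_div_distrib, Finset.prod_const, Finset.card_univ, Fintype.card_fin]
  have hQ : 0 < ∏ i, (1 + x i ^ 2) := Finset.prod_pos fun i _ => by positivity
  simp only [norm_exp_sub_exp]
  rw [Real.finsetProd_rpow _ _ fun p _ => by positivity, Finset.prod_mul_distrib,
    prod_lt_mul fun i => Real.sqrt (2 / (1 + x i ^ 2)), hsq, Real.mul_rpow (Finset.prod_nonneg fun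
        p _ => abs_nonneg _) (by positivity), cauchyWeight,
    absVand]
  set A := (∏ p : Fin n × Fin n with p.1 < p.2, |x p.2 - x p.1|) ^ β
  have : (∏ i, 2 / (1 + x i ^ 2)) * (((∏ i, 2 / (1 + x i ^ 2)) ^ (1 / 2 : ℝ)) ^ (n - 1)) ^ β =
      (2 ^ n) ^ (β * ((n : ℝ) - 1) / 2 + 1) *
        (∏ i, (1 + x i ^ 2)) ^ (-(β * ((n : ℝ) - 1) / 2 + 1)) := by
    rw [← Real.rpow_natCast _ (n - 1), ← Real.rpow_mul hP.le, ← Real.rpow_mul hP.le,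
      ← Real.rpow_one_add' hP.le, Nat.cast_sub hn, Nat.cast_one,
      show 1 + 1 / 2 * ((n : ℝ) - 1) * β = β * ((n : ℝ) - 1) / 2 + 1 by ring, hq,
      Real.div_rpow (by positivity) hQ.le, Real.rpow_neg hQ.le, div_eq_mul_inv]
    have : (1 : ℝ) ≤ n := by exact_mod_cast hn
    nlinarith
  rw [mul_left_comm, this]
  ring

theorem countIn_pi_add_two_arctan {θ : ℝ} (hθ : θ ∈ Set.Ioc 0 Real.pi) {n : ℕ} (x : Fin n → ℝ) :
    (countIn 0 θ (fun i => Real.pi + 2 * Real.arctan (x i)) : ℝ) = countLt (negCot θ) x := by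
  have hc : Real.arctan (negCot θ) = (θ - Real.pi) / 2 := by
    have := Real.pi_pos
    rw [← Real.arctan_tan (x := (θ - Real.pi) / 2) (by linarith [hθ.1]) (by linarith [hθ.2]),
      show (θ - Real.pi) / 2 = θ / 2 - Real.pi / 2 by ring, Real.tan_eq_sin_div_cos,
      Real.sin_sub_pi_div_two, Real.cos_sub_pi_div_two, negCot, neg_div]
  have h : ∀ t : ℝ, (0 ≤ Real.pi + 2 * Real.arctan t ∧ Real.pi + 2 * Real.arctan t < θ) ↔
      t < negCot θ := fun t => by
    rw [← Real.arctan_strictMono.lt_iff_lt (a := t) (b := negCot θ), hc]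
    have := Real.neg_pi_div_two_lt_arctan t
    constructor
    · rintro ⟨_, h⟩; linarith
    · intro h; constructor <;> linarith
  simp only [countIn, countLt, h, Finset.sum_boole]

theorem pairConst_eq {β : ℝ} (hβ : 0 < β) (k : ℕ) :
    pairConst β k = 1 / 2 * Real.pi ^ k * 2 ^ (-(β * k * (k + 1) / 2)) /
      (k.factorial * (β / 2) ^ k) := by
  induction k with
  | zero => simp [pairConst]
  | succ k ih =>
    have h4 : (4 : ℝ) ^ (-(((k + 1 : ℕ) : ℝ) * (β / 2))) = 2 ^ (-(((k + 1 : ℕ) : ℝ) * β)) := by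
      rw [show (4 : ℝ) = 2 ^ (2 : ℝ) by norm_num, ← Real.rpow_mul zero_le_two]
      congr 1; ring
    have h2 : (2 : ℝ) ^ (-(β * (k + 1 : ℕ) * ((k + 1 : ℕ) + 1) / 2)) =
        2 ^ (-(β * k * (k + 1) / 2)) * 2 ^ (-(((k + 1 : ℕ) : ℝ) * β)) := by
      rw [← Real.rpow_add zero_lt_two]
      congr 1; push_cast; ring
    rw [pairConst, ih, h4, h2, Nat.factorial_succ]
    have : (k.factorial : ℝ) ≠ 0 := by positivity
    push_cast
    field_simp
    ring

theorem cbeConst_identity {β : ℝ} (hβ : 0 < β) (k : ℕ) :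
    (2 ^ (k + 1)) ^ (β * (((k + 1 : ℕ) : ℝ) - 1) / 2 + 1) / cbeConst β (k + 1) *
        ((k + 1).factorial * (Real.Gamma (((k + 1 : ℕ) : ℝ) * (β / 2)) * pairConst β k)) =
      (2 * Real.pi)⁻¹ * Real.Gamma (β / 2) ^ (k + 1) := by
  have e1 : ((2 : ℝ) ^ (k + 1)) ^ (β * (((k + 1 : ℕ) : ℝ) - 1) / 2 + 1) =
      2 ^ (k + 1) * (2 ^ (-(β * k * (k + 1) / 2)))⁻¹ := by
    rw [← Real.rpow_neg zero_le_two, neg_neg, ← Real.rpow_natCast 2 (k + 1),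
      ← Real.rpow_mul zero_le_two, ← Real.rpow_add zero_lt_two]
    congr 1; push_cast; ring
  have e2 : Real.Gamma (1 + β * ((k + 1 : ℕ) : ℝ) / 2) = ((k + 1 : ℕ) : ℝ) * (β / 2) *
      Real.Gamma (((k + 1 : ℕ) : ℝ) * (β / 2)) := by
    rw [← Real.Gamma_add_one (by positivity)]
    congr 1; ring
  have e3 : Real.Gamma (1 + β / 2) = β / 2 * Real.Gamma (β / 2) := by
    rw [← Real.Gamma_add_one (by positivity), add_comm]
  have h1 : (Real.Gamma (((k + 1 : ℕ) : ℝ) * (β / 2))) ≠ 0 :=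
    (Real.Gamma_pos_of_pos (by positivity)).ne'
  have h2 : Real.Gamma (β / 2) ≠ 0 := (Real.Gamma_pos_of_pos (by positivity)).ne'
  have h3 : (2 : ℝ) ^ (-(β * k * (k + 1) / 2)) ≠ 0 := (Real.rpow_pos_of_pos zero_lt_two _).ne'
  have h4 : (k.factorial : ℝ) ≠ 0 := by positivity
  have := Real.pi_pos.ne'
  rw [e1, cbeConst, e2, e3, pairConst_eq hβ, Nat.factorial_succ]
  generalize (2 : ℝ) ^ (-(β * k * (k + 1) / 2)) = A at *
  generalize Real.Gamma (β / 2) = B at *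
  generalize Real.Gamma (((k + 1 : ℕ) : ℝ) * (β / 2)) = D at *
  push_cast
  field_simp
  ring

theorem cbeConst_pos {β : ℝ} (hβ : 0 < β) (n : ℕ) : 0 < cbeConst β n := by
  have h1 : 0 < Real.Gamma (1 + β * n / 2) := Real.Gamma_pos_of_pos (by positivity)
  have h2 : 0 < Real.Gamma (1 + β / 2) := Real.Gamma_pos_of_pos (by positivity)
  have := Real.pi_pos
  rw [cbeConst]; positivity

theorem lintegral_cbe {β : ℝ} (hβ : 0 < β) {n : ℕ} (hn : 1 ≤ n) {Φ : (Fin n → ℝ) → ENNReal}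
    (hΦ : Measurable Φ) :
    ∫⁻ y, Φ y ∂cbe β n =
      ENNReal.ofReal ((2 ^ n) ^ (β * ((n : ℝ) - 1) / 2 + 1) / cbeConst β n) *
        ∫⁻ x, ENNReal.ofReal (cauchyWeight β x) *
          Φ fun i => Real.pi + 2 * Real.arctan (x i) := by
  have hC := cbeConst_pos hβ n
  have hmp := measurePreserving_pi (fun _ : Fin n =>
      volume.withDensity fun x : ℝ => ENNReal.ofReal (2 / (1 + x ^ 2)))
    (fun _ => volume.restrict (Set.Ico 0 (2 * Real.pi)))
    fun _ => measurePreserving_pi_add_two_arctan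
  have hd : Measurable fun y : Fin n → ℝ => ENNReal.ofReal ((1 / cbeConst β n) *
      ∏ p ∈ Finset.univ.filter (fun p : Fin n × Fin n => p.1 < p.2),
        ‖Complex.exp (Complex.I * (y p.1 : ℂ)) - Complex.exp (Complex.I * (y p.2 : ℂ))‖ ^ β) := by
    fun_prop
  have hc : Measurable fun x : Fin n → ℝ => ((fun y : Fin n → ℝ =>
      ENNReal.ofReal ((1 / cbeConst β n) *
      ∏ p ∈ Finset.univ.filter (fun p : Fin n × Fin n => p.1 < p.2),
        ‖Complex.exp (Complex.I * (y p.1 : ℂ)) - Complex.exp (Complex.I * (y p.2 : ℂ))‖ ^ β)) * Φ)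
      fun i => Real.pi + 2 * Real.arctan (x i) := (hd.mul hΦ).comp hmp.measurable
  rw [cbe, lintegral_withDensity_eq_lintegral_mul _ hd hΦ, volume_pi, Measure.restrict_pi_pi,
    ← hmp.lintegral_comp (hd.mul hΦ), pi_withDensity _ (by fun_prop),
    lintegral_withDensity_eq_lintegral_mul _
      (Finset.measurable_fun_prod _ fun i _ => by fun_prop) hc,
    ← volume_pi, ← lintegral_const_mul' _ _ ENNReal.ofReal_ne_top]
  refine lintegral_congr fun x => ?_
  simp only [Pi.mul_apply]
  rw [← mul_assoc, ← mul_assoc, ← ENNReal.ofReal_prod_of_nonneg fun i _ => by positivity,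
    ← ENNReal.ofReal_mul (Finset.prod_nonneg fun i _ => by positivity),
    ← ENNReal.ofReal_mul (by positivity), mul_left_comm, jacobian_mul_density hβ hn]
  congr 2
  ring

theorem measurable_countIn {n : ℕ} (θ : ℝ) :
    Measurable fun y : Fin n → ℝ => (countIn 0 θ y : ℝ) := by
  have : (fun y : Fin n → ℝ => (countIn 0 θ y : ℝ)) =
      fun y => ∑ j, if 0 ≤ y j ∧ y j < θ then (1 : ℝ) else 0 := by
    ext y; simp only [countIn, Finset.sum_boole]
  rw [this]
  refine Finset.measurable_fun_sum _ fun j _ => Measurable.ite ?_ measurable_const measurable_const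
  exact (measurableSet_le measurable_const (measurable_pi_apply j)).inter
    (measurableSet_lt (measurable_pi_apply j) measurable_const)

/-- The law of the counting function as the law of an integer part of a random phase. -/
theorem lintegral_countIn {β θ : ℝ} (hβ : 0 < β) (hθ : θ ∈ Set.Ioc 0 Real.pi) (k : ℕ)
    {f : ℝ → ENNReal} (hf : Measurable f) :
    ∫⁻ y, f (countIn 0 θ y) ∂cbe β (k + 1) = ENNReal.ofReal (2 * Real.pi)⁻¹ *
      ∫⁻ x, (∫⁻ s in Set.Ioc (-Real.pi) Real.pi, f (windingNumber s x)) ∂phaseLaw β θ k := by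
  have hG : 0 < Real.Gamma (β / 2) := Real.Gamma_pos_of_pos (by positivity)
  have hfm : Measurable fun x : Fin (k + 1) → ℝ => ENNReal.ofReal (cauchyWeight β x) *
      f (countLt (negCot θ) x) := Measurable.mul (by fun_prop) (hf.comp (by fun_prop))
  rw [lintegral_cbe (Φ := fun y => f (countIn 0 θ y)) hβ (by lia) (hf.comp (measurable_countIn θ))]
  simp only [countIn_pi_add_two_arctan hθ]
  rw [lintegral_eq_factorial_mul hfm
    (fun y σ => by rw [cauchyWeight_comp_perm, countLt_comp_perm])
    (fun y hy => by
      rw [cauchyWeight, absVand_eq_zero hy, Real.zero_rpow hβ.ne', zero_mul, ENNReal.ofReal_zero,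
        zero_mul])]
  have hG0 : ENNReal.ofReal (Real.Gamma (β / 2)) ^ (k + 1) ≠ 0 :=
    pow_ne_zero _ (by simpa using hG)
  rw [← ENNReal.mul_left_inj hG0 (by finiteness), mul_assoc, mul_assoc,
    lintegral_countLt hβ hθ k hf]
  set I := ∫⁻ x, (∫⁻ s in Set.Ioc (-Real.pi) Real.pi, f (windingNumber s x)) ∂phaseLaw β θ k
  have hG' := (Real.Gamma_pos_of_pos (show 0 < ((k + 1 : ℕ) : ℝ) * (β / 2) by positivity)).le
  have hp := pairConst_nonneg hβ k
  have hC := cbeConst_pos hβ (k + 1)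
  have := congrArg ENNReal.ofReal (cbeConst_identity hβ k)
  rw [ENNReal.ofReal_mul (by positivity), ENNReal.ofReal_mul (by positivity),
    ENNReal.ofReal_mul hG', ENNReal.ofReal_mul (by positivity), ENNReal.ofReal_pow hG.le,
    ENNReal.ofReal_natCast] at this
  calc _ = (ENNReal.ofReal ((2 ^ (k + 1)) ^ (β * (((k + 1 : ℕ) : ℝ) - 1) / 2 + 1) /
        cbeConst β (k + 1)) * (((k + 1).factorial : ENNReal) *
        (ENNReal.ofReal (Real.Gamma (((k + 1 : ℕ) : ℝ) * (β / 2))) *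
          ENNReal.ofReal (pairConst β k)))) * I := by ring
    _ = _ := by rw [this]; ring

theorem lintegral_mul_rpow_sub_one {b : ℝ} (hb : 0 < b) :
    ∫⁻ ρ in Set.Ioo (0 : ℝ) 1, ENNReal.ofReal (2 * ρ * (1 - ρ ^ 2) ^ (b - 1)) =
      ENNReal.ofReal (1 / b) := by
  have hcont : ContinuousOn (fun ρ : ℝ => -((1 - ρ ^ 2) ^ b / b)) (Set.Icc 0 1) :=
    ((Continuous.rpow_const (by fun_prop) fun _ => Or.inr hb.le).div_const b).neg.continuousOn
  have hderiv : ∀ ρ ∈ Set.Ioo (0 : ℝ) 1, HasDerivAt (fun ρ : ℝ => -((1 - ρ ^ 2) ^ b / b))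
      (2 * ρ * (1 - ρ ^ 2) ^ (b - 1)) ρ := fun ρ hρ => by
    have h1 : HasDerivAt (fun ρ : ℝ => 1 - ρ ^ 2) (-(2 * ρ)) ρ := by
      simpa using (hasDerivAt_pow 2 ρ).const_sub 1
    refine ((h1.rpow_const (p := b)
      (Or.inl (by nlinarith [hρ.1, hρ.2]))).div_const b).neg.congr_deriv ?_
    field_simp
  have hpos : ∀ ρ ∈ Set.Ioo (0 : ℝ) 1, 0 ≤ 2 * ρ * (1 - ρ ^ 2) ^ (b - 1) := fun ρ hρ =>
    mul_nonneg (by linarith [hρ.1]) (Real.rpow_nonneg (by nlinarith [hρ.1, hρ.2]) _)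
  have hint := intervalIntegral.integrableOn_deriv_of_nonneg hcont hderiv hpos
  have hI := intervalIntegral.integral_eq_sub_of_hasDerivAt_of_le zero_le_one hcont hderiv
    ((intervalIntegrable_iff_integrableOn_Ioc_of_le zero_le_one).2 hint)
  rw [← ofReal_integral_eq_lintegral_ofReal (hint.mono_set Set.Ioo_subset_Ioc_self)
    ((ae_restrict_iff' measurableSet_Ioo).2 (ae_of_all _ hpos)),
    ← integral_Ioc_eq_integral_Ioo, ← intervalIntegral.integral_of_le zero_le_one, hI]
  simp [Real.zero_rpow hb.ne']

theorem ae_mem_Ioo_radialMeasure (c : ℝ) : ∀ᵐ ρ ∂radialMeasure c, ρ ∈ Set.Ioo (0 : ℝ) 1 :=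
  (withDensity_absolutelyContinuous _ _).ae_le (ae_restrict_mem measurableSet_Ioo)

theorem lintegral_radialMeasure {c a : ℝ} (hc : 0 < c) (ha : 0 ≤ a) :
    ∫⁻ ρ, ENNReal.ofReal ((1 - ρ ^ 2) ^ a) ∂radialMeasure c = ENNReal.ofReal (c / (c + a)) := by
  rw [radialMeasure, lintegral_withDensity_eq_lintegral_mul _ (by fun_prop) (by fun_prop),
    show c / (c + a) = c * (1 / (c + a)) by ring, ENNReal.ofReal_mul hc.le,
    ← lintegral_mul_rpow_sub_one (by linarith), ← lintegral_const_mul' _ _ ENNReal.ofReal_ne_top]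
  refine setLIntegral_congr_fun measurableSet_Ioo fun ρ hρ => ?_
  have h1 : 0 < 1 - ρ ^ 2 := by nlinarith [hρ.1, hρ.2]
  have := hρ.1
  simp only [Pi.mul_apply]
  rw [← ENNReal.ofReal_mul (by positivity), ← ENNReal.ofReal_mul hc.le]
  congr 1
  rw [show c + a - 1 = (c - 1) + a by ring, Real.rpow_add h1]
  ring

theorem isProbabilityMeasure_radialMeasure {c : ℝ} (hc : 0 < c) :
    IsProbabilityMeasure (radialMeasure c) := ⟨by
  have := lintegral_radialMeasure hc le_rfl
  simpa [hc.ne'] using this⟩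

theorem integral_rpow_radialMeasure {c a : ℝ} (hc : 0 < c) (ha : 0 ≤ a) :
    ∫ ρ, (1 - ρ ^ 2) ^ a ∂radialMeasure c = c / (c + a) := by
  rw [integral_eq_lintegral_of_nonneg_ae _ (by fun_prop), lintegral_radialMeasure hc ha,
    ENNReal.toReal_ofReal (by positivity)]
  filter_upwards [ae_mem_Ioo_radialMeasure c] with ρ hρ
  exact Real.rpow_nonneg (by nlinarith [hρ.1, hρ.2]) _

theorem integrable_pow_radialMeasure {c : ℝ} (hc : 0 < c) (m : ℕ) :
    Integrable (fun ρ => ρ ^ m) (radialMeasure c) := by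
  have := isProbabilityMeasure_radialMeasure hc
  refine Integrable.of_bound (by fun_prop) 1 ?_
  filter_upwards [ae_mem_Ioo_radialMeasure c] with ρ hρ
  rw [Real.norm_eq_abs, abs_pow, abs_of_pos hρ.1]
  exact pow_le_one₀ hρ.1.le hρ.2.le

theorem integral_sq_radialMeasure {c : ℝ} (hc : 0 < c) :
    ∫ ρ, ρ ^ 2 ∂radialMeasure c = 1 / (c + 1) := by
  have := isProbabilityMeasure_radialMeasure hc
  have h := integral_rpow_radialMeasure hc zero_le_one
  simp only [Real.rpow_one] at h
  rw [integral_sub (integrable_const _) (integrable_pow_radialMeasure hc 2), integral_const] at h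
  simp only [probReal_univ, smul_eq_mul, mul_one] at h
  rw [← sub_sub_cancel 1 (∫ ρ, ρ ^ 2 ∂radialMeasure c), h]
  field_simp
  ring

theorem integral_pow_four_radialMeasure {c : ℝ} (hc : 0 < c) :
    ∫ ρ, ρ ^ 4 ∂radialMeasure c = 2 / ((c + 1) * (c + 2)) := by
  have := isProbabilityMeasure_radialMeasure hc
  have h := integral_rpow_radialMeasure hc (a := 2) (by norm_num)
  have h2 : ∀ ρ : ℝ, (1 - ρ ^ 2) ^ (2 : ℝ) = 1 - 2 * ρ ^ 2 + ρ ^ 4 := fun ρ => by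
    rw [Real.rpow_two]; ring
  have i2 := (integrable_pow_radialMeasure hc 2).const_mul 2
  have i4 := integrable_pow_radialMeasure hc 4
  have i1 : Integrable (fun _ => (1 : ℝ)) (radialMeasure c) := integrable_const _
  have e1 := integral_add (i1.sub i2) i4
  have e2 := integral_sub i1 i2
  simp only [Pi.sub_apply, integral_const_mul, integral_const, integral_sq_radialMeasure hc,
    probReal_univ, smul_eq_mul, mul_one] at e1 e2
  simp only [h2] at h
  have e3 : ∫ ρ, ρ ^ 4 ∂radialMeasure c = c / (c + 2) - (1 - 2 * (1 / (c + 1))) := by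
    linarith
  rw [e3]
  field_simp
  ring

theorem integral_cube_radialMeasure_le {c κ : ℝ} (hc : 0 < c) (hκ : 0 < κ) :
    ∫ ρ, ρ ^ 3 ∂radialMeasure c ≤ (1 / κ) / (2 * c) + κ / c ^ 2 := by
  have i2 := integrable_pow_radialMeasure hc 2
  have i4 := integrable_pow_radialMeasure hc 4
  calc ∫ ρ, ρ ^ 3 ∂radialMeasure c ≤
      ∫ ρ, (1 / κ / 2 * ρ ^ 2 + κ / 2 * ρ ^ 4) ∂radialMeasure c := by
        refine integral_mono (integrable_pow_radialMeasure hc 3)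
          ((i2.const_mul _).add (i4.const_mul _)) fun ρ => ?_
        have : 1 / κ / 2 * ρ ^ 2 + κ / 2 * ρ ^ 4 - ρ ^ 3 = ρ ^ 2 * (1 - κ * ρ) ^ 2 / (2 * κ) := by
          field_simp; ring
        have : 0 ≤ ρ ^ 2 * (1 - κ * ρ) ^ 2 / (2 * κ) := by positivity
        simp only
        linarith
    _ = 1 / κ / 2 * (1 / (c + 1)) + κ / 2 * (2 / ((c + 1) * (c + 2))) := by
        rw [integral_add (i2.const_mul _) (i4.const_mul _), integral_const_mul, integral_const_mul,
          integral_sq_radialMeasure hc, integral_pow_four_radialMeasure hc]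
    _ ≤ 1 / κ / 2 * (1 / c) + κ / 2 * (2 / (c * c)) := by
        gcongr <;> linarith
    _ = _ := by field_simp

theorem isProbabilityMeasure_stepMeasure {c : ℝ} (hc : 0 < c) :
    IsProbabilityMeasure (stepMeasure c) := by
  have := isProbabilityMeasure_radialMeasure hc
  unfold stepMeasure
  infer_instance

theorem isProbabilityMeasure_phaseLaw {β : ℝ} (hβ : 0 < β) (θ : ℝ) :
    ∀ k, IsProbabilityMeasure (phaseLaw β θ k)
  | 0 => by unfold phaseLaw; infer_instance
  | k + 1 => by
    have := isProbabilityMeasure_phaseLaw hβ θ k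
    have := isProbabilityMeasure_stepMeasure (c := ((k + 1 : ℕ) : ℝ) * (β / 2)) (by positivity)
    unfold phaseLaw
    exact Measure.isProbabilityMeasure_map (by fun_prop)

theorem map_countIn {β θ : ℝ} (hβ : 0 < β) (hθ : θ ∈ Set.Ioc 0 Real.pi) (k : ℕ) :
    (cbe β (k + 1)).map (fun y => (countIn 0 θ y : ℝ)) =
      ((phaseLaw β θ k).prod uniformPhase).map fun p => windingNumber p.2 p.1 := by
  refine Measure.ext_of_lintegral _ fun f hf => ?_
  rw [lintegral_map hf (measurable_countIn θ), lintegral_map hf (by fun_prop),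
      lintegral_countIn hβ hθ k hf,
    lintegral_prod _ (by
      exact (show Measurable fun p : ℝ × ℝ => f (windingNumber p.2 p.1) from
        hf.comp (by fun_prop)).aemeasurable), ← lintegral_const_mul' _ _ ENNReal.ofReal_ne_top]
  simp only [uniformPhase, lintegral_smul_measure, smul_eq_mul]

theorem windingNumber_eq_floor {s : ℝ} (hs : s ∈ Set.Ioo (-Real.pi) Real.pi) (x : ℝ) :
    windingNumber s x = ⌊(s + x + Real.pi) / (2 * Real.pi)⌋ := by
  have : ⌊(s + Real.pi) / (2 * Real.pi)⌋ = 0 := by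
    have := Real.pi_pos
    rw [Int.floor_eq_zero_iff]
    exact ⟨div_nonneg (by linarith [hs.1]) (by positivity),
      (div_lt_one (by positivity)).2 (by linarith [hs.2])⟩
  rw [windingNumber, this, Int.cast_zero, sub_zero]

theorem ae_mem_Ioo_uniformPhase : ∀ᵐ s ∂uniformPhase, s ∈ Set.Ioo (-Real.pi) Real.pi := by
  refine Measure.smul_absolutelyContinuous.ae_le ?_
  rw [← restrict_Ioo_eq_restrict_Ioc]
  exact ae_restrict_mem measurableSet_Ioo

theorem integral_uniformPhase {E : Type*} [NormedAddCommGroup E] [NormedSpace ℝ E] (f : ℝ → E) :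
    ∫ s, f s ∂uniformPhase = (2 * Real.pi)⁻¹ • ∫ s in -Real.pi..Real.pi, f s := by
  have := Real.pi_pos
  rw [uniformPhase, integral_smul_measure, ENNReal.toReal_ofReal (by positivity),
    intervalIntegral.integral_of_le (by linarith)]

theorem integral_uniformPhase_shift {E : Type*} [NormedAddCommGroup E] [NormedSpace ℝ E]
    {f : ℝ → E} (hf : Function.Periodic f (2 * Real.pi)) (x : ℝ) :
    ∫ s, f (s + x) ∂uniformPhase = ∫ s, f s ∂uniformPhase := by
  rw [integral_uniformPhase, integral_uniformPhase, intervalIntegral.integral_comp_add_right]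
  congr 1
  have := hf.intervalIntegral_add_eq (-Real.pi + x) (-Real.pi)
  rw [show -Real.pi + x + 2 * Real.pi = Real.pi + x by ring,
    show -Real.pi + 2 * Real.pi = Real.pi by ring] at this
  exact this

theorem abs_arg_one_add_le {z : ℂ} (hz : ‖z‖ < 1) : |(1 + z).arg| ≤ Real.pi / 2 * ‖z‖ := by
  have hre := one_add_re_pos hz
  have harg := arg_lt_of_re_pos hre
  have hn : 0 < ‖1 + z‖ := norm_pos_iff.2 (one_add_ne_zero_of_norm_lt hz)
  have h1 := Real.mul_abs_le_abs_sin (abs_le.2 ⟨by linarith, harg.2.le⟩ : |(1 + z).arg| ≤ Real.pi /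
      2)
  have h2 : |Real.sin (1 + z).arg| ≤ ‖z‖ := by
    rw [Complex.sin_arg, abs_div, abs_of_pos hn, div_le_iff₀ hn]
    refine abs_le_of_sq_le_sq ?_ (by positivity)
    have h3 : ‖z‖ ^ 2 = z.re ^ 2 + z.im ^ 2 := by rw [Complex.sq_norm, Complex.normSq_apply]; ring
    have h4 : ‖1 + z‖ ^ 2 = (1 + z.re) ^ 2 + z.im ^ 2 := by
      rw [Complex.sq_norm, Complex.normSq_apply]; simp; ring
    rw [mul_pow, h3, h4, Complex.add_im, Complex.one_im, zero_add]
    nlinarith [sq_nonneg (z.re + z.re ^ 2 + z.im ^ 2)]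
  have := Real.pi_pos
  calc |(1 + z).arg| = Real.pi / 2 * (2 / Real.pi * |(1 + z).arg|) := by field_simp
    _ ≤ Real.pi / 2 * ‖z‖ := by gcongr; exact h1.trans h2

theorem abs_arg_one_add_sub_im_le {z : ℂ} (hz : ‖z‖ < 1) :
    |(1 + z).arg - z.im| ≤ 6 * ‖z‖ ^ 2 := by
  rcases le_or_gt ‖z‖ (1 / 2) with h | h
  · have h1 := Complex.norm_log_one_add_sub_self_le hz
    have h2 : (1 + z).arg - z.im = (Complex.log (1 + z) - z).im := by
      rw [Complex.sub_im, Complex.log_im]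
    rw [h2]
    refine (Complex.abs_im_le_norm _).trans (h1.trans ?_)
    have : (1 - ‖z‖)⁻¹ ≤ 2 := by
      rw [inv_le_comm₀ (by linarith) zero_lt_two]; linarith
    nlinarith [sq_nonneg ‖z‖]
  · have h1 := abs_arg_one_add_le hz
    have h2 := Complex.abs_im_le_norm z
    have h3 := abs_sub (1 + z).arg z.im
    have := Real.pi_lt_four
    nlinarith

theorem diskArg_ofReal (ρ s : ℝ) : ∃ z : ℂ, ‖z‖ = |ρ| ∧ z.im = -(ρ * Real.sin s) ∧
    diskArg ρ s = 2 * (1 + z).arg := by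
  refine ⟨ρ * Complex.exp (-(s * Complex.I)), ?_, ?_, rfl⟩
  · rw [norm_mul, Complex.norm_real, ← neg_mul, ← Complex.ofReal_neg, Complex.norm_exp_ofReal_mul_I,
      mul_one, Real.norm_eq_abs]
  · rw [← neg_mul, ← Complex.ofReal_neg, Complex.im_ofReal_mul, Complex.exp_ofReal_mul_I_im]
    simp

theorem abs_phaseJump_le {ρ : ℝ} (hρ : ρ ∈ Set.Ioo (0 : ℝ) 1) (x s : ℝ) :
    |phaseJump x (ρ, s)| ≤ 2 * Real.pi * ρ := by
  obtain ⟨z, hz, -, h1⟩ := diskArg_ofReal ρ (s + x)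
  obtain ⟨w, hw, -, h2⟩ := diskArg_ofReal ρ s
  rw [abs_of_pos hρ.1] at hz hw
  have a1 := abs_arg_one_add_le (hz.trans_lt hρ.2)
  have a2 := abs_arg_one_add_le (hw.trans_lt hρ.2)
  rw [phaseJump, h1, h2, ← mul_sub, abs_mul, abs_two]
  have := abs_sub (1 + z).arg (1 + w).arg
  rw [hz] at a1
  rw [hw] at a2
  linarith

theorem abs_phaseJump_sub_le {ρ : ℝ} (hρ : ρ ∈ Set.Ioo (0 : ℝ) 1) (x s : ℝ) :
    |phaseJump x (ρ, s) - 2 * ρ * (Real.sin s - Real.sin (s + x))| ≤ 24 * ρ ^ 2 := by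
  obtain ⟨z, hz, hz', h1⟩ := diskArg_ofReal ρ (s + x)
  obtain ⟨w, hw, hw', h2⟩ := diskArg_ofReal ρ s
  rw [abs_of_pos hρ.1] at hz hw
  have a1 := abs_arg_one_add_sub_im_le (hz.trans_lt hρ.2)
  have a2 := abs_arg_one_add_sub_im_le (hw.trans_lt hρ.2)
  rw [hz, hz'] at a1
  rw [hw, hw'] at a2
  rw [phaseJump, h1, h2]
  rw [abs_le] at *
  constructor <;> linarith [a1.1, a1.2, a2.1, a2.2]

theorem periodic_diskArg (α : ℂ) : Function.Periodic (diskArg α) (2 * Real.pi) :=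
  diskArg_add_two_pi α

theorem abs_diskArg_le (α : ℂ) (s : ℝ) : |diskArg α s| ≤ 2 * Real.pi := by
  rw [diskArg, abs_mul, abs_two]
  linarith [Complex.abs_arg_le_pi (1 + α * Complex.exp (-(s * Complex.I)))]

theorem abs_phaseJump_le_const (x : ℝ) (w : ℝ × ℝ) : |phaseJump x w| ≤ 4 * Real.pi := by
  have h1 := abs_diskArg_le w.1 (w.2 + x)
  have h2 := abs_diskArg_le w.1 w.2
  rw [phaseJump]
  linarith [abs_sub (diskArg w.1 (w.2 + x)) (diskArg w.1 w.2)]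

theorem integral_phaseJump (x ρ : ℝ) : ∫ s, phaseJump x (ρ, s) ∂uniformPhase = 0 := by
  have h : ∀ x : ℝ, Integrable (fun s => diskArg ρ (s + x)) uniformPhase := fun x =>
    Integrable.of_bound (Measurable.aestronglyMeasurable (by fun_prop)) (2 * Real.pi) (ae_of_all _
        fun s => abs_diskArg_le _ _)
  have h0 := h 0
  simp only [add_zero] at h0
  simp only [phaseJump]
  rw [integral_sub (h x) h0, integral_uniformPhase_shift (periodic_diskArg ρ), sub_self]

theorem integral_sin_sub_sin_sq (x : ℝ) :
    ∫ s, (Real.sin s - Real.sin (s + x)) ^ 2 ∂uniformPhase = 1 - Real.cos x := by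
  have hderiv : ∀ s ∈ Set.uIcc (-Real.pi) Real.pi, HasDerivAt (fun s => (1 - Real.cos x) * s -
      (Real.sin (2 * s) + Real.sin (2 * s + 2 * x)) / 4 + Real.sin (2 * s + x) / 2)
      ((Real.sin s - Real.sin (s + x)) ^ 2) s := fun s _ => by
    have h2 : HasDerivAt (fun s : ℝ => 2 * s) 2 s := by simpa using (hasDerivAt_id s).const_mul 2
    refine (((hasDerivAt_id s).const_mul (1 - Real.cos x)).sub
      ((h2.sin.add (h2.add_const (2 * x)).sin).div_const 4)).add
      ((h2.add_const x).sin.div_const 2) |>.congr_deriv ?_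
    rw [show 2 * s + 2 * x = 2 * (s + x) by ring, show 2 * s + x = s + (s + x) by ring,
      Real.cos_add s (s + x), Real.cos_two_mul, Real.cos_two_mul,
      show x = (s + x) - s by ring, Real.cos_sub, show s + (s + x - s) = s + x by ring]
    have e1 := Real.sin_sq_add_cos_sq s
    have e2 := Real.sin_sq_add_cos_sq (s + x)
    linear_combination -e1 - e2
  have hpi := Real.pi_pos
  rw [integral_uniformPhase, intervalIntegral.integral_eq_sub_of_hasDerivAt hderiv
    (by apply Continuous.intervalIntegrable; fun_prop)]
  have e1 : Real.sin (2 * Real.pi) = 0 := Real.sin_two_pi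
  have e2 : Real.sin (2 * -Real.pi) = 0 := by rw [mul_neg, Real.sin_neg, e1, neg_zero]
  have e3 : ∀ y, Real.sin (2 * Real.pi + y) = Real.sin y := fun y => by
    rw [add_comm, Real.sin_add_two_pi]
  have e4 : ∀ y, Real.sin (2 * -Real.pi + y) = Real.sin y := fun y => by
    rw [mul_neg, ← sub_eq_neg_add, Real.sin_sub_two_pi]
  rw [e1, e2, e3, e3, e4, e4, smul_eq_mul]
  field_simp
  ring

theorem norm_exp_I_mul_sub_le (y : ℝ) :
    ‖Complex.exp (Complex.I * y) - 1 - Complex.I * y‖ ≤ y ^ 2 * Real.exp |y| := by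
  have h := Complex.norm_exp_sub_sum_le_norm_mul_exp (Complex.I * y) 2
  rw [norm_mul, Complex.norm_I, one_mul, Complex.norm_real, Real.norm_eq_abs, sq_abs] at h
  convert h using 2
  simp [Finset.sum_range_succ]
  ring

theorem norm_exp_I_mul_sub_sq_le (y : ℝ) :
    ‖Complex.exp (Complex.I * y) - 1 - Complex.I * y + ((y ^ 2 / 2 : ℝ) : ℂ)‖ ≤
      |y| ^ 3 * Real.exp |y| := by
  have h := Complex.norm_exp_sub_sum_le_norm_mul_exp (Complex.I * y) 3
  rw [norm_mul, Complex.norm_I, one_mul, Complex.norm_real, Real.norm_eq_abs] at h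
  convert h using 2
  simp [Finset.sum_range_succ, Nat.factorial, mul_pow]
  ring

theorem integrable_exp_I_mul {α : Type*} [MeasurableSpace α] {μ : Measure α} [IsFiniteMeasure μ]
    {g : α → ℝ} (hg : Measurable g) : Integrable (fun a => Complex.exp (Complex.I * (g a : ℂ))) μ :=
  Integrable.of_bound (by fun_prop) 1 (ae_of_all _ fun a => (Complex.norm_exp_I_mul_ofReal _).le)

theorem integrable_phaseJump {μ : Measure (ℝ × ℝ)} [IsFiniteMeasure μ] (x : ℝ) :
    Integrable (phaseJump x) μ :=
  Integrable.of_bound (Measurable.aestronglyMeasurable (by fun_prop)) (4 * Real.pi)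
    (ae_of_all _ fun s => abs_phaseJump_le_const _ _)

theorem integrable_phaseJump_right (x ρ : ℝ) :
    Integrable (fun s => phaseJump x (ρ, s)) uniformPhase :=
  Integrable.of_bound (Measurable.aestronglyMeasurable (by fun_prop)) (4 * Real.pi)
    (ae_of_all _ fun s => abs_phaseJump_le_const _ _)

theorem norm_integral_exp_phaseJump_sub_one_le {M ν ρ : ℝ} (hν : |ν| ≤ M)
    (hρ : ρ ∈ Set.Ioo (0 : ℝ) 1) (x : ℝ) :
    ‖∫ s, Complex.exp (Complex.I * ((ν * phaseJump x (ρ, s) : ℝ) : ℂ)) ∂uniformPhase - 1‖ ≤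
      (2 * Real.pi) ^ 2 * Real.exp (2 * Real.pi * M) * ν ^ 2 * ρ ^ 2 := by
  have hM := (abs_nonneg ν).trans hν
  have hpi := Real.pi_pos
  have i1 : Integrable (fun s => Complex.exp (Complex.I * ((ν * phaseJump x (ρ, s) : ℝ) : ℂ)))
      uniformPhase := integrable_exp_I_mul (by fun_prop)
  have i2 : Integrable (fun s => Complex.I * ((ν * phaseJump x (ρ, s) : ℝ) : ℂ)) uniformPhase :=
    (((integrable_phaseJump_right x ρ).const_mul ν).ofReal).const_mul _
  have i0 : Integrable (fun _ => (1 : ℂ)) uniformPhase := integrable_const _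
  have : ∫ s, (Complex.exp (Complex.I * ((ν * phaseJump x (ρ, s) : ℝ) : ℂ)) - 1 -
      Complex.I * ((ν * phaseJump x (ρ, s) : ℝ) : ℂ)) ∂uniformPhase =
      ∫ s, Complex.exp (Complex.I * ((ν * phaseJump x (ρ, s) : ℝ) : ℂ)) ∂uniformPhase - 1 := by
    rw [integral_sub (f := fun s => Complex.exp (Complex.I * ((ν * phaseJump x (ρ,
        s) : ℝ) : ℂ)) - 1)
      (i1.sub i0) i2, integral_sub i1 i0, integral_const_mul, integral_complex_ofReal,
      integral_const_mul, integral_phaseJump]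
    simp
  rw [← this]
  refine (norm_integral_le_of_norm_le_const (ae_of_all _ fun s => ?_)).trans_eq
    (by rw [probReal_univ, mul_one])
  have h1 := abs_phaseJump_le hρ x s
  refine (norm_exp_I_mul_sub_le _).trans ?_
  have h2 : |ν * phaseJump x (ρ, s)| ≤ 2 * Real.pi * M := by
    rw [abs_mul, mul_comm]
    have := hρ.2
    gcongr
    nlinarith
  have h3 : (ν * phaseJump x (ρ, s)) ^ 2 ≤ ν ^ 2 * (2 * Real.pi * ρ) ^ 2 := by
    rw [mul_pow, ← sq_abs (phaseJump x (ρ, s))]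
    gcongr
  calc _ ≤ ν ^ 2 * (2 * Real.pi * ρ) ^ 2 * Real.exp (2 * Real.pi * M) := by gcongr
    _ = _ := by ring

theorem norm_integral_exp_phaseJump_sub_le {M ν ρ : ℝ} (hν : |ν| ≤ M)
    (hρ : ρ ∈ Set.Ioo (0 : ℝ) 1) (x : ℝ) :
    ‖∫ s, Complex.exp (Complex.I * ((ν * phaseJump x (ρ, s) : ℝ) : ℂ)) ∂uniformPhase -
        ((1 - 2 * ν ^ 2 * ρ ^ 2 * (1 - Real.cos x) : ℝ) : ℂ)‖ ≤
      ((2 * Real.pi) ^ 3 * M * Real.exp (2 * Real.pi * M) + 144) * ν ^ 2 * ρ ^ 3 := by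
  have hM := (abs_nonneg ν).trans hν
  have hpi := Real.pi_pos
  have hρ0 := hρ.1
  let L : ℝ → ℝ := fun s => 2 * ρ * (Real.sin s - Real.sin (s + x))
  have hL : ∀ s, |L s| ≤ 4 * ρ := fun s => by
    have := abs_sub (Real.sin s) (Real.sin (s + x))
    rw [abs_mul, abs_of_pos (by positivity)]
    nlinarith [Real.abs_sin_le_one s, Real.abs_sin_le_one (s + x)]
  have iL : Integrable (fun s => L s ^ 2) uniformPhase :=
    Integrable.of_bound (by unfold L; fun_prop) ((4 * ρ) ^ 2) (ae_of_all _ fun s => by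
      rw [norm_pow, Real.norm_eq_abs]
      exact pow_le_pow_left₀ (abs_nonneg _) (hL s) 2)
  have i1 : Integrable (fun s => Complex.exp (Complex.I * ((ν * phaseJump x (ρ, s) : ℝ) : ℂ)))
      uniformPhase := integrable_exp_I_mul (by fun_prop)
  have i2 : Integrable (fun s => Complex.I * ((ν * phaseJump x (ρ, s) : ℝ) : ℂ)) uniformPhase :=
    (((integrable_phaseJump_right x ρ).const_mul ν).ofReal).const_mul _
  have i3 : Integrable (fun s => ((ν ^ 2 / 2 * L s ^ 2 : ℝ) : ℂ)) uniformPhase :=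
    (iL.const_mul _).ofReal
  have i0 : Integrable (fun _ => (1 : ℂ)) uniformPhase := integrable_const _
  have hI : ∫ s, L s ^ 2 ∂uniformPhase = 4 * ρ ^ 2 * (1 - Real.cos x) := by
    simp only [L, mul_pow _ _ 2]
    rw [integral_const_mul, integral_sin_sub_sin_sq]
    ring
  have : ∫ s, (Complex.exp (Complex.I * ((ν * phaseJump x (ρ, s) : ℝ) : ℂ)) - 1 -
      Complex.I * ((ν * phaseJump x (ρ, s) : ℝ) : ℂ) + ((ν ^ 2 / 2 * L s ^ 2 : ℝ) : ℂ))
          ∂uniformPhase =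
      ∫ s, Complex.exp (Complex.I * ((ν * phaseJump x (ρ, s) : ℝ) : ℂ)) ∂uniformPhase -
        ((1 - 2 * ν ^ 2 * ρ ^ 2 * (1 - Real.cos x) : ℝ) : ℂ) := by
    rw [integral_add (f := fun s => Complex.exp (Complex.I * ((ν * phaseJump x (ρ,
        s) : ℝ) : ℂ)) - 1 -
        Complex.I * ((ν * phaseJump x (ρ, s) : ℝ) : ℂ)) ((i1.sub i0).sub i2) i3,
      integral_sub (f := fun s => Complex.exp (Complex.I * ((ν * phaseJump x (ρ, s) : ℝ) : ℂ)) - 1)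
        (i1.sub i0) i2, integral_sub i1 i0,
      integral_const_mul, integral_complex_ofReal, integral_complex_ofReal, integral_const_mul,
          integral_const_mul,
      integral_phaseJump, hI]
    simp
    ring
  rw [← this]
  refine (norm_integral_le_of_norm_le_const (ae_of_all _ fun s => ?_)).trans_eq
    (by rw [probReal_univ, mul_one])
  have h1 := abs_phaseJump_le hρ x s
  have h2 : |ν * phaseJump x (ρ, s)| ≤ 2 * Real.pi * M := by
    rw [abs_mul, mul_comm]
    have := hρ.2
    gcongr
    nlinarith
  have h3 : |ν * phaseJump x (ρ, s)| ^ 3 ≤ ν ^ 2 * M * (2 * Real.pi * ρ) ^ 3 := by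
    rw [abs_mul, mul_pow, pow_succ |ν|, sq_abs]
    gcongr
  have h4 := norm_exp_I_mul_sub_sq_le (ν * phaseJump x (ρ, s))
  have h5 : |L s ^ 2 - phaseJump x (ρ, s) ^ 2| ≤ 288 * ρ ^ 3 := by
    rw [sq_sub_sq, abs_mul, mul_comm, abs_sub_comm]
    have h6 : |L s + phaseJump x (ρ, s)| ≤ 12 * ρ := by
      have := abs_add_le (L s) (phaseJump x (ρ, s))
      nlinarith [hL s, Real.pi_lt_four]
    calc _ ≤ (24 * ρ ^ 2) * (12 * ρ) := by
          gcongr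
          exact abs_phaseJump_sub_le hρ x s
      _ = _ := by ring
  have e : Complex.exp (Complex.I * ((ν * phaseJump x (ρ, s) : ℝ) : ℂ)) - 1 -
      Complex.I * ((ν * phaseJump x (ρ, s) : ℝ) : ℂ) + ((ν ^ 2 / 2 * L s ^ 2 : ℝ) : ℂ) =
      (Complex.exp (Complex.I * ((ν * phaseJump x (ρ, s) : ℝ) : ℂ)) - 1 -
      Complex.I * ((ν * phaseJump x (ρ, s) : ℝ) : ℂ) +
        (((ν * phaseJump x (ρ, s)) ^ 2 / 2 : ℝ) : ℂ)) +
      ((ν ^ 2 / 2 * (L s ^ 2 - phaseJump x (ρ, s) ^ 2) : ℝ) : ℂ) := by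
    push_cast; ring
  rw [e]
  refine (norm_add_le _ _).trans ?_
  rw [Complex.norm_real, Real.norm_eq_abs, abs_mul, abs_of_nonneg (by positivity : 0 ≤ ν ^ 2 / 2)]
  calc _ ≤ ν ^ 2 * M * (2 * Real.pi * ρ) ^ 3 * Real.exp (2 * Real.pi * M) +
        ν ^ 2 / 2 * (288 * ρ ^ 3) := by
        gcongr
        refine h4.trans ?_
        gcongr
    _ = _ := by ring

theorem integral_exp_phaseJump {c : ℝ} (hc : 0 < c) (ν x : ℝ) :
    ∫ w, Complex.exp (Complex.I * ((ν * phaseJump x w : ℝ) : ℂ)) ∂stepMeasure c =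
      ∫ ρ, ∫ s, Complex.exp (Complex.I * ((ν * phaseJump x (ρ, s) : ℝ) : ℂ)) ∂uniformPhase
        ∂radialMeasure c := by
  have := isProbabilityMeasure_radialMeasure hc
  rw [stepMeasure, integral_prod _ (integrable_exp_I_mul (by fun_prop))]

theorem integrable_integral_exp_phaseJump {c : ℝ} (hc : 0 < c) (ν x : ℝ) :
    Integrable (fun ρ => ∫ s, Complex.exp (Complex.I * ((ν * phaseJump x (ρ, s) : ℝ) : ℂ))
      ∂uniformPhase) (radialMeasure c) := by
  have := isProbabilityMeasure_radialMeasure hc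
  exact (integrable_exp_I_mul (μ := (radialMeasure c).prod uniformPhase)
    (g := fun w => ν * phaseJump x w) (by fun_prop)).integral_prod_left

theorem exists_norm_integral_exp_sub_one_le {β : ℝ} (hβ : 0 < β) (M : ℝ) :
    ∃ C > 0, ∀ ν, |ν| ≤ M → ∀ (k : ℕ) (x : ℝ), 1 ≤ k →
      ‖∫ w, Complex.exp (Complex.I * ((ν * phaseJump x w : ℝ) : ℂ))
        ∂stepMeasure ((k : ℝ) * (β / 2)) - 1‖ ≤ C / k := by
  refine ⟨(2 * Real.pi) ^ 2 * Real.exp (2 * Real.pi * M) * (M ^ 2 + 1) * (2 / β),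
    by have := Real.pi_pos; positivity, fun ν hν k x hk => ?_⟩
  have hk0 : (0 : ℝ) < k := by exact_mod_cast hk
  have hc : 0 < (k : ℝ) * (β / 2) := by positivity
  have := isProbabilityMeasure_radialMeasure hc
  have hM : ν ^ 2 ≤ M ^ 2 + 1 := by
    have := sq_le_sq' (by linarith [neg_abs_le ν, le_abs_self ν]) ((le_abs_self ν).trans hν)
    linarith
  have i0 : Integrable (fun _ => (1 : ℂ)) (radialMeasure ((k : ℝ) * (β / 2))) := integrable_const _
  have e : ∫ w, Complex.exp (Complex.I * ((ν * phaseJump x w : ℝ) : ℂ))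
      ∂stepMeasure ((k : ℝ) * (β / 2)) - 1 = ∫ ρ, ((∫ s, Complex.exp (Complex.I *
        ((ν * phaseJump x (ρ, s) : ℝ) : ℂ)) ∂uniformPhase) - 1)
        ∂radialMeasure ((k : ℝ) * (β / 2)) := by
    rw [integral_sub (integrable_integral_exp_phaseJump hc ν x) i0, integral_exp_phaseJump hc]
    simp
  rw [e]
  refine (norm_integral_le_of_norm_le ((integrable_pow_radialMeasure hc 2).const_mul _)
    ((ae_mem_Ioo_radialMeasure _).mono fun ρ hρ =>
      norm_integral_exp_phaseJump_sub_one_le hν hρ x)).trans ?_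
  rw [integral_const_mul, integral_sq_radialMeasure hc]
  calc _ ≤ (2 * Real.pi) ^ 2 * Real.exp (2 * Real.pi * M) * (M ^ 2 + 1) *
        (1 / ((k : ℝ) * (β / 2))) := by gcongr; linarith
    _ = _ := by field_simp

theorem exists_norm_integral_exp_sub_le {β : ℝ} (hβ : 0 < β) (M : ℝ) (hM : 0 ≤ M) :
    ∃ C > 0, ∀ ν, |ν| ≤ M → ∀ (k : ℕ) (x : ℝ), 1 ≤ k →
      ‖∫ w, Complex.exp (Complex.I * ((ν * phaseJump x w : ℝ) : ℂ))
        ∂stepMeasure ((k : ℝ) * (β / 2)) -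
          ((1 - 4 * ν ^ 2 / β / k * (1 - Real.cos x) : ℝ) : ℂ)‖ ≤ C * ν ^ 2 / (k * √k) := by
  refine ⟨((2 * Real.pi) ^ 3 * M * Real.exp (2 * Real.pi * M) + 144) * (1 / β + 4 / β ^ 2) +
    16 / β ^ 2, by have := Real.pi_pos; positivity, fun ν hν k x hk => ?_⟩
  have hk1 : (1 : ℝ) ≤ k := by exact_mod_cast hk
  have hk0 : (0 : ℝ) < k := by exact_mod_cast hk
  have hs : 0 < √(k : ℝ) := Real.sqrt_pos.2 hk0
  have hsk : √(k : ℝ) ≤ k := Real.sqrt_le_left (by positivity) |>.2 (by nlinarith)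
  have hss : √(k : ℝ) ^ 2 = k := Real.sq_sqrt hk0.le
  obtain ⟨c, hc'⟩ : ∃ c, (k : ℝ) * (β / 2) = c := ⟨_, rfl⟩
  have hc : 0 < c := by rw [← hc']; positivity
  rw [hc']
  have := isProbabilityMeasure_radialMeasure hc
  have i2 : Integrable (fun ρ : ℝ => 1 - 2 * ν ^ 2 * ρ ^ 2 * (1 - Real.cos x)) (radialMeasure c) :=
    (integrable_const _).sub (((integrable_pow_radialMeasure hc 2).const_mul _).mul_const _)
  have i2' : Integrable (fun ρ : ℝ => ((1 - 2 * ν ^ 2 * ρ ^ 2 * (1 - Real.cos x) : ℝ) : ℂ))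
      (radialMeasure c) := i2.ofReal
  have e : ∫ w, Complex.exp (Complex.I * ((ν * phaseJump x w : ℝ) : ℂ)) ∂stepMeasure c -
      ((1 - 2 * ν ^ 2 * (1 / (c + 1)) * (1 - Real.cos x) : ℝ) : ℂ) =
      ∫ ρ, ((∫ s, Complex.exp (Complex.I * ((ν * phaseJump x (ρ, s) : ℝ) : ℂ)) ∂uniformPhase) -
        ((1 - 2 * ν ^ 2 * ρ ^ 2 * (1 - Real.cos x) : ℝ) : ℂ)) ∂radialMeasure c := by
    rw [integral_sub (integrable_integral_exp_phaseJump hc ν x) i2',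
      integral_exp_phaseJump hc, integral_complex_ofReal, integral_sub (integrable_const _)
        (((integrable_pow_radialMeasure hc 2).const_mul _).mul_const _), integral_mul_const,
      integral_const_mul, integral_sq_radialMeasure hc]
    simp
  have b1 := (norm_integral_le_of_norm_le ((integrable_pow_radialMeasure hc 3).const_mul _)
    ((ae_mem_Ioo_radialMeasure _).mono fun ρ hρ =>
      norm_integral_exp_phaseJump_sub_le hν hρ x))
  rw [← e, integral_const_mul] at b1
  have b2 := integral_cube_radialMeasure_le hc hs
  have e2 : 1 / √(k : ℝ) / (2 * c) + √(k : ℝ) / c ^ 2 = (1 / β + 4 / β ^ 2) / (k * √k) := by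
    rw [← hc']
    field_simp
    rw [hss]
    ring
  rw [e2] at b2
  have b3 : ‖((1 - 2 * ν ^ 2 * (1 / (c + 1)) * (1 - Real.cos x) : ℝ) : ℂ) -
      ((1 - 4 * ν ^ 2 / β / k * (1 - Real.cos x) : ℝ) : ℂ)‖ ≤ 16 / β ^ 2 * ν ^ 2 / (k * √k) := by
    rw [← Complex.ofReal_sub, Complex.norm_real, Real.norm_eq_abs]
    have : 1 - 2 * ν ^ 2 * (1 / (c + 1)) * (1 - Real.cos x) -
        (1 - 4 * ν ^ 2 / β / k * (1 - Real.cos x)) =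
        2 * ν ^ 2 / (c * (c + 1)) * (1 - Real.cos x) := by
      rw [← hc']
      field_simp
      ring
    rw [this, abs_of_nonneg (mul_nonneg (by positivity) (by linarith [Real.cos_le_one x]))]
    calc _ ≤ 2 * ν ^ 2 / (c * c) * 2 := by
          have h1 := Real.cos_le_one x
          have h2 := Real.neg_one_le_cos x
          refine mul_le_mul ?_ (by linarith) (by linarith) (by positivity)
          gcongr
          linarith
      _ = 16 / β ^ 2 * ν ^ 2 / (k * k) := by rw [← hc']; field_simp; ring
      _ ≤ _ := by gcongr
  have := norm_sub_le_norm_sub_add_norm_sub (∫ w, Complex.exp (Complex.I * ((ν * phaseJump x w : ℝ)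
      : ℂ)) ∂stepMeasure c)
    ((1 - 2 * ν ^ 2 * (1 / (c + 1)) * (1 - Real.cos x) : ℝ) : ℂ) ((1 - 4 * ν ^ 2 / β / k * (1 -
        Real.cos x) : ℝ) : ℂ)
  refine this.trans ((add_le_add b1 b3).trans ?_)
  have hpi := Real.pi_pos
  calc _ ≤ ((2 * Real.pi) ^ 3 * M * Real.exp (2 * Real.pi * M) + 144) * ν ^ 2 *
        ((1 / β + 4 / β ^ 2) / (k * √k)) + 16 / β ^ 2 * ν ^ 2 / (k * √k) := by gcongr
    _ = _ := by ring

theorem hasDerivAt_diskArg {α : ℂ} (hα : ‖α‖ < 1) (s : ℝ) :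
    HasDerivAt (diskArg α) (2 * (-(Complex.I * (α * Complex.exp (-(s * Complex.I)))) /
      (1 + α * Complex.exp (-(s * Complex.I)))).im) s := by
  have hn : ‖α * Complex.exp (-(s * Complex.I))‖ < 1 := by
    rwa [norm_mul, ← neg_mul, ← Complex.ofReal_neg, Complex.norm_exp_ofReal_mul_I, mul_one]
  have h1 : HasDerivAt (fun s : ℝ => 1 + α * Complex.exp (-(s * Complex.I)))
      (-(Complex.I * (α * Complex.exp (-(s * Complex.I))))) s := by
    have h2 : HasDerivAt (fun s : ℝ => -((s : ℂ) * Complex.I)) (-Complex.I) s := by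
      refine ((Complex.ofRealCLM.hasDerivAt (x := s)).mul_const Complex.I).neg.congr_deriv ?_
      simp
    refine ((h2.cexp.const_mul α).const_add 1).congr_deriv ?_
    ring
  have h3 := h1.clog_real (Or.inl (one_add_re_pos hn))
  have h4 : diskArg α = fun s : ℝ =>
      2 * (Complex.log (1 + α * Complex.exp (-(s * Complex.I)))).im := by
    funext s
    rw [Complex.log_im, diskArg]
  rw [h4]
  exact (Complex.imCLM.hasFDerivAt.comp_hasDerivAt s h3).const_mul 2

theorem monotone_add_diskArg {α : ℂ} (hα : ‖α‖ < 1) : Monotone fun s => s + diskArg α s := by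
  have hd : ∀ s, HasDerivAt (fun s => s + diskArg α s) _ s := fun s =>
    (hasDerivAt_id s).add (hasDerivAt_diskArg hα s)
  refine monotone_of_deriv_nonneg (fun s => (hd s).differentiableAt) fun s => ?_
  rw [(hd s).deriv]
  have hn : ‖α * Complex.exp (-(s * Complex.I))‖ < 1 := by
    rwa [norm_mul, ← neg_mul, ← Complex.ofReal_neg, Complex.norm_exp_ofReal_mul_I, mul_one]
  generalize α * Complex.exp (-(s * Complex.I)) = z at hn
  have h1 : 0 < Complex.normSq (1 + z) := Complex.normSq_pos.2 (one_add_ne_zero_of_norm_lt hn)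
  have h2 : Complex.normSq z < 1 := by
    rw [Complex.normSq_eq_norm_sq]; nlinarith [norm_nonneg z]
  have h3 : 1 + 2 * (-(Complex.I * z) / (1 + z)).im =
      (1 - Complex.normSq z) / Complex.normSq (1 + z) := by
    rw [Complex.div_im]
    field_simp
    simp [Complex.normSq_apply]
    ring
  rw [h3]
  exact div_nonneg (by linarith) h1.le

theorem add_phaseJump_nonneg {x : ℝ} (hx : 0 ≤ x) {w : ℝ × ℝ} (hw : w.1 ∈ Set.Ioo (0 : ℝ) 1) :
    0 ≤ x + phaseJump x w := by
  have hn : ‖(w.1 : ℂ)‖ < 1 := by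
    rw [Complex.norm_real, Real.norm_eq_abs, abs_of_pos hw.1]; exact hw.2
  have := monotone_add_diskArg hn (show w.2 ≤ w.2 + x by linarith)
  rw [phaseJump]
  simp only at this
  linarith

theorem ae_stepMeasure (c : ℝ) : ∀ᵐ w ∂stepMeasure c, w.1 ∈ Set.Ioo (0 : ℝ) 1 :=
  Measure.quasiMeasurePreserving_fst.ae (ae_mem_Ioo_radialMeasure c)

theorem ae_phaseLaw_nonneg (β : ℝ) {θ : ℝ} (hθ : 0 ≤ θ) : ∀ k, ∀ᵐ x ∂phaseLaw β θ k, 0 ≤ x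
  | 0 => by
    rw [phaseLaw, ae_dirac_iff measurableSet_Ici]
    exact hθ
  | k + 1 => by
    rw [phaseLaw, ae_map_iff (by fun_prop) measurableSet_Ici]
    filter_upwards [Measure.quasiMeasurePreserving_fst.ae (ae_phaseLaw_nonneg β hθ k),
      Measure.quasiMeasurePreserving_snd.ae (ae_stepMeasure _)] with p h1 h2
    have := add_phaseJump_nonneg h1 h2
    linarith

theorem integral_stepMeasure_phaseJump {c : ℝ} (hc : 0 < c) (x : ℝ) :
    ∫ w, phaseJump x w ∂stepMeasure c = 0 := by
  have := isProbabilityMeasure_radialMeasure hc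
  rw [stepMeasure, integral_prod _ (integrable_phaseJump x)]
  simp [integral_phaseJump]

theorem integral_phaseLaw {β θ : ℝ} (hβ : 0 < β) : ∀ k : ℕ,
    Integrable (fun x => x) (phaseLaw β θ k) ∧ ∫ x, x ∂phaseLaw β θ k = ((k : ℝ) + 1) * θ
  | 0 => by
    rw [phaseLaw]
    exact ⟨integrable_dirac (by simp), by simp⟩
  | k + 1 => by
    obtain ⟨h1, h2⟩ := integral_phaseLaw (θ := θ) hβ k
    have hc : 0 < ((k + 1 : ℕ) : ℝ) * (β / 2) := by positivity
    have := isProbabilityMeasure_phaseLaw hβ θ k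
    have := isProbabilityMeasure_stepMeasure hc
    have hm : Measurable fun p : ℝ × ℝ × ℝ => θ + p.1 + phaseJump p.1 p.2 := by fun_prop
    have i1 : Integrable (fun p : ℝ × ℝ × ℝ => θ + p.1)
        ((phaseLaw β θ k).prod (stepMeasure (((k + 1 : ℕ) : ℝ) * (β / 2)))) :=
      (integrable_const _).add (h1.comp_fst _)
    have i2 : Integrable (fun p : ℝ × ℝ × ℝ => phaseJump p.1 p.2)
        ((phaseLaw β θ k).prod (stepMeasure (((k + 1 : ℕ) : ℝ) * (β / 2)))) :=
      Integrable.of_bound (Measurable.aestronglyMeasurable (by fun_prop)) (4 * Real.pi)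
        (ae_of_all _ fun s => abs_phaseJump_le_const _ _)
    have i3 := i1.add i2
    rw [phaseLaw]
    refine ⟨(integrable_map_measure aestronglyMeasurable_id hm.aemeasurable).2 i3, ?_⟩
    rw [integral_map (f := fun x => x) hm.aemeasurable aestronglyMeasurable_id,
      integral_add i1 i2,
      integral_add (integrable_const _) (h1.comp_fst _), integral_prod _ i2,
      integral_fun_fst (fun x => x), h2]
    simp only [integral_stepMeasure_phaseJump hc, integral_const, probReal_univ]
    simp
    ring

/-- Characteristic function of the phase after `k` steps. -/
def phaseChar (β θ : ℝ) (k : ℕ) (ν : ℝ) : ℂ :=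
  ∫ x, Complex.exp (Complex.I * ((ν * x : ℝ) : ℂ)) ∂phaseLaw β θ k

theorem phaseChar_succ {β θ : ℝ} (hβ : 0 < β) (k : ℕ) (ν : ℝ) :
    phaseChar β θ (k + 1) ν = Complex.exp (Complex.I * ((ν * θ : ℝ) : ℂ)) *
      ∫ x, Complex.exp (Complex.I * ((ν * x : ℝ) : ℂ)) *
        ∫ w, Complex.exp (Complex.I * ((ν * phaseJump x w : ℝ) : ℂ))
          ∂stepMeasure (((k + 1 : ℕ) : ℝ) * (β / 2)) ∂phaseLaw β θ k := by
  have := isProbabilityMeasure_phaseLaw hβ θ k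
  have := isProbabilityMeasure_stepMeasure (c := ((k + 1 : ℕ) : ℝ) * (β / 2)) (by positivity)
  rw [phaseChar, phaseLaw, integral_map (by fun_prop) (by fun_prop),
    integral_prod _ (integrable_exp_I_mul (by fun_prop)), ← integral_const_mul]
  refine integral_congr_ae (ae_of_all _ fun x => ?_)
  simp only
  rw [← integral_const_mul, ← integral_const_mul]
  refine integral_congr_ae (ae_of_all _ fun w => ?_)
  simp only
  rw [← Complex.exp_add, ← Complex.exp_add]
  congr 1
  push_cast
  ring

theorem norm_phaseChar_le {β θ : ℝ} (hβ : 0 < β) (k : ℕ) (ν : ℝ) : ‖phaseChar β θ k ν‖ ≤ 1 := by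
  have := isProbabilityMeasure_phaseLaw hβ θ k
  refine (norm_integral_le_of_norm_le_const (ae_of_all _ fun x =>
    (Complex.norm_exp_I_mul_ofReal _).le)).trans_eq (by simp)

theorem phaseChar_zero (β θ ν : ℝ) :
    phaseChar β θ 0 ν = Complex.exp (Complex.I * ((ν * θ : ℝ) : ℂ)) := by
  rw [phaseChar, phaseLaw, integral_dirac]

theorem one_sub_cos_le {x : ℝ} (hx : 0 ≤ x) : 1 - Real.cos x ≤ x := by
  rcases le_or_gt x 2 with h | h
  · have := Real.one_sub_sq_div_two_le_cos (x := x)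
    nlinarith
  · linarith [Real.neg_one_le_cos x]

theorem norm_phaseChar_succ_sub_le {β θ : ℝ} (hβ : 0 < β) (k : ℕ) (ν : ℝ) {g : ℝ → ℂ}
    (hg : Integrable (fun x => Complex.exp (Complex.I * ((ν * x : ℝ) : ℂ)) * g x) (phaseLaw β θ k))
    {h : ℝ → ℝ} (hh : Integrable h (phaseLaw β θ k))
    (hgh : ∀ᵐ x ∂phaseLaw β θ k, ‖∫ w, Complex.exp (Complex.I * ((ν * phaseJump x w : ℝ) : ℂ))
      ∂stepMeasure (((k + 1 : ℕ) : ℝ) * (β / 2)) - g x‖ ≤ h x) :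
    ‖phaseChar β θ (k + 1) ν - Complex.exp (Complex.I * ((ν * θ : ℝ) : ℂ)) *
      ∫ x, Complex.exp (Complex.I * ((ν * x : ℝ) : ℂ)) * g x ∂phaseLaw β θ k‖ ≤
    ∫ x, h x ∂phaseLaw β θ k := by
  have := isProbabilityMeasure_phaseLaw hβ θ k
  have := isProbabilityMeasure_stepMeasure (c := ((k + 1 : ℕ) : ℝ) * (β / 2)) (by positivity)
  have hi : Integrable (fun x => Complex.exp (Complex.I * ((ν * x : ℝ) : ℂ)) *
        ∫ w, Complex.exp (Complex.I * ((ν * phaseJump x w : ℝ) : ℂ))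
          ∂stepMeasure (((k + 1 : ℕ) : ℝ) * (β / 2))) (phaseLaw β θ k) := by
    simp only [← integral_const_mul, ← Complex.exp_add, ← mul_add, ← Complex.ofReal_add]
    exact (integrable_exp_I_mul
      (μ := (phaseLaw β θ k).prod (stepMeasure (((k + 1 : ℕ) : ℝ) * (β / 2))))
      (g := fun p => ν * (p.1 + phaseJump p.1 p.2)) (by fun_prop)).integral_prod_left
  rw [phaseChar_succ hβ, ← mul_sub, norm_mul, Complex.norm_exp_I_mul_ofReal, one_mul,
    ← integral_sub hi hg]
  refine norm_integral_le_of_norm_le hh (hgh.mono fun x hx => ?_)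
  rwa [← mul_sub, norm_mul, Complex.norm_exp_I_mul_ofReal, one_mul]

theorem norm_phaseChar_succ_sub_of_const {β θ : ℝ} (hβ : 0 < β) {k : ℕ} {ν δ : ℝ}
    (h : ∀ x, ‖∫ w, Complex.exp (Complex.I * ((ν * phaseJump x w : ℝ) : ℂ))
      ∂stepMeasure (((k + 1 : ℕ) : ℝ) * (β / 2)) - 1‖ ≤ δ) :
    ‖phaseChar β θ (k + 1) ν - Complex.exp (Complex.I * ((ν * θ : ℝ) : ℂ)) *
      phaseChar β θ k ν‖ ≤ δ := by
  have := isProbabilityMeasure_phaseLaw hβ θ k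
  have := norm_phaseChar_succ_sub_le (θ := θ) hβ k ν (g := fun _ => 1) (h := fun _ => δ)
    (by simpa only [mul_one] using integrable_exp_I_mul (by fun_prop)) (integrable_const _)
    (ae_of_all _ h)
  simpa [phaseChar] using this

theorem integral_exp_mul_one_sub_cos {β : ℝ} (hβ : 0 < β) (θ : ℝ) (k : ℕ) (ν a : ℝ) :
    Integrable (fun x => Complex.exp (Complex.I * ((ν * x : ℝ) : ℂ)) *
      ((1 - a * (1 - Real.cos x) : ℝ) : ℂ)) (phaseLaw β θ k) ∧
    ∫ x, Complex.exp (Complex.I * ((ν * x : ℝ) : ℂ)) * ((1 - a * (1 - Real.cos x) : ℝ) : ℂ)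
      ∂phaseLaw β θ k = (1 - a) * phaseChar β θ k ν +
        a / 2 * (phaseChar β θ k (ν + 1) + phaseChar β θ k (ν - 1)) := by
  have := isProbabilityMeasure_phaseLaw hβ θ k
  have h : ∀ x : ℝ, Complex.exp (Complex.I * ((ν * x : ℝ) : ℂ)) *
      ((1 - a * (1 - Real.cos x) : ℝ) : ℂ) =
      (1 - a) * Complex.exp (Complex.I * ((ν * x : ℝ) : ℂ)) +
        a / 2 * (Complex.exp (Complex.I * (((ν + 1) * x : ℝ) : ℂ)) +
          Complex.exp (Complex.I * (((ν - 1) * x : ℝ) : ℂ))) := fun x => by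
    have e1 : Complex.exp (Complex.I * (((ν + 1) * x : ℝ) : ℂ)) =
        Complex.exp (Complex.I * ((ν * x : ℝ) : ℂ)) * Complex.exp (x * Complex.I) := by
      rw [← Complex.exp_add]; congr 1; push_cast; ring
    have e2 : Complex.exp (Complex.I * (((ν - 1) * x : ℝ) : ℂ)) =
        Complex.exp (Complex.I * ((ν * x : ℝ) : ℂ)) * Complex.exp (-x * Complex.I) := by
      rw [← Complex.exp_add]; congr 1; push_cast; ring
    rw [e1, e2]
    push_cast
    rw [Complex.cos]
    ring
  have i0 : ∀ ν : ℝ, Integrable (fun x => Complex.exp (Complex.I * ((ν * x : ℝ) : ℂ)))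
    (phaseLaw β θ k) := fun ν => integrable_exp_I_mul (by fun_prop)
  simp only [h]
  have i1 := (i0 ν).const_mul (1 - a : ℂ)
  have i2 : Integrable (fun x => (a / 2 : ℂ) * (Complex.exp (Complex.I * (((ν + 1) * x : ℝ) : ℂ)) +
      Complex.exp (Complex.I * (((ν - 1) * x : ℝ) : ℂ)))) (phaseLaw β θ k) :=
    ((i0 (ν + 1)).add (i0 (ν - 1))).const_mul (a / 2 : ℂ)
  refine ⟨i1.add i2, ?_⟩
  rw [integral_add i1 i2, integral_const_mul, integral_const_mul]
  congr 2
  exact integral_add (i0 _) (i0 _)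

theorem one_div_mul_sqrt_le {k : ℝ} (hk : 1 ≤ k) :
    1 / (k * √k) ≤ 4 * (1 / √k - 1 / √(k + 1)) := by
  have hk0 : 0 < k := by linarith
  have h1 : 0 < √k := Real.sqrt_pos.2 hk0
  have h2 : √k ^ 2 = k := Real.sq_sqrt hk0.le
  have h3 : √(k + 1) ^ 2 = k + 1 := Real.sq_sqrt (by linarith)
  have h4 : 0 < √(k + 1) := Real.sqrt_pos.2 (by linarith)
  have h5 : √(k + 1) ≤ 3 / 2 * √k := by
    refine abs_le_of_sq_le_sq' ?_ (by positivity) |>.2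
    rw [mul_pow, h2, h3]; linarith
  generalize √k = a at *
  generalize √(k + 1) = b at *
  have h6 : 1 / a - 1 / b = 1 / (a * b * (a + b)) := by
    have h7 : (b - a) * (a + b) = 1 := by nlinarith
    field_simp
    linarith
  rw [h6, ← h2, mul_one_div, div_le_div_iff₀ (by positivity) (by positivity)]
  have : b * (a + b) ≤ 4 * a ^ 2 := by nlinarith
  nlinarith

theorem one_div_sq_le {k : ℝ} (hk : 1 ≤ k) : 1 / k ^ 2 ≤ 2 * (1 / k - 1 / (k + 1)) := by
  have : 1 / k - 1 / (k + 1) = 1 / (k * (k + 1)) := by field_simp; ring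
  rw [this, mul_one_div, div_le_div_iff₀ (by positivity) (by positivity)]
  nlinarith

theorem le_add_of_succ_le {f : ℕ → ℝ} {a b : ℝ} (ha : 0 ≤ a) (hb : 0 ≤ b) {m : ℕ} (hm : 1 ≤ m)
    (hf : ∀ k, m ≤ k → f (k + 1) ≤ f k + (a * (1 / (k * √k)) + b * (1 / (k : ℝ) ^ 2)))
    {n : ℕ} (hn : m ≤ n) : f n ≤ f m + (4 * a + 2 * b / m) := by
  have key : f n ≤ f m + (4 * a * (1 / √m - 1 / √n) + 2 * b * (1 / m - 1 / n)) := by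
    induction n, hn using Nat.le_induction with
    | base => simp
    | succ k hk ih =>
      have hk1 : (1 : ℝ) ≤ k := by exact_mod_cast hm.trans hk
      have h1 := mul_le_mul_of_nonneg_left (one_div_mul_sqrt_le hk1) ha
      have h2 := mul_le_mul_of_nonneg_left (one_div_sq_le hk1) hb
      have h3 := hf k hk
      push_cast
      linarith
  have hm1 : (1 : ℝ) ≤ m := by exact_mod_cast hm
  have h1 : 1 / √(m : ℝ) ≤ 1 := by
    rw [div_le_one (by positivity)]; exact Real.one_le_sqrt.2 hm1
  have h2 : 0 ≤ 1 / √(n : ℝ) := by positivity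
  have h3 : 0 ≤ 1 / (n : ℝ) := by positivity
  have h4 : 4 * a * (1 / √m - 1 / √n) ≤ 4 * a * 1 :=
    mul_le_mul_of_nonneg_left (by linarith) (by linarith)
  have h5 : 2 * b * (1 / (m : ℝ) - 1 / n) ≤ 2 * b * (1 / m) :=
    mul_le_mul_of_nonneg_left (by linarith) (by linarith)
  rw [mul_one_div] at h5
  linarith

theorem abs_exp_neg_mul_log_sub_one_le {t x : ℝ} (ht : 0 ≤ t) (hx : 1 ≤ x) :
    |Real.exp (-t * Real.log x) - 1| ≤ t * (x - 1) := by
  have h1 : Real.log x ≤ x - 1 := Real.log_le_sub_one_of_pos (by linarith)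
  have h2 : 0 ≤ Real.log x := Real.log_nonneg hx
  have h3 := Real.add_one_le_exp (-t * Real.log x)
  have h4 : Real.exp (-t * Real.log x) ≤ 1 := Real.exp_le_one_iff.2 (by nlinarith)
  rw [abs_of_nonpos (by linarith)]
  nlinarith

theorem abs_exp_neg_mul_log_succ_sub_le {t θ : ℝ} (ht : 0 ≤ t) (ht' : t ≤ 1 / 2)
    (hθ : θ ∈ Set.Ioc 0 Real.pi) {k : ℝ} (hk : 1 ≤ k) :
    |Real.exp (-t * Real.log (2 + (k + 1) * θ)) -
      (1 - t / k) * Real.exp (-t * Real.log (2 + k * θ))| ≤ 8 * t / θ * (1 / k ^ 2) := by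
  have hθ0 := hθ.1
  have hk0 : 0 < k := by linarith
  have hy : 0 < 2 + k * θ := by positivity
  obtain ⟨x, hx⟩ : ∃ x, θ / (2 + k * θ) = x := ⟨_, rfl⟩
  have hx0 : 0 ≤ x := by rw [← hx]; positivity
  have hxk : x ≤ 1 / k := by
    rw [← hx, div_le_div_iff₀ hy hk0]; nlinarith
  have hxk' : 1 / k - x ≤ 2 / θ * (1 / k ^ 2) := by
    have : 1 / k - x = 2 / (k * (2 + k * θ)) := by rw [← hx]; field_simp; ring
    rw [this, div_mul_div_comm, mul_one]
    exact div_le_div_of_nonneg_left (by norm_num) (by positivity) (by nlinarith)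
  have e1 : Real.log (2 + (k + 1) * θ) = Real.log (2 + k * θ) + Real.log (1 + x) := by
    rw [← Real.log_mul (by positivity) (by positivity), ← hx]
    congr 1
    field_simp
    ring
  obtain ⟨l, hl⟩ : ∃ l, Real.log (1 + x) = l := ⟨_, rfl⟩
  have hlx : l ≤ x := by
    have := Real.log_le_sub_one_of_pos (show 0 < 1 + x by linarith); linarith
  have hl0 : 0 ≤ l := by rw [← hl]; exact Real.log_nonneg (by linarith)
  have hlx' : x - x ^ 2 ≤ l := by
    have h1 := Real.one_sub_inv_le_log_of_pos (show 0 < 1 + x by linarith)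
    have h2 : 1 - (1 + x)⁻¹ - (x - x ^ 2) = x ^ 3 / (1 + x) := by field_simp; ring
    have h3 : 0 ≤ x ^ 3 / (1 + x) := by positivity
    linarith
  have hG : Real.exp (-t * Real.log (2 + k * θ)) ≤ 1 :=
    Real.exp_le_one_iff.2 (by
      have := Real.log_nonneg (show 1 ≤ 2 + k * θ by nlinarith)
      nlinarith)
  have hk2 : (1 / k) ^ 2 = 1 / k ^ 2 := by rw [div_pow, one_pow]
  have hkey : |Real.exp (-t * l) - (1 - t / k)| ≤ 8 * t / θ * (1 / k ^ 2) := by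
    have h1 := Real.add_one_le_exp (-t * l)
    have h2 : Real.exp (-t * l) ≤ 1 - t * l + (t * l) ^ 2 := by
      have h3 := Real.abs_exp_sub_one_sub_id_le (x := -t * l) (by
        have : x ≤ 1 := hxk.trans (by rw [div_le_one hk0]; exact hk)
        rw [abs_le]; constructor <;> nlinarith)
      have := (abs_le.1 h3).2
      nlinarith
    have h4 : 1 / k ^ 2 ≤ 4 / θ * (1 / k ^ 2) := by
      refine le_mul_of_one_le_left (by positivity) ?_
      rw [le_div_iff₀ hθ0]; linarith [hθ.2, Real.pi_le_four]
    have h5 : x ^ 2 ≤ 1 / k ^ 2 := by rw [← hk2]; gcongr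
    have h6 : l ^ 2 ≤ 1 / k ^ 2 := (pow_le_pow_left₀ hl0 hlx 2).trans h5
    have e2 : t / k = t * (1 / k) := by ring
    have e3 : 8 * t / θ * (1 / k ^ 2) = t * (8 * (1 / θ * (1 / k ^ 2))) := by ring
    have e4 : 4 / θ * (1 / k ^ 2) = 4 * (1 / θ * (1 / k ^ 2)) := by ring
    have e5 : 2 / θ * (1 / k ^ 2) = 2 * (1 / θ * (1 / k ^ 2)) := by ring
    have h7 : 0 ≤ 1 / θ * (1 / k ^ 2) := by positivity
    rw [e2, e3]
    rw [e4] at h4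
    rw [e5] at hxk'
    have h8 : (t * l) ^ 2 ≤ t * (2 * (1 / θ * (1 / k ^ 2))) := by
      have : t * (t * l ^ 2) ≤ t * (1 / 2 * (4 * (1 / θ * (1 / k ^ 2)))) := by
        gcongr
        linarith
      linarith
    have h9 : t * (1 / k - l) ≤ t * (6 * (1 / θ * (1 / k ^ 2))) :=
      mul_le_mul_of_nonneg_left (by linarith) ht
    have h10 : 0 ≤ t * (1 / k - l) := mul_nonneg ht (by linarith)
    rw [abs_le]
    constructor <;> nlinarith
  rw [e1, hl, mul_add, Real.exp_add, mul_comm (1 - t / k), ← mul_sub, abs_mul, Real.abs_exp]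
  exact (mul_le_of_le_one_left (abs_nonneg _) hG).trans hkey

theorem le_norm_exp_I_mul_sub_one {θ : ℝ} (hθ : θ ∈ Set.Ioc 0 Real.pi) :
    θ / 2 ≤ ‖Complex.exp (Complex.I * θ) - 1‖ := by
  rw [Complex.norm_exp_I_mul_ofReal_sub_one, Real.norm_eq_abs,
    abs_of_nonneg (mul_nonneg (by norm_num) (Real.sin_nonneg_of_nonneg_of_le_pi
      (by linarith [hθ.1]) (by linarith [hθ.2, Real.pi_pos])))]
  have h1 := Real.mul_le_sin (x := θ / 2) (by linarith [hθ.1]) (by linarith [hθ.2])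
  have h2 : 1 / 2 ≤ 2 / Real.pi := by
    rw [div_le_div_iff₀ (by norm_num) Real.pi_pos]; linarith [Real.pi_le_four]
  nlinarith [hθ.1]

/-- A slowly decaying sequence driven by two rotating sequences behaves like a power law. -/
theorem norm_sub_exp_neg_mul_log_le {A P Q : ℕ → ℂ} {t R S θ : ℝ} {u : ℂ} (ht : 0 ≤ t)
    (ht' : t ≤ 1 / 2) (hR : 0 ≤ R) (hS : 0 ≤ S) (hθ : θ ∈ Set.Ioc 0 Real.pi)
    (hu : u = Complex.exp (Complex.I * θ)) (hA1 : A 1 = 1)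
    (hP : ∀ k, ‖P k‖ ≤ 1) (hQ : ∀ k, ‖Q k‖ ≤ 1)
    (hA : ∀ k : ℕ, 1 ≤ k → ‖A (k + 1) - ((1 - t / k) * A k + t / (2 * k) * (P k + Q k))‖ ≤
      R * (1 / (k * √k)))
    (hP' : ∀ k : ℕ, 1 ≤ k → ‖P (k + 1) - u * P k‖ ≤ S / k)
    (hQ' : ∀ k : ℕ, 1 ≤ k → ‖Q (k + 1) - u⁻¹ * Q k‖ ≤ S / k)
    (hA' : ∀ k : ℕ, 1 ≤ k → ‖A (k + 1) - A k‖ ≤ t * θ + R * (1 / (k * √k)))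
    {n : ℕ} (hn : 1 ≤ n) :
    ‖A n - (Real.exp (-t * Real.log (2 + n * θ)) : ℝ)‖ ≤ (40 + 4 * S) * (t + R) := by
  have hθ0 := hθ.1
  have hθ4 : θ ≤ 4 := hθ.2.trans Real.pi_le_four
  have early : ∀ n : ℕ, 1 ≤ n → n * θ ≤ 1 + θ →
      ‖A n - (Real.exp (-t * Real.log (2 + n * θ)) : ℝ)‖ ≤ 12 * t + 4 * R := by
    intro n hn hnθ
    have h1 := le_add_of_succ_le (f := fun k => ‖A k - 1‖ - t * θ * k) (a := R) (b := 0)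
      hR le_rfl le_rfl (fun k hk => by
        have := norm_sub_le_norm_sub_add_norm_sub (A (k + 1)) (A k) 1
        have := hA' k hk
        push_cast
        linarith) hn
    have h2 := abs_exp_neg_mul_log_sub_one_le ht (show 1 ≤ 2 + n * θ by nlinarith)
    have h3 := norm_sub_le_norm_sub_add_norm_sub (A n) 1
      ((Real.exp (-t * Real.log (2 + n * θ)) : ℝ) : ℂ)
    rw [norm_sub_rev 1, ← Complex.ofReal_one, ← Complex.ofReal_sub, Complex.norm_real,
      Real.norm_eq_abs, Complex.ofReal_one] at h3
    simp only [hA1] at h1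
    simp at h1
    have h4 : t * (n * θ) ≤ t * 5 := mul_le_mul_of_nonneg_left (by linarith) ht
    have h5 : 0 ≤ t * θ := by positivity
    linarith
  obtain ⟨K, hK⟩ : ∃ K : ℕ, ⌈1 / θ⌉₊ = K := ⟨_, rfl⟩
  have hK1 : 1 ≤ K := by rw [← hK, Nat.one_le_ceil_iff]; positivity
  have hKθ : 1 ≤ K * θ := by
    have := Nat.le_ceil (1 / θ); rw [hK, div_le_iff₀ hθ0] at this; exact this
  have hKθ' : K * θ ≤ 1 + θ := by
    have := (Nat.ceil_lt_add_one (show 0 ≤ 1 / θ by positivity)).le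
    rw [hK] at this
    have := mul_le_mul_of_nonneg_right this hθ0.le
    rwa [add_mul, one_div, inv_mul_cancel₀ hθ0.ne', one_mul] at this
  rcases le_total n K with hnK | hnK
  · have h1 : (n : ℝ) * θ ≤ K * θ := by gcongr
    have h2 := early n hn (h1.trans hKθ')
    nlinarith [mul_nonneg hS (add_nonneg ht hR)]
  have hu1 : ‖u‖ = 1 := by rw [hu, Complex.norm_exp_I_mul_ofReal]
  have hu0 : u ≠ 0 := by rw [hu]; exact Complex.exp_ne_zero _
  have hu2 : θ / 2 ≤ ‖u - 1‖ := by rw [hu]; exact le_norm_exp_I_mul_sub_one hθ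
  have hu3 : θ / 2 ≤ ‖u⁻¹ - 1‖ := by
    have : u⁻¹ - 1 = -(u⁻¹ * (u - 1)) := by field_simp; ring
    rwa [this, norm_neg, norm_mul, norm_inv, hu1, inv_one, one_mul]
  obtain ⟨p, hp⟩ : ∃ p, (u - 1)⁻¹ = p := ⟨_, rfl⟩
  obtain ⟨q, hq⟩ : ∃ q, (u⁻¹ - 1)⁻¹ = q := ⟨_, rfl⟩
  have hpu : p * (u - 1) = 1 := by
    rw [← hp]; exact inv_mul_cancel₀ (norm_pos_iff.1 (by linarith))
  have hqu : q * (u⁻¹ - 1) = 1 := by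
    rw [← hq]; exact inv_mul_cancel₀ (norm_pos_iff.1 (by linarith))
  have hp2 : ‖p‖ ≤ 2 / θ := by
    rw [← hp, norm_inv, ← inv_div]; exact inv_anti₀ (by positivity) hu2
  have hq2 : ‖q‖ ≤ 2 / θ := by
    rw [← hq, norm_inv, ← inv_div]; exact inv_anti₀ (by positivity) hu3
  have hPQ : ∀ k, ‖p * P k + q * Q k‖ ≤ 4 / θ := fun k => by
    refine (norm_add_le _ _).trans ?_
    rw [norm_mul, norm_mul]
    have h1 := mul_le_mul hp2 (hP k) (norm_nonneg _) (by positivity)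
    have h2 := mul_le_mul hq2 (hQ k) (norm_nonneg _) (by positivity)
    have : 4 / θ = 2 / θ + 2 / θ := by ring
    linarith
  obtain ⟨D, hD⟩ : ∃ D : ℕ → ℂ, D = fun k : ℕ => A k - t / (2 * k) * (p * P k + q * Q k) :=
    ⟨_, rfl⟩
  obtain ⟨G, hG⟩ : ∃ G : ℕ → ℝ, G = fun k : ℕ => Real.exp (-t * Real.log (2 + k * θ)) := ⟨_, rfl⟩
  have hDA : ∀ k : ℕ, K ≤ k → ‖A k - D k‖ ≤ 2 * t := fun k hk => by
    have hk1 : (1 : ℝ) ≤ k := by exact_mod_cast hK1.trans hk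
    have hkθ : 1 ≤ k * θ := hKθ.trans (by gcongr)
    rw [hD]
    simp only [sub_sub_cancel]
    have e : ((t : ℂ) / (2 * k)) = ((t / (2 * k) : ℝ) : ℂ) := by push_cast; ring
    rw [norm_mul, e, Complex.norm_real, Real.norm_eq_abs, abs_of_nonneg (by positivity)]
    refine (mul_le_mul_of_nonneg_left (hPQ k) (by positivity)).trans ?_
    rw [div_mul_div_comm, div_le_iff₀ (by positivity)]
    nlinarith
  have hDs : ∀ k : ℕ, 1 ≤ k → ‖D (k + 1) - (1 - t / k) * D k‖ ≤
      R * (1 / (k * √k)) + (2 * S + 3) * t / θ * (1 / (k : ℝ) ^ 2) := fun k hk => by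
    have hk1 : (1 : ℝ) ≤ k := by exact_mod_cast hk
    have hkc : (k : ℂ) ≠ 0 := by exact_mod_cast (show k ≠ 0 by omega)
    have hkc' : (k : ℂ) + 1 ≠ 0 := by exact_mod_cast (show k + 1 ≠ 0 by omega)
    have e : D (k + 1) - (1 - t / k) * D k =
        (A (k + 1) - ((1 - t / k) * A k + t / (2 * k) * (P k + Q k))) -
        ((t / (2 * k) : ℝ) : ℂ) * (p * (P (k + 1) - u * P k) + q * (Q (k + 1) - u⁻¹ * Q k)) +
        ((t / (2 * k * (k + 1)) : ℝ) : ℂ) * (p * P (k + 1) + q * Q (k + 1)) -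
        ((t ^ 2 / (2 * k ^ 2) : ℝ) : ℂ) * (p * P k + q * Q k) := by
      have e1 : p * (P (k + 1) - u * P k) = p * P (k + 1) - p * P k - P k := by
        linear_combination (-P k) * hpu
      have e2 : q * (Q (k + 1) - u⁻¹ * Q k) = q * Q (k + 1) - q * Q k - Q k := by
        linear_combination (-Q k) * hqu
      rw [e1, e2, hD]
      push_cast
      field_simp
      ring
    have b1 : ‖p * (P (k + 1) - u * P k) + q * (Q (k + 1) - u⁻¹ * Q k)‖ ≤ 4 / θ * (S / k) := by
      refine (norm_add_le _ _).trans ?_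
      rw [norm_mul, norm_mul]
      have h1 := mul_le_mul hp2 (hP' k hk) (norm_nonneg _) (by positivity)
      have h2 := mul_le_mul hq2 (hQ' k hk) (norm_nonneg _) (by positivity)
      have : 4 / θ * (S / k) = 2 / θ * (S / k) + 2 / θ * (S / k) := by ring
      linarith
    have nr : ∀ {r b : ℝ} {z : ℂ}, 0 ≤ r → ‖z‖ ≤ b → ‖(r : ℂ) * z‖ ≤ r * b := fun hr hz => by
      rw [norm_mul, Complex.norm_real, Real.norm_eq_abs, abs_of_nonneg hr]
      gcongr
    have c1 := nr (show 0 ≤ t / (2 * k) by positivity) b1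
    have c2 := nr (show 0 ≤ t / (2 * k * (k + 1)) by positivity) (hPQ (k + 1))
    have c3 := nr (show 0 ≤ t ^ 2 / (2 * (k : ℝ) ^ 2) by positivity) (hPQ k)
    have d2 : t / (2 * k * (k + 1)) * (4 / θ) ≤ 2 * (t / θ * (1 / (k : ℝ) ^ 2)) := by
      have : t / (2 * k * (k + 1)) ≤ t / (2 * k * k) := by gcongr; linarith
      refine (mul_le_mul_of_nonneg_right this (by positivity)).trans_eq ?_
      field_simp
      ring
    have d1 : t / (2 * k) * (4 / θ * (S / k)) = 2 * S * (t / θ * (1 / (k : ℝ) ^ 2)) := by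
      field_simp
      ring
    have d3 : t ^ 2 / (2 * (k : ℝ) ^ 2) * (4 / θ) ≤ 1 * (t / θ * (1 / (k : ℝ) ^ 2)) := by
      have : t ^ 2 / (2 * (k : ℝ) ^ 2) * (4 / θ) = 2 * t * (t / θ * (1 / (k : ℝ) ^ 2)) := by
        field_simp
        ring
      rw [this]
      gcongr
      linarith
    have e3 : (2 * S + 3) * t / θ * (1 / (k : ℝ) ^ 2) =
        (2 * S + 3) * (t / θ * (1 / (k : ℝ) ^ 2)) := by ring
    rw [e, e3]
    refine (norm_sub_le _ _).trans ?_
    refine (add_le_add_left ((norm_add_le _ _).trans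
      (add_le_add_left (norm_sub_le _ _) _)) _).trans ?_
    have := hA k hk
    linarith
  have late := le_add_of_succ_le (f := fun k => ‖D k - G k‖) (a := R)
    (b := (2 * S + 11) * t / θ) hR (by positivity) hK1 (fun k hk => by
      have hk1 : (1 : ℝ) ≤ k := by exact_mod_cast hK1.trans hk
      have h1 := hDs k (hK1.trans hk)
      have h2 := abs_exp_neg_mul_log_succ_sub_le ht ht' hθ hk1
      have h3 : ‖((G (k + 1) - (1 - t / k) * G k : ℝ) : ℂ)‖ ≤ 8 * t / θ * (1 / (k : ℝ) ^ 2) := by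
        rw [Complex.norm_real, Real.norm_eq_abs, hG]
        push_cast
        exact h2
      have e : D (k + 1) - G (k + 1) = (D (k + 1) - (1 - t / k) * D k) -
          ((G (k + 1) - (1 - t / k) * G k : ℝ) : ℂ) + ((1 - t / k : ℝ) : ℂ) * (D k - G k) := by
        push_cast
        ring
      have h4 : ‖((1 - t / k : ℝ) : ℂ) * (D k - G k)‖ ≤ 1 * ‖D k - G k‖ := by
        rw [norm_mul, Complex.norm_real, Real.norm_eq_abs]
        gcongr
        have : t / k ≤ t := div_le_self ht hk1
        have : 0 ≤ t / k := by positivity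
        rw [abs_le]
        constructor <;> linarith
      have h5 := (norm_add_le ((D (k + 1) - (1 - t / k) * D k) -
          ((G (k + 1) - (1 - t / k) * G k : ℝ) : ℂ)) (((1 - t / k : ℝ) : ℂ) * (D k - G k))).trans
        (add_le_add_left (norm_sub_le _ _) _)
      have e3 : (2 * S + 11) * t / θ * (1 / (k : ℝ) ^ 2) = (2 * S + 3) * t / θ * (1 / (k : ℝ) ^ 2) +
        8 * t / θ * (1 / (k : ℝ) ^ 2) := by ring
      rw [← e] at h5
      rw [e3]
      linarith) hnK
  have h1 := early K hK1 hKθ'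
  have h2 : ‖D K - G K‖ ≤ ‖A K - D K‖ + ‖A K - G K‖ := by
    rw [norm_sub_rev (A K) (D K)]; exact norm_sub_le_norm_sub_add_norm_sub _ _ _
  have h3 := norm_sub_le_norm_sub_add_norm_sub (A n) (D n) (G n)
  have h4 := hDA n hnK
  have h5 := hDA K le_rfl
  have h6 : 2 * ((2 * S + 11) * t / θ) / K ≤ (4 * S + 22) * t := by
    have : 2 * ((2 * S + 11) * t / θ) / K = (4 * S + 22) * t / (K * θ) := by field_simp; ring
    rw [this]
    exact div_le_self (by positivity) hKθ
  rw [hG] at h2 h3 late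
  simp only at h2 h3 late
  have h7 := mul_nonneg hS hR
  nlinarith

theorem exists_norm_phaseChar_sub_le {β : ℝ} (hβ : 0 < β) :
    ∃ C > 0, ∀ μ : ℝ, |μ| ≤ √(β / 8) → ∀ θ ∈ Set.Ioc 0 Real.pi, ∀ k : ℕ,
      ‖Complex.exp (-(Complex.I * ((μ * ((k + 1 : ℕ) * θ) : ℝ) : ℂ))) * phaseChar β θ k μ -
        (Real.exp (-(4 * μ ^ 2 / β) * Real.log (2 + (k + 1 : ℕ) * θ)) : ℝ)‖ ≤ C * μ ^ 2 := by
  obtain ⟨S, hS, hS'⟩ := exists_norm_integral_exp_sub_one_le hβ (√(β / 8) + 1)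
  obtain ⟨R, hR, hR'⟩ := exists_norm_integral_exp_sub_le hβ (√(β / 8) + 1) (by positivity)
  refine ⟨(40 + 4 * S) * (4 / β + R), by positivity, fun μ hμ θ hθ k => ?_⟩
  have hμ1 : |μ| ≤ √(β / 8) + 1 := by linarith
  have hμ2 : |μ + 1| ≤ √(β / 8) + 1 := by
    have := abs_add_le μ 1; rw [abs_one] at this; linarith
  have hμ3 : |μ - 1| ≤ √(β / 8) + 1 := by
    have := abs_sub μ 1; rw [abs_one] at this; linarith
  have ht : 4 * μ ^ 2 / β ≤ 1 / 2 := by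
    have h1 : μ ^ 2 ≤ β / 8 := by
      rw [← sq_abs, ← Real.sq_sqrt (show 0 ≤ β / 8 by positivity)]
      gcongr
    rw [div_le_iff₀ hβ]
    linarith
  have hn : ∀ (x : ℝ) (z : ℂ), ‖Complex.exp (-(Complex.I * (x : ℂ))) * z‖ = ‖z‖ := fun x z => by
    rw [norm_mul, ← mul_neg, ← Complex.ofReal_neg, Complex.norm_exp_I_mul_ofReal, one_mul]
  have hrot : ∀ (j : ℕ) (ν b : ℝ), ν - b = μ →
      ∀ w z : ℂ, Complex.exp (-(Complex.I * ((μ * ((j + 1 + 1 : ℕ) * θ) : ℝ) : ℂ))) * w -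
        Complex.exp (Complex.I * ((b * θ : ℝ) : ℂ)) *
          (Complex.exp (-(Complex.I * ((μ * ((j + 1 : ℕ) * θ) : ℝ) : ℂ))) * z) =
        Complex.exp (-(Complex.I * ((μ * ((j + 1 + 1 : ℕ) * θ) : ℝ) : ℂ))) *
          (w - Complex.exp (Complex.I * ((ν * θ : ℝ) : ℂ)) * z) := fun j ν b hb w z => by
    have e : Complex.exp (-(Complex.I * ((μ * ((j + 1 + 1 : ℕ) * θ) : ℝ) : ℂ))) *
        Complex.exp (Complex.I * ((ν * θ : ℝ) : ℂ)) = Complex.exp (Complex.I * ((b * θ : ℝ) : ℂ)) *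
          Complex.exp (-(Complex.I * ((μ * ((j + 1 : ℕ) * θ) : ℝ) : ℂ))) := by
      rw [← Complex.exp_add, ← Complex.exp_add, ← hb]
      congr 1
      push_cast
      ring
    linear_combination z * e
  have hmain := norm_sub_exp_neg_mul_log_le
    (A := fun n => Complex.exp (-(Complex.I * ((μ * (n * θ) : ℝ) : ℂ))) * phaseChar β θ (n - 1) μ)
    (P := fun n => Complex.exp (-(Complex.I * ((μ * (n * θ) : ℝ) : ℂ))) *
      phaseChar β θ (n - 1) (μ + 1))
    (Q := fun n => Complex.exp (-(Complex.I * ((μ * (n * θ) : ℝ) : ℂ))) *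
      phaseChar β θ (n - 1) (μ - 1))
    (t := 4 * μ ^ 2 / β) (R := R * μ ^ 2) (S := S) (u := Complex.exp (Complex.I * θ))
    (by positivity) ht (by positivity) hS.le hθ rfl ?_ ?_ ?_ ?_ ?_ ?_ ?_
    (show 1 ≤ k + 1 by omega)
  · simp only [Nat.add_sub_cancel] at hmain
    refine hmain.trans_eq ?_
    ring
  · simp only [Nat.sub_self, Nat.cast_one, one_mul]
    rw [phaseChar_zero, ← Complex.exp_add, neg_add_cancel, Complex.exp_zero]
  · intro n; rw [hn]; exact norm_phaseChar_le hβ _ _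
  · intro n; rw [hn]; exact norm_phaseChar_le hβ _ _
  · rintro n hn1
    obtain ⟨j, rfl⟩ := Nat.exists_eq_add_of_le' hn1
    simp only [Nat.add_sub_cancel]
    have := isProbabilityMeasure_phaseLaw hβ θ j
    obtain ⟨h1, h2⟩ := integral_exp_mul_one_sub_cos hβ θ j μ (4 * μ ^ 2 / β / (j + 1 : ℕ))
    have h3 := norm_phaseChar_succ_sub_le hβ j μ h1 (integrable_const _)
      (ae_of_all _ fun x => hR' μ hμ1 (j + 1) x (by omega))
    rw [h2, ← hn (μ * ((j + 1 + 1 : ℕ) * θ)), ← hrot j μ 0 (by ring), integral_const,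
      probReal_univ, one_smul] at h3
    refine (le_of_eq ?_).trans (h3.trans_eq (by ring))
    congr 2
    push_cast
    rw [zero_mul, mul_zero, Complex.exp_zero]
    simp only [div_eq_mul_inv, mul_inv]
    ring
  · rintro n hn1
    obtain ⟨j, rfl⟩ := Nat.exists_eq_add_of_le' hn1
    simp only [Nat.add_sub_cancel]
    have h3 := norm_phaseChar_succ_sub_of_const (θ := θ) hβ
      (fun x => hS' (μ + 1) hμ2 (j + 1) x (by omega))
    rwa [← hn (μ * ((j + 1 + 1 : ℕ) * θ)), ← hrot j (μ + 1) 1 (by ring), one_mul] at h3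
  · rintro n hn1
    obtain ⟨j, rfl⟩ := Nat.exists_eq_add_of_le' hn1
    simp only [Nat.add_sub_cancel]
    have h3 := norm_phaseChar_succ_sub_of_const (θ := θ) hβ
      (fun x => hS' (μ - 1) hμ3 (j + 1) x (by omega))
    rw [← hn (μ * ((j + 1 + 1 : ℕ) * θ)), ← hrot j (μ - 1) (-1) (by ring), neg_one_mul,
      Complex.ofReal_neg, mul_neg,
      Complex.exp_neg (Complex.I * (θ : ℂ))] at h3
    exact h3
  · rintro n hn1
    obtain ⟨j, rfl⟩ := Nat.exists_eq_add_of_le' hn1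
    simp only [Nat.add_sub_cancel]
    have := isProbabilityMeasure_phaseLaw hβ θ j
    obtain ⟨i1, i2⟩ := integral_phaseLaw (θ := θ) hβ j
    obtain ⟨a, ha⟩ : ∃ a, 4 * μ ^ 2 / β / (j + 1 : ℕ) = a := ⟨_, rfl⟩
    have ha0 : 0 ≤ a := by rw [← ha]; positivity
    obtain ⟨r, hr⟩ : ∃ r, R * μ ^ 2 / (((j + 1 : ℕ) : ℝ) * √((j + 1 : ℕ) : ℝ)) = r := ⟨_, rfl⟩
    have h3 := norm_phaseChar_succ_sub_le hβ j μ (g := fun _ => 1) (h := fun x => a * x + r)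
      (by simpa only [mul_one] using integrable_exp_I_mul (by fun_prop))
      ((i1.const_mul a).add (integrable_const r))
      ((ae_phaseLaw_nonneg β hθ.1.le j).mono fun x hx => by
        have h4 := hR' μ hμ1 (j + 1) x (by omega)
        rw [ha, hr] at h4
        have h5 : ‖((1 - a * (1 - Real.cos x) : ℝ) : ℂ) - 1‖ ≤ a * x := by
          rw [← Complex.ofReal_one, ← Complex.ofReal_sub, Complex.norm_real, Real.norm_eq_abs,
            sub_sub_cancel_left, abs_neg, abs_of_nonneg
              (mul_nonneg ha0 (by linarith [Real.cos_le_one x]))]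
          exact mul_le_mul_of_nonneg_left (one_sub_cos_le hx) ha0
        refine (norm_sub_le_norm_sub_add_norm_sub _
          ((1 - a * (1 - Real.cos x) : ℝ) : ℂ) _).trans ?_
        linarith)
    rw [integral_add (f := fun x => a * x) (i1.const_mul a) (integrable_const r),
      integral_const_mul, i2, integral_const, probReal_univ, one_smul] at h3
    simp only [mul_one] at h3
    rw [← phaseChar, ← hn (μ * ((j + 1 + 1 : ℕ) * θ)), ← hrot j μ 0 (by ring), zero_mul,
      Complex.ofReal_zero, mul_zero, Complex.exp_zero, one_mul] at h3
    refine h3.trans_eq ?_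
    rw [← hr, ← ha]
    push_cast
    field_simp

theorem integral_windingNumber_sub (x : ℝ) :
    ∫ s, (windingNumber s x - x / (2 * Real.pi)) ∂uniformPhase = 0 ∧
      ∀ᵐ s ∂uniformPhase, |windingNumber s x - x / (2 * Real.pi)| ≤ 1 := by
  have hpi := Real.pi_pos
  have hw : ∀ x : ℝ, ∀ᵐ s ∂uniformPhase, windingNumber s x - x / (2 * Real.pi) =
      (s + Real.pi) / (2 * Real.pi) - Int.fract ((s + x + Real.pi) / (2 * Real.pi)) := fun x => by
    filter_upwards [ae_mem_Ioo_uniformPhase] with s hs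
    rw [windingNumber_eq_floor hs, Int.fract]
    field_simp
    ring
  have hb : ∀ᵐ s ∂uniformPhase, (s + Real.pi) / (2 * Real.pi) ∈ Set.Icc (0 : ℝ) 1 := by
    filter_upwards [ae_mem_Ioo_uniformPhase] with s hs
    exact ⟨div_nonneg (by linarith [hs.1]) (by positivity),
      (div_le_one (by positivity)).2 (by linarith [hs.2])⟩
  have hmf : ∀ x : ℝ, Integrable (fun s => Int.fract ((s + x + Real.pi) / (2 * Real.pi)))
      uniformPhase := fun x =>
    Integrable.of_bound (measurable_fract.comp (by fun_prop)).aestronglyMeasurable 1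
      (ae_of_all _ fun s => by
        rw [Real.norm_eq_abs, abs_of_nonneg (Int.fract_nonneg _)]
        exact (Int.fract_lt_one _).le)
  have hml : Integrable (fun s => (s + Real.pi) / (2 * Real.pi)) uniformPhase :=
    Integrable.of_bound (Measurable.aestronglyMeasurable (by fun_prop)) 1
      (hb.mono fun s hs => by rw [Real.norm_eq_abs, abs_of_nonneg hs.1]; exact hs.2)
  refine ⟨?_, ?_⟩
  · have hshift : ∫ s, Int.fract ((s + x + Real.pi) / (2 * Real.pi)) ∂uniformPhase =
        ∫ s, Int.fract ((s + Real.pi) / (2 * Real.pi)) ∂uniformPhase :=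
      integral_uniformPhase_shift (f := fun s => Int.fract ((s + Real.pi) / (2 * Real.pi)))
        (fun s => by
          have : (s + 2 * Real.pi + Real.pi) / (2 * Real.pi) =
              (s + Real.pi) / (2 * Real.pi) + 1 := by
            field_simp
            ring
          simp only [this, Int.fract_add_one]) x
    rw [integral_congr_ae (hw x), integral_sub hml (hmf x), hshift,
      ← integral_sub hml (by simpa using hmf 0)]
    refine integral_eq_zero_of_ae ?_
    filter_upwards [hw 0] with s hs
    rw [add_zero] at hs
    rw [← hs]
    simp [windingNumber]
  · filter_upwards [hw x, hb] with s hs hs'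
    rw [hs, abs_le]
    have h1 := Int.fract_nonneg ((s + x + Real.pi) / (2 * Real.pi))
    have h2 := (Int.fract_lt_one ((s + x + Real.pi) / (2 * Real.pi))).le
    constructor <;> linarith [hs'.1, hs'.2]

theorem norm_integral_exp_windingNumber_sub_one_le {c l : ℝ} (hl : |l| ≤ c) (x : ℝ) :
    ‖∫ s, Complex.exp (Complex.I * ((l * (windingNumber s x - x / (2 * Real.pi)) : ℝ) : ℂ))
      ∂uniformPhase - 1‖ ≤ Real.exp c * l ^ 2 := by
  obtain ⟨h1, h2⟩ := integral_windingNumber_sub x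
  have i1 : Integrable (fun s => Complex.exp (Complex.I *
      ((l * (windingNumber s x - x / (2 * Real.pi)) : ℝ) : ℂ))) uniformPhase :=
    integrable_exp_I_mul (by fun_prop)
  have i2 : Integrable (fun s => ((l * (windingNumber s x - x / (2 * Real.pi)) : ℝ) : ℂ))
      uniformPhase := by
    refine Integrable.ofReal (Integrable.const_mul ?_ l)
    exact Integrable.of_bound (Measurable.aestronglyMeasurable (by fun_prop)) 1 h2
  have e : ∫ s, Complex.exp (Complex.I * ((l * (windingNumber s x - x / (2 * Real.pi)) : ℝ) : ℂ))
      ∂uniformPhase - 1 = ∫ s, (Complex.exp (Complex.I *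
        ((l * (windingNumber s x - x / (2 * Real.pi)) : ℝ) : ℂ)) - 1 - Complex.I *
          ((l * (windingNumber s x - x / (2 * Real.pi)) : ℝ) : ℂ)) ∂uniformPhase := by
    rw [integral_sub (f := fun s => Complex.exp (Complex.I *
        ((l * (windingNumber s x - x / (2 * Real.pi)) : ℝ) : ℂ)) - 1)
        (i1.sub (integrable_const _)) (i2.const_mul _), integral_sub i1 (integrable_const _),
      integral_const_mul, integral_complex_ofReal, integral_const_mul, h1]
    simp
  rw [e]
  refine (norm_integral_le_of_norm_le_const (h2.mono fun s hs => ?_)).trans_eq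
    (by rw [probReal_univ, mul_one])
  refine (norm_exp_I_mul_sub_le _).trans ?_
  rw [abs_mul, mul_comm (Real.exp c), mul_pow]
  have h3 : (windingNumber s x - x / (2 * Real.pi)) ^ 2 ≤ 1 := by
    rw [← sq_abs]; exact pow_le_one₀ (abs_nonneg _) hs
  have h4 : |l| * |windingNumber s x - x / (2 * Real.pi)| ≤ c :=
    (mul_le_of_le_one_right (abs_nonneg _) hs).trans hl
  gcongr
  exact mul_le_of_le_one_right (sq_nonneg _) h3

theorem norm_integral_exp_countIn_sub_le {β θ c l : ℝ} (hβ : 0 < β) (hθ : θ ∈ Set.Ioc 0 Real.pi)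
    (hl : |l| ≤ c) (k : ℕ) (b : ℝ) :
    ‖∫ y, Complex.exp (Complex.I * ((l * ((countIn 0 θ y : ℝ) - b) : ℝ) : ℂ)) ∂cbe β (k + 1) -
      Complex.exp (-(Complex.I * ((l * b : ℝ) : ℂ))) * phaseChar β θ k (l / (2 * Real.pi))‖ ≤
    Real.exp c * l ^ 2 := by
  have := isProbabilityMeasure_phaseLaw hβ θ k
  have hpi := Real.pi_pos
  have e1 : ∫ y, Complex.exp (Complex.I * ((l * ((countIn 0 θ y : ℝ) - b) : ℝ) : ℂ))
      ∂cbe β (k + 1) = ∫ x, ∫ s, Complex.exp (Complex.I * ((l * (windingNumber s x - b) : ℝ) : ℂ))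
        ∂uniformPhase ∂phaseLaw β θ k := by
    rw [← integral_map (φ := fun y => (countIn 0 θ y : ℝ))
      (f := fun z : ℝ => Complex.exp (Complex.I * ((l * (z - b) : ℝ) : ℂ)))
      (measurable_countIn θ).aemeasurable (by fun_prop), map_countIn hβ hθ,
      integral_map (by fun_prop) (by fun_prop),
      integral_prod _ (integrable_exp_I_mul (by fun_prop))]
  have e2 : Complex.exp (-(Complex.I * ((l * b : ℝ) : ℂ))) * phaseChar β θ k (l / (2 * Real.pi)) =
      ∫ x, Complex.exp (Complex.I * ((l * (x / (2 * Real.pi) - b) : ℝ) : ℂ)) ∂phaseLaw β θ k := by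
    rw [phaseChar, ← integral_const_mul]
    refine integral_congr_ae (ae_of_all _ fun x => ?_)
    simp only
    rw [← Complex.exp_add]
    congr 1
    push_cast
    ring
  have i1 : Integrable (fun x => ∫ s, Complex.exp (Complex.I *
      ((l * (windingNumber s x - b) : ℝ) : ℂ)) ∂uniformPhase) (phaseLaw β θ k) :=
    (integrable_exp_I_mul (μ := (phaseLaw β θ k).prod uniformPhase)
      (g := fun p => l * (windingNumber p.2 p.1 - b)) (by fun_prop)).integral_prod_left
  rw [e1, e2, ← integral_sub i1 (integrable_exp_I_mul (by fun_prop))]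
  refine (norm_integral_le_of_norm_le_const (ae_of_all _ fun x => ?_)).trans_eq
    (by rw [probReal_univ, mul_one])
  have e3 : ∀ s, Complex.exp (Complex.I * ((l * (windingNumber s x - b) : ℝ) : ℂ)) =
      Complex.exp (Complex.I * ((l * (x / (2 * Real.pi) - b) : ℝ) : ℂ)) *
        Complex.exp (Complex.I * ((l * (windingNumber s x - x / (2 * Real.pi)) : ℝ) : ℂ)) :=
    fun s => by
      rw [← Complex.exp_add]
      congr 1
      push_cast
      ring
  simp only [e3]
  rw [integral_const_mul, ← mul_sub_one, norm_mul, Complex.norm_exp_I_mul_ofReal, one_mul]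
  exact norm_integral_exp_windingNumber_sub_one_le hl x

end

end CircularBeta

/-- Estimate for the characteristic function of the counting function of the CβE:
`|E[e^{iλ(N_n(0,θ) − nθ/(2π))}] − e^{−(λ²/(βπ²)) ln(2+nθ)}| ≤ Cλ²`
for `θ ∈ (0,π]` and `|λ| ≤ 2π√(β/8)`, with `C` depending only on `β`. -/
theorem counting_char_estimate (β : ℝ) (hβ : 0 < β) :
    ∃ C > 0, ∀ n : ℕ, 1 ≤ n → ∀ θ ∈ Set.Ioc (0:ℝ) Real.pi, ∀ lam : ℝ,
      lam ∈ Set.Icc (-(2 * Real.pi * Real.sqrt (β / 8))) (2 * Real.pi * Real.sqrt (β / 8)) →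
      ‖(∫ y, Complex.exp (Complex.I *
            ((lam * ((countIn 0 θ y : ℝ) - n * θ / (2 * Real.pi)) : ℝ) : ℂ)) ∂(cbe β n))
          - (Real.exp (-(lam ^ 2 / (β * Real.pi ^ 2)) * Real.log (2 + n * θ)) : ℂ)‖
        ≤ C * lam ^ 2 := by
  have hpi := Real.pi_pos
  obtain ⟨C, hC, hC'⟩ := CircularBeta.exists_norm_phaseChar_sub_le hβ
  refine ⟨Real.exp (2 * Real.pi * √(β / 8)) + C * (1 / (2 * Real.pi)) ^ 2, by positivity,
    fun n hn θ hθ l hl => ?_⟩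
  obtain ⟨k, rfl⟩ := Nat.exists_eq_add_of_le' hn
  have hl' : |l| ≤ 2 * Real.pi * √(β / 8) := abs_le.2 hl
  have h1 := CircularBeta.norm_integral_exp_countIn_sub_le hβ hθ hl' k
    ((k + 1 : ℕ) * θ / (2 * Real.pi))
  have h2 := hC' (l / (2 * Real.pi)) (by
    rw [abs_div, abs_of_pos (by positivity : 0 < 2 * Real.pi), div_le_iff₀ (by positivity)]
    linarith) θ hθ k
  have e1 : l / (2 * Real.pi) * ((k + 1 : ℕ) * θ) = l * ((k + 1 : ℕ) * θ / (2 * Real.pi)) := by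
    ring
  have e2 : 4 * (l / (2 * Real.pi)) ^ 2 / β = l ^ 2 / (β * Real.pi ^ 2) := by
    field_simp
    ring
  rw [e1, e2] at h2
  refine (norm_sub_le_norm_sub_add_norm_sub _ _ _).trans ((add_le_add h1 h2).trans_eq ?_)
  ring
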